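/- arXiv:2411.10012 — 4 statements merged into one kernel-verified Lean document; each statement's English description precedes it below -/
import Mathlib

section
/- There is an absolute constant C > 0 with the following property. Let λ ≥ 1, M ≥ 1, 0 < θ ≤ 1 and N₁ ≥ N₂ > 1 be reals, and let g₁, g₂ : ℝ×(1/λ)ℤ → ℂ be supported in {ξ : N₁ ≤ |ξ| ≤ 2N₁} and {ξ : N₂ ≤ |ξ| ≤ 2N₂} respectively, with finite L²_λ norms. Define F(t,x,y) := ∬ e^{i((x,y)·(ξ₁+ξ₂) − t(|ξ₁|²+|ξ₂|²))} · 1[|μ₁−μ₂| ≥ M] · 1[|ξ₁·ξ₂| ≤ θ|ξ₁||ξ₂|] · g₁(ξ₁) g₂(ξ₂) (dξ₁)_λ (dξ₂)_λ, where ξⱼ = (μⱼ,ηⱼ). Then (∫₀¹ ∫_ℝ ∫₀^{2πλ} |F(t,x,y)|² dy dx dt)^{1/2} ≤ C (1/(λM) + θ)^{1/2} ‖g₁‖_{L²_λ} ‖g₂‖_{L²_λ}. -/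
noncomputable section
open MeasureTheory
open scoped ENNReal NNReal Classical

/-- `|ξ|` for `ξ = (μ, j/λ) ∈ ℝ × (1/λ)ℤ`. -/
def fnorm (lam μ : ℝ) (j : ℤ) : ℝ := Real.sqrt (μ ^ 2 + ((j : ℝ) / lam) ^ 2)

/-- Squared `L²_λ` norm of `g : ℝ × (1/λ)ℤ → ℂ`, where `g μ j` stands for `g (μ, j/λ)`. -/
def l2sq (lam : ℝ) (g : ℝ → ℤ → ℂ) : ℝ≥0∞ :=
  ENNReal.ofReal (1 / lam) * ∑' j : ℤ, ∫⁻ μ : ℝ, (‖g μ j‖₊ : ℝ≥0∞) ^ 2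

/-- The bilinear expression
`F(t,x,y) = ∬ e^{i((x,y)·(ξ₁+ξ₂) − t(|ξ₁|²+|ξ₂|²))} 1[|μ₁−μ₂| ≥ M] 1[|ξ₁·ξ₂| ≤ θ|ξ₁||ξ₂|]
  g₁(ξ₁) g₂(ξ₂) (dξ₁)_λ (dξ₂)_λ`. -/
def Fbilin (lam M θ : ℝ) (g₁ g₂ : ℝ → ℤ → ℂ) (t x y : ℝ) : ℂ :=
  ((1 / lam ^ 2 : ℝ) : ℂ) * ∑' j₁ : ℤ, ∑' j₂ : ℤ, ∫ μ₁ : ℝ, ∫ μ₂ : ℝ,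
    if M ≤ |μ₁ - μ₂| ∧
        |μ₁ * μ₂ + ((j₁ : ℝ) / lam) * ((j₂ : ℝ) / lam)| ≤
          θ * fnorm lam μ₁ j₁ * fnorm lam μ₂ j₂ then
      Complex.exp (Complex.I *
        (((x * (μ₁ + μ₂) + y * ((j₁ : ℝ) / lam + (j₂ : ℝ) / lam))
          - t * ((μ₁ ^ 2 + ((j₁ : ℝ) / lam) ^ 2) + (μ₂ ^ 2 + ((j₂ : ℝ) / lam) ^ 2)) : ℝ) : ℂ))
        * g₁ μ₁ j₁ * g₂ μ₂ j₂
    else 0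

lemma tele_max (A : Finset ℤ) (a P : ℤ → ℝ) (hA : A.Nonempty)
    (h : ∀ j ∈ A, ∀ j' ∈ A, j < j' → a j ≤ P j' - P j) :
    ∃ m ∈ A, ∃ n ∈ A, ∑ j ∈ A, a j ≤ P m - P n + a m := by
  induction A using Finset.induction_on_max with
  | empty => simp at hA
  | insert x s hx ih =>
    have hxs : x ∉ s := fun hh => lt_irrefl _ (hx x hh)
    rw [Finset.sum_insert hxs]
    by_cases hs : s.Nonempty
    · obtain ⟨m, hm, n, hn, hmn⟩ := ih hs (fun j hj j' hj' => h j (Finset.mem_insert_of_mem hj) j'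
        (Finset.mem_insert_of_mem hj'))
      refine ⟨x, Finset.mem_insert_self _ _, n, Finset.mem_insert_of_mem hn, ?_⟩
      have := h m (Finset.mem_insert_of_mem hm) x (Finset.mem_insert_self _ _) (hx m hm)
      linarith
    · rw [Finset.not_nonempty_iff_eq_empty] at hs
      subst hs
      exact ⟨x, by simp, x, by simp, by simp⟩

lemma tele_min (A : Finset ℤ) (a P : ℤ → ℝ) (hA : A.Nonempty)
    (h : ∀ j ∈ A, ∀ j' ∈ A, j' < j → a j ≤ P j' - P j) :
    ∃ m ∈ A, ∃ n ∈ A, ∑ j ∈ A, a j ≤ P m - P n + a m := by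
  induction A using Finset.induction_on_min with
  | empty => simp at hA
  | insert x s hx ih =>
    have hxs : x ∉ s := fun hh => lt_irrefl _ (hx x hh)
    rw [Finset.sum_insert hxs]
    by_cases hs : s.Nonempty
    · obtain ⟨m, hm, n, hn, hmn⟩ := ih hs (fun j hj j' hj' => h j (Finset.mem_insert_of_mem hj) j'
        (Finset.mem_insert_of_mem hj'))
      refine ⟨x, Finset.mem_insert_self _ _, n, Finset.mem_insert_of_mem hn, ?_⟩
      have := h m (Finset.mem_insert_of_mem hm) x (Finset.mem_insert_self _ _) (hx m hm)
      linarith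
    · rw [Finset.not_nonempty_iff_eq_empty] at hs
      subst hs
      exact ⟨x, by simp, x, by simp, by simp⟩

lemma step_ineq (R v v' ρ ρ' h : ℝ) (hR : 0 < R) (hv : 0 ≤ v) (hρ : 0 < ρ) (hρ' : 0 < ρ')
    (hh : 0 < h) (hvv : h ≤ v' - v) (e : ρ ^ 2 + v ^ 2 = R ^ 2) (e' : ρ' ^ 2 + v' ^ 2 = R ^ 2) :
    h * R * (1 / ρ) ≤ (v' - ρ') - (v - ρ) := by
  have h1 : ρ' ≤ ρ := by
    by_contra hc
    push Not at hc
    nlinarith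
  have h2 : R ≤ ρ + v := by
    by_contra hc
    push Not at hc
    nlinarith
  have h3 : h * v ≤ (ρ - ρ') * ρ := by
    nlinarith [mul_nonneg hv (sub_nonneg.2 hvv), mul_self_nonneg (ρ - ρ')]
  rw [mul_one_div, div_le_iff₀ hρ]
  nlinarith [mul_le_mul_of_nonneg_left h2 hh.le]

lemma root_sum (lam M R D : ℝ) (K : ℤ) (A : Finset ℤ) (ρ : ℤ → ℝ) (hlam : 1 ≤ lam) (hM : 1 ≤ M)
    (hR : 0 < R) (hD : 0 ≤ D) (hρ : ∀ j ∈ A, M ≤ ρ j)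
    (e : ∀ j ∈ A, ρ j ^ 2 + ((2 * (j : ℝ) - K) / lam) ^ 2 = R ^ 2)
    (h1 : ∀ j ∈ A, ∀ j' ∈ A, |(2 * (j : ℝ) - K) / lam - (2 * (j' : ℝ) - K) / lam| ≤ D)
    (h2 : ∀ j ∈ A, ∀ j' ∈ A, |ρ j - ρ j'| ≤ D) :
    ∑ j ∈ A, 1 / ρ j ≤ 2 * (lam * D / R + 1 / M) := by
  have hl : 0 < lam := by linarith
  have hM0 : 0 < M := by linarith
  have hQ : 0 ≤ lam * D / R + 1 / M := by positivity
  have key : ∀ j j' : ℤ, j < j' → 2 / lam ≤ (2 * (j' : ℝ) - K) / lam - (2 * (j : ℝ) - K) / lam := by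
    intro j j' hj
    have : (j : ℝ) + 1 ≤ j' := by exact_mod_cast hj
    rw [← sub_div]
    gcongr
    linarith
  have hp : ∀ j ∈ A, 0 < ρ j := fun j hj => hM0.trans_le (hρ j hj)
  have hE : ∀ j ∈ A, 1 / ρ j ≤ 1 / M := fun j hj => one_div_le_one_div_of_le hM0 (hρ j hj)
  rw [← Finset.sum_filter_add_sum_filter_not A (fun j => 0 ≤ (2 * (j : ℝ) - K) / lam)]
  have conv : ∀ x y : ℝ, 2 / lam * R * x ≤ y → x ≤ lam / (2 * R) * y := by
    intro x y hxy
    calc x = lam / (2 * R) * (2 / lam * R * x) := by field_simp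
      _ ≤ _ := by gcongr
  have a1 : ∑ j ∈ A.filter (fun j : ℤ => 0 ≤ (2 * (j : ℝ) - K) / lam), 1 / ρ j ≤ lam * D / R + 1 / M := by
    by_cases hne : (A.filter (fun j : ℤ => 0 ≤ (2 * (j : ℝ) - K) / lam)).Nonempty
    · obtain ⟨m, hm, n, hn, hmn⟩ := tele_max _ (fun j => 1 / ρ j)
        (fun j => lam / (2 * R) * ((2 * (j : ℝ) - K) / lam - ρ j)) hne (by
          intro j hj j' hj' hjj
          rw [Finset.mem_filter] at hj hj'
          have := step_ineq R _ _ (ρ j) (ρ j') (2 / lam) hR hj.2 (hp j hj.1) (hp j' hj'.1)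
            (by positivity) (key j j' hjj) (e j hj.1) (e j' hj'.1)
          have := conv _ _ this
          linarith)
      rw [Finset.mem_filter] at hm hn
      have := hE m hm.1
      have b1 := (abs_le.1 (h1 m hm.1 n hn.1)).2
      have b2 := (abs_le.1 (h2 m hm.1 n hn.1)).1
      have b3 : lam / (2 * R) * (((2 * (m : ℝ) - K) / lam - ρ m) - ((2 * (n : ℝ) - K) / lam - ρ n))
          ≤ lam / (2 * R) * (2 * D) := by
        gcongr
        linarith
      have b4 : lam / (2 * R) * (2 * D) = lam * D / R := by field_simp
      linarith
    · rw [Finset.not_nonempty_iff_eq_empty] at hne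
      rw [hne]; simpa using hQ
  have a2 : ∑ j ∈ A.filter (fun j : ℤ => ¬ 0 ≤ (2 * (j : ℝ) - K) / lam), 1 / ρ j ≤ lam * D / R + 1 / M := by
    by_cases hne : (A.filter (fun j : ℤ => ¬ 0 ≤ (2 * (j : ℝ) - K) / lam)).Nonempty
    · obtain ⟨m, hm, n, hn, hmn⟩ := tele_min _ (fun j => 1 / ρ j)
        (fun j => lam / (2 * R) * (-((2 * (j : ℝ) - K) / lam) - ρ j)) hne (by
          intro j hj j' hj' hjj
          rw [Finset.mem_filter] at hj hj'
          have := step_ineq R (-((2 * (j : ℝ) - K) / lam)) (-((2 * (j' : ℝ) - K) / lam)) (ρ j) (ρ j')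
            (2 / lam) hR (by linarith [hj.2]) (hp j hj.1) (hp j' hj'.1)
            (by positivity) (by linarith [key j' j hjj]) (by rw [neg_sq]; exact e j hj.1)
            (by rw [neg_sq]; exact e j' hj'.1)
          have := conv _ _ this
          linarith)
      rw [Finset.mem_filter] at hm hn
      have := hE m hm.1
      have b1 := (abs_le.1 (h1 m hm.1 n hn.1)).1
      have b2 := (abs_le.1 (h2 m hm.1 n hn.1)).1
      have b3 : lam / (2 * R) * ((-((2 * (m : ℝ) - K) / lam) - ρ m) - (-((2 * (n : ℝ) - K) / lam) - ρ n))
          ≤ lam / (2 * R) * (2 * D) := by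
        gcongr
        linarith
      have b4 : lam / (2 * R) * (2 * D) = lam * D / R := by field_simp
      linarith
    · rw [Finset.not_nonempty_iff_eq_empty] at hne
      rw [hne]; simpa using hQ
  linarith

/-- direction cell of side `θ` -/
def cell (θ a b n : ℝ) : ℤ × ℤ := (⌊a / n / θ⌋, ⌊b / n / θ⌋)

lemma floor_close (θ x y : ℝ) (hθ : 0 < θ) (h : ⌊x / θ⌋ = ⌊y / θ⌋) : |x - y| ≤ θ := by
  have := Int.abs_sub_lt_one_of_floor_eq_floor h
  rw [← sub_div, abs_div, abs_of_pos hθ, div_lt_one hθ] at this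
  exact this.le

lemma geom_nb (θ R : ℝ) (hθ : θ ≤ 1 / 2) (hR : 0 < R) (n m a b a' b' : ℝ) (hn : 0 < n) (hm : 0 < m)
    (en : n ^ 2 = a ^ 2 + b ^ 2) (em : m ^ 2 = a' ^ 2 + b' ^ 2)
    (er : (a - a') ^ 2 + (b - b') ^ 2 = R ^ 2) (ed : |a * a' + b * b'| ≤ θ * n * m) :
    n ≤ 2 * R ∧ m ≤ 2 * R := by
  have h1 := (abs_le.1 ed).2
  have h2 : θ * n * m ≤ 1 / 2 * n * m := by gcongr
  have h3 : n ^ 2 + m ^ 2 ≤ 2 * R ^ 2 := by nlinarith [sq_nonneg (n - m)]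
  constructor
  · refine (le_abs_self n).trans (abs_le_of_sq_le_sq ?_ (by positivity))
    nlinarith [sq_nonneg m]
  · refine (le_abs_self m).trans (abs_le_of_sq_le_sq ?_ (by positivity))
    nlinarith [sq_nonneg n]

lemma geom_q (a b c : ℝ) (h1 : c ≤ 1 / 2) (h2 : -(1 / 2) ≤ c) :
    (a ^ 2 + b ^ 2) / 2 ≤ a ^ 2 + b ^ 2 + 2 * (a * b) * c := by
  nlinarith [mul_nonneg (sq_nonneg (a + b)) (by linarith : 0 ≤ c + 1 / 2),
        mul_nonneg (sq_nonneg (a - b)) (by linarith : 0 ≤ 1 / 2 - c)]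

/-- geometry -/
lemma geom (θ R a₁ b₁ n₁ a₂ b₂ n₂ a₁' b₁' n₁' a₂' b₂' n₂' : ℝ) (hθ : 0 < θ)
    (hR : 0 < R)
    (hn₁ : 0 < n₁) (hn₂ : 0 < n₂) (hn₁' : 0 < n₁') (hn₂' : 0 < n₂')
    (e₁ : n₁ ^ 2 = a₁ ^ 2 + b₁ ^ 2) (e₂ : n₂ ^ 2 = a₂ ^ 2 + b₂ ^ 2)
    (e₁' : n₁' ^ 2 = a₁' ^ 2 + b₁' ^ 2) (e₂' : n₂' ^ 2 = a₂' ^ 2 + b₂' ^ 2)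
    (sa : a₁ + a₂ = a₁' + a₂') (sb : b₁ + b₂ = b₁' + b₂')
    (r : (a₁ - a₂) ^ 2 + (b₁ - b₂) ^ 2 = R ^ 2) (r' : (a₁' - a₂') ^ 2 + (b₁' - b₂') ^ 2 = R ^ 2)
    (d : |a₁ * a₂ + b₁ * b₂| ≤ θ * n₁ * n₂) (d' : |a₁' * a₂' + b₁' * b₂'| ≤ θ * n₁' * n₂')
    (c₁ : cell θ a₁ b₁ n₁ = cell θ a₁' b₁' n₁') (c₂ : cell θ a₂ b₂ n₂ = cell θ a₂' b₂' n₂') :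
    |(a₁ - a₂) - (a₁' - a₂')| ≤ 20 * θ * R ∧ |(b₁ - b₂) - (b₁' - b₂')| ≤ 20 * θ * R := by
  by_cases hθ2 : 1 / 2 < θ
  · have q : ∀ x y : ℝ, x ^ 2 + y ^ 2 = R ^ 2 → |x| ≤ R ∧ |y| ≤ R := fun x y h =>
      ⟨abs_le_of_sq_le_sq (by nlinarith) hR.le, abs_le_of_sq_le_sq (by nlinarith) hR.le⟩
    have q1 := q _ _ r
    have q2 := q _ _ r'
    have : 2 * R ≤ 20 * θ * R := by nlinarith
    constructor
    · exact (abs_sub _ _).trans (by linarith [q1.1, q2.1])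
    · exact (abs_sub _ _).trans (by linarith [q1.2, q2.2])
  · push Not at hθ2
    obtain ⟨m1, m2⟩ := geom_nb θ R hθ2 hR n₁ n₂ _ _ _ _ hn₁ hn₂ e₁ e₂ r d
    obtain ⟨m1', m2'⟩ := geom_nb θ R hθ2 hR n₁' n₂' _ _ _ _ hn₁' hn₂' e₁' e₂' r' d'
    simp only [cell, Prod.mk.injEq] at c₁ c₂
    have x1 := floor_close θ _ _ hθ c₁.1
    have y1 := floor_close θ _ _ hθ c₁.2
    have x2 := floor_close θ _ _ hθ c₂.1
    have y2 := floor_close θ _ _ hθ c₂.2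
    set p₁ := a₁ / n₁ with hp₁
    set q₁ := b₁ / n₁ with hq₁
    set p₂ := a₂ / n₂ with hp₂
    set q₂ := b₂ / n₂ with hq₂
    set p₁' := a₁' / n₁' with hp₁'
    set q₁' := b₁' / n₁' with hq₁'
    set p₂' := a₂' / n₂' with hp₂'
    set q₂' := b₂' / n₂' with hq₂'
    have ea₁ : a₁ = n₁ * p₁ := by rw [hp₁]; field_simp
    have eb₁ : b₁ = n₁ * q₁ := by rw [hq₁]; field_simp
    have ea₂ : a₂ = n₂ * p₂ := by rw [hp₂]; field_simp
    have eb₂ : b₂ = n₂ * q₂ := by rw [hq₂]; field_simp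
    have ea₁' : a₁' = n₁' * p₁' := by rw [hp₁']; field_simp
    have eb₁' : b₁' = n₁' * q₁' := by rw [hq₁']; field_simp
    have ea₂' : a₂' = n₂' * p₂' := by rw [hp₂']; field_simp
    have eb₂' : b₂' = n₂' * q₂' := by rw [hq₂']; field_simp
    have u1 : p₁ ^ 2 + q₁ ^ 2 = 1 := by
      rw [hp₁, hq₁, div_pow, div_pow, ← add_div, ← e₁, div_self (by positivity)]
    have u2 : p₂ ^ 2 + q₂ ^ 2 = 1 := by
      rw [hp₂, hq₂, div_pow, div_pow, ← add_div, ← e₂, div_self (by positivity)]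
    clear_value p₁ q₁ p₂ q₂ p₁' q₁' p₂' q₂'
    have dd : |p₁ * p₂ + q₁ * q₂| ≤ θ := by
      have : a₁ * a₂ + b₁ * b₂ = n₁ * n₂ * (p₁ * p₂ + q₁ * q₂) := by rw [ea₁, ea₂, eb₁, eb₂]; ring
      rw [this, abs_mul, abs_of_pos (by positivity)] at d
      have hpos : 0 < n₁ * n₂ := by positivity
      rw [mul_comm, mul_assoc] at d
      exact le_of_mul_le_mul_right (by linarith only [d]) hpos
    have dd2 := (abs_le.1 dd)
    -- error vectors
    have X1 : |n₁' * (p₁ - p₁')| ≤ 2 * R * θ := by rw [abs_mul, abs_of_pos hn₁']; gcongr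
    have Y1 : |n₁' * (q₁ - q₁')| ≤ 2 * R * θ := by rw [abs_mul, abs_of_pos hn₁']; gcongr
    have X2 : |n₂' * (p₂ - p₂')| ≤ 2 * R * θ := by rw [abs_mul, abs_of_pos hn₂']; gcongr
    have Y2 : |n₂' * (q₂ - q₂')| ≤ 2 * R * θ := by rw [abs_mul, abs_of_pos hn₂']; gcongr
    have EX : (n₁' - n₁) * p₁ + (n₂' - n₂) * p₂ = n₁' * (p₁ - p₁') + n₂' * (p₂ - p₂') := by
      rw [ea₁, ea₂, ea₁', ea₂'] at sa; linarith
    have EY : (n₁' - n₁) * q₁ + (n₂' - n₂) * q₂ = n₁' * (q₁ - q₁') + n₂' * (q₂ - q₂') := by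
      rw [eb₁, eb₂, eb₁', eb₂'] at sb; linarith
    have BX : |(n₁' - n₁) * p₁ + (n₂' - n₂) * p₂| ≤ 4 * R * θ := by
      rw [EX]; exact (abs_add_le _ _).trans (by linarith)
    have BY : |(n₁' - n₁) * q₁ + (n₂' - n₂) * q₂| ≤ 4 * R * θ := by
      rw [EY]; exact (abs_add_le _ _).trans (by linarith)
    set a := n₁' - n₁ with ha
    set b := n₂' - n₂ with hb
    have Q : a ^ 2 + b ^ 2 + 2 * (a * b) * (p₁ * p₂ + q₁ * q₂) ≤ 2 * (4 * R * θ) ^ 2 := by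
      have s1 := sq_le_sq' (abs_le.1 BX).1 (abs_le.1 BX).2
      have s2 := sq_le_sq' (abs_le.1 BY).1 (abs_le.1 BY).2
      have : a ^ 2 + b ^ 2 + 2 * (a * b) * (p₁ * p₂ + q₁ * q₂) =
        (a * p₁ + b * p₂) ^ 2 + (a * q₁ + b * q₂) ^ 2 := by
        linear_combination (- a ^ 2) * u1 - b ^ 2 * u2
      linarith
    have Q2 : (a ^ 2 + b ^ 2) / 2 ≤ a ^ 2 + b ^ 2 + 2 * (a * b) * (p₁ * p₂ + q₁ * q₂) := by
      exact geom_q a b _ (by linarith) (by linarith)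
    have A : |a| ≤ 8 * R * θ := by
      apply abs_le_of_sq_le_sq _ (by positivity)
      nlinarith only [sq_nonneg b, Q, Q2]
    have pb : |p₁| ≤ 1 := by apply abs_le_of_sq_le_sq _ (by norm_num); nlinarith only [u1, sq_nonneg p₁, sq_nonneg q₁]
    have qb : |q₁| ≤ 1 := by apply abs_le_of_sq_le_sq _ (by norm_num); nlinarith only [u1, sq_nonneg p₁, sq_nonneg q₁]
    have AP : |a * p₁| ≤ 8 * R * θ := by
      rw [abs_mul]; calc |a| * |p₁| ≤ |a| * 1 := by gcongr
        _ ≤ _ := by linarith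
    have AQ : |a * q₁| ≤ 8 * R * θ := by
      rw [abs_mul]; calc |a| * |q₁| ≤ |a| * 1 := by gcongr
        _ ≤ _ := by linarith
    constructor
    · have : (a₁ - a₂) - (a₁' - a₂') = 2 * (n₁' * (p₁ - p₁') - a * p₁) := by
        rw [ha]; linear_combination (-1) * sa + 2 * ea₁ - 2 * ea₁'
      rw [this, abs_mul, abs_two]
      have := abs_sub (n₁' * (p₁ - p₁')) (a * p₁)
      linarith
    · have : (b₁ - b₂) - (b₁' - b₂') = 2 * (n₁' * (q₁ - q₁') - a * q₁) := by
        rw [ha]; linear_combination (-1) * sb + 2 * eb₁ - 2 * eb₁'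
      rw [this, abs_mul, abs_two]
      have := abs_sub (n₁' * (q₁ - q₁')) (a * q₁)
      linarith

def kap (lam θ μ : ℝ) (j : ℤ) : ℤ × ℤ := cell θ μ ((j : ℝ) / lam) (fnorm lam μ j)

def Creg (lam M θ : ℝ) (μ₁ : ℝ) (j₁ : ℤ) (μ₂ : ℝ) (j₂ : ℤ) : Prop :=
  M ≤ |μ₁ - μ₂| ∧ |μ₁ * μ₂ + ((j₁ : ℝ) / lam) * ((j₂ : ℝ) / lam)| ≤
          θ * fnorm lam μ₁ j₁ * fnorm lam μ₂ j₂

def Sreg (lam M θ : ℝ) (k l : ℤ × ℤ) (μ₁ : ℝ) (j₁ : ℤ) (μ₂ : ℝ) (j₂ : ℤ) : Prop :=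
  Creg lam M θ μ₁ j₁ μ₂ j₂ ∧ (0 < fnorm lam μ₁ j₁ ∧ kap lam θ μ₁ j₁ = k) ∧
   (0 < fnorm lam μ₂ j₂ ∧ kap lam θ μ₂ j₂ = l)

lemma fnorm_sq (lam μ : ℝ) (j : ℤ) : fnorm lam μ j ^ 2 = μ ^ 2 + ((j : ℝ) / lam) ^ 2 :=
  Real.sq_sqrt (by positivity)

lemma measurable_fnorm (lam : ℝ) (j : ℤ) : Measurable (fun μ => fnorm lam μ j) := by
  unfold fnorm; fun_prop

lemma measurable_kap (lam θ : ℝ) (j : ℤ) : Measurable (fun μ => kap lam θ μ j) := by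
  unfold kap cell
  have := measurable_fnorm lam j
  apply Measurable.prodMk
  · exact Int.measurable_floor.comp (by fun_prop)
  · exact Int.measurable_floor.comp (by fun_prop)

lemma measurableSet_Creg (lam M θ : ℝ) (j₁ j₂ : ℤ) :
    MeasurableSet {p : ℝ × ℝ | Creg lam M θ p.1 j₁ p.2 j₂} := by
  have m1 : Measurable (fun p : ℝ × ℝ => fnorm lam p.1 j₁) :=
    (measurable_fnorm lam j₁).comp measurable_fst
  have m2 : Measurable (fun p : ℝ × ℝ => fnorm lam p.2 j₂) :=
    (measurable_fnorm lam j₂).comp measurable_snd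
  unfold Creg
  have hA : MeasurableSet {p : ℝ × ℝ | M ≤ |p.1 - p.2|} :=
    measurableSet_le (by fun_prop) (by fun_prop)
  have hB : MeasurableSet {p : ℝ × ℝ | |p.1 * p.2 + ((j₁ : ℝ) / lam) * ((j₂ : ℝ) / lam)| ≤
          θ * fnorm lam p.1 j₁ * fnorm lam p.2 j₂} :=
    measurableSet_le (by fun_prop) ((measurable_const.mul m1).mul m2)
  exact hA.inter hB

lemma measurableSet_cellset (lam θ : ℝ) (j : ℤ) (k : ℤ × ℤ) :
    MeasurableSet {μ : ℝ | 0 < fnorm lam μ j ∧ kap lam θ μ j = k} := by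
  refine MeasurableSet.inter (measurableSet_lt measurable_const (measurable_fnorm lam j)) ?_
  exact measurable_kap lam θ j (measurableSet_singleton k)

lemma measurableSet_Sreg (lam M θ : ℝ) (k l : ℤ × ℤ) (j₁ j₂ : ℤ) :
    MeasurableSet {p : ℝ × ℝ | Sreg lam M θ k l p.1 j₁ p.2 j₂} := by
  unfold Sreg
  refine (measurableSet_Creg lam M θ j₁ j₂).inter (MeasurableSet.inter ?_ ?_)
  · exact measurable_fst (measurableSet_cellset lam θ j₁ k)
  · exact measurable_snd (measurableSet_cellset lam θ j₂ l)

lemma point_sum (lam M θ : ℝ) (k l : ℤ × ℤ) (hlam : 1 ≤ lam) (hM : 1 ≤ M) (hθ : 0 < θ)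
    (s σ τ : ℝ) (hs : s = 1 ∨ s = -1) (K : ℤ) (ρ : ℤ → ℝ)
    (hρ : ∀ j, ρ j = √(2 * (τ - (((j : ℝ) / lam) ^ 2 + (((K - j : ℤ) : ℝ) / lam) ^ 2)) - σ ^ 2)) :
    ∑' j : ℤ, (if 0 < ρ j ∧
        Sreg lam M θ k l ((σ + s * ρ j) / 2) j ((σ - s * ρ j) / 2) (K - j) then
        ENNReal.ofReal (1 / (2 * ρ j)) else 0) ≤ ENNReal.ofReal (lam * (20 * θ) + 1 / M) := by
  have hl : 0 < lam := by linarith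
  have hM0 : 0 < M := by linarith
  rw [ENNReal.tsum_eq_iSup_sum]
  refine iSup_le fun S => ?_
  rw [← Finset.sum_filter]
  set A := S.filter (fun j => 0 < ρ j ∧
        Sreg lam M θ k l ((σ + s * ρ j) / 2) j ((σ - s * ρ j) / 2) (K - j)) with hA
  have hmem : ∀ j ∈ A, 0 < ρ j ∧
        Sreg lam M θ k l ((σ + s * ρ j) / 2) j ((σ - s * ρ j) / 2) (K - j) := fun j hj =>
    (Finset.mem_filter.1 hj).2
  rw [← ENNReal.ofReal_sum_of_nonneg (fun j hj => by have := (hmem j hj).1; positivity)]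
  apply ENNReal.ofReal_le_ofReal
  rcases A.eq_empty_or_nonempty with hem | ⟨j₀, hj₀⟩
  · rw [hem]; simp; positivity
  set R := √(2 * τ - σ ^ 2 - ((K : ℝ) / lam) ^ 2) with hR
  have hsq : s ^ 2 = 1 := by rcases hs with h | h <;> rw [h] <;> norm_num
  have sqρ : ∀ j ∈ A, ρ j ^ 2 =
      2 * (τ - (((j : ℝ) / lam) ^ 2 + (((K - j : ℤ) : ℝ) / lam) ^ 2)) - σ ^ 2 := by
    intro j hj
    have := (hmem j hj).1
    rw [hρ j] at this ⊢
    exact Real.sq_sqrt (Real.sqrt_pos.1 this).le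
  have e0 : ∀ j ∈ A, ρ j ^ 2 + ((2 * (j : ℝ) - K) / lam) ^ 2 =
      2 * τ - σ ^ 2 - ((K : ℝ) / lam) ^ 2 := by
    intro j hj
    rw [sqρ j hj]; push_cast; ring
  have hpos : 0 < 2 * τ - σ ^ 2 - ((K : ℝ) / lam) ^ 2 := by
    rw [← e0 j₀ hj₀]
    have := (hmem j₀ hj₀).1
    positivity
  have hR0 : 0 < R := Real.sqrt_pos.2 hpos
  have hR2 : R ^ 2 = 2 * τ - σ ^ 2 - ((K : ℝ) / lam) ^ 2 := Real.sq_sqrt hpos.le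
  have e : ∀ j ∈ A, ρ j ^ 2 + ((2 * (j : ℝ) - K) / lam) ^ 2 = R ^ 2 := fun j hj => by
    rw [hR2, e0 j hj]
  have habs : |s| = 1 := by rcases hs with h | h <;> rw [h] <;> norm_num
  have G : ∀ j ∈ A, ∀ j' ∈ A,
      |ρ j - ρ j'| ≤ 20 * θ * R ∧
      |(2 * (j : ℝ) - K) / lam - (2 * (j' : ℝ) - K) / lam| ≤ 20 * θ * R := by
    intro j hj j' hj'
    obtain ⟨hp, ⟨hc1, hc2⟩, ⟨hf1, hk1⟩, ⟨hf2, hk2⟩⟩ := hmem j hj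
    obtain ⟨hp', ⟨hc1', hc2'⟩, ⟨hf1', hk1'⟩, ⟨hf2', hk2'⟩⟩ := hmem j' hj'
    have := geom θ R _ _ _ _ _ _ _ _ _ _ _ _ hθ hR0 hf1 hf2 hf1' hf2'
      (fnorm_sq _ _ _) (fnorm_sq _ _ _) (fnorm_sq _ _ _) (fnorm_sq _ _ _)
      (by ring) (by push_cast; ring)
      (by rw [← e j hj]; push_cast; linear_combination (ρ j ^ 2) * hsq)
      (by rw [← e j' hj']; push_cast; linear_combination (ρ j' ^ 2) * hsq)
      hc2 hc2' (hk1.trans hk1'.symm) (hk2.trans hk2'.symm)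
    have i1 : (σ + s * ρ j) / 2 - (σ - s * ρ j) / 2 - ((σ + s * ρ j') / 2 - (σ - s * ρ j') / 2)
        = s * (ρ j - ρ j') := by ring
    have i2 : (j : ℝ) / lam - ((K - j : ℤ) : ℝ) / lam - ((j' : ℝ) / lam - ((K - j' : ℤ) : ℝ) / lam)
      = (2 * (j : ℝ) - K) / lam - (2 * (j' : ℝ) - K) / lam := by push_cast; ring
    rw [i1, i2, abs_mul, habs, one_mul] at this
    exact this
  have hMρ : ∀ j ∈ A, M ≤ ρ j := by
    intro j hj
    obtain ⟨hp, ⟨hc1, hc2⟩, -⟩ := hmem j hj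
    have i1 : (σ + s * ρ j) / 2 - (σ - s * ρ j) / 2 = s * ρ j := by ring
    rw [i1, abs_mul, habs, one_mul, abs_of_pos hp] at hc1
    exact hc1
  have := root_sum lam M R (20 * θ * R) K A ρ hlam hM hR0 (by positivity) hMρ e
    (fun j hj j' hj' => (G j hj j' hj').2) (fun j hj j' hj' => (G j hj j' hj').1)
  have h2 : ∑ j ∈ A, 1 / (2 * ρ j) = 1 / 2 * ∑ j ∈ A, 1 / ρ j := by
    rw [Finset.mul_sum]
    refine Finset.sum_congr rfl fun j _ => ?_
    rw [one_div_mul_one_div]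
  rw [h2]
  have h3 : lam * (20 * θ * R) / R = lam * (20 * θ) := by field_simp
  rw [h3] at this
  linarith

lemma half_cov (s σ e : ℝ) (hs : s = 1 ∨ s = -1) (P : ℝ → Prop) (f : ℝ → ℝ≥0∞) :
    ∫⁻ μ in {μ : ℝ | 0 < s * (2 * μ - σ)}, (if P μ then f (μ ^ 2 + (σ - μ) ^ 2 + e) else 0) ≤
    ∫⁻ τ, (if 0 < √(2 * (τ - e) - σ ^ 2) ∧ P ((σ + s * √(2 * (τ - e) - σ ^ 2)) / 2) then
      ENNReal.ofReal (1 / (2 * √(2 * (τ - e) - σ ^ 2))) else 0) * f τ := by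
  have hsq : s * s = 1 := by rcases hs with h | h <;> rw [h] <;> norm_num
  have habs : |s| = 1 := by rcases hs with h | h <;> rw [h] <;> norm_num
  have hms : MeasurableSet {μ : ℝ | 0 < s * (2 * μ - σ)} :=
    measurableSet_lt measurable_const (by fun_prop)
  have hroot : ∀ μ ∈ {μ : ℝ | 0 < s * (2 * μ - σ)},
      √(2 * ((μ ^ 2 + (σ - μ) ^ 2 + e) - e) - σ ^ 2) = s * (2 * μ - σ) := by
    intro μ hμ
    rw [← Real.sqrt_sq (le_of_lt hμ)]
    congr 1
    linear_combination (-(2 * μ - σ) ^ 2) * hsq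
  have hinv : ∀ μ : ℝ, (σ + s * (s * (2 * μ - σ))) / 2 = μ := by
    intro μ
    linear_combination ((2 * μ - σ) / 2) * hsq
  have := lintegral_image_eq_lintegral_abs_deriv_mul hms
    (f := fun μ => μ ^ 2 + (σ - μ) ^ 2 + e) (f' := fun μ => 2 * (2 * μ - σ))
    (fun μ _ => by
      have h1 : HasDerivAt (fun μ : ℝ => μ ^ 2 + (σ - μ) ^ 2 + e) (2 * (2 * μ - σ)) μ := by
        have a := (hasDerivAt_id μ).pow 2
        have b := ((hasDerivAt_id μ).const_sub σ).pow 2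
        have c := (a.add b).add_const e
        exact c.congr_deriv (by norm_num; ring)
      exact h1.hasDerivWithinAt)
    (by
      intro x hx y hy hxy
      have h1 := hroot x hx
      have h2 := hroot y hy
      have hxy' : x ^ 2 + (σ - x) ^ 2 + e = y ^ 2 + (σ - y) ^ 2 + e := hxy
      rw [hxy', h2] at h1
      rw [← hinv x, ← hinv y, h1])
    (fun τ => (if 0 < √(2 * (τ - e) - σ ^ 2) ∧ P ((σ + s * √(2 * (τ - e) - σ ^ 2)) / 2) then
      ENNReal.ofReal (1 / (2 * √(2 * (τ - e) - σ ^ 2))) else 0) * f τ)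
  refine le_trans (le_of_eq ?_) (this.symm.le.trans (setLIntegral_le_lintegral _ _))
  refine setLIntegral_congr_fun hms fun μ hμ => ?_
  rw [hroot μ hμ, hinv μ]
  have hμ' : 0 < s * (2 * μ - σ) := hμ
  by_cases hP : P μ
  · rw [if_pos hP, if_pos ⟨hμ', hP⟩, ← mul_assoc, ← ENNReal.ofReal_mul (abs_nonneg _)]
    have : |2 * (2 * μ - σ)| = 2 * (s * (2 * μ - σ)) := by
      have := abs_of_pos hμ'
      rw [abs_mul, habs, one_mul] at this
      rw [abs_mul, this, abs_two]
    rw [this, mul_one_div, div_self (by positivity), ENNReal.ofReal_one, one_mul]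
  · rw [if_neg hP, if_neg (fun h => hP h.2), zero_mul, mul_zero]

lemma full_cov (σ e : ℝ) (P : ℝ → Prop) (hP : ∀ μ, P μ → μ ≠ σ / 2) (f : ℝ → ℝ≥0∞) :
    ∫⁻ μ, (if P μ then f (μ ^ 2 + (σ - μ) ^ 2 + e) else 0) ≤
    (∫⁻ τ, (if 0 < √(2 * (τ - e) - σ ^ 2) ∧ P ((σ + 1 * √(2 * (τ - e) - σ ^ 2)) / 2) then
      ENNReal.ofReal (1 / (2 * √(2 * (τ - e) - σ ^ 2))) else 0) * f τ) +
    ∫⁻ τ, (if 0 < √(2 * (τ - e) - σ ^ 2) ∧ P ((σ + (-1) * √(2 * (τ - e) - σ ^ 2)) / 2) then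
      ENNReal.ofReal (1 / (2 * √(2 * (τ - e) - σ ^ 2))) else 0) * f τ := by
  refine le_trans ?_ (add_le_add (half_cov 1 σ e (Or.inl rfl) P f) (half_cov (-1) σ e (Or.inr rfl) P f))
  have hms : ∀ s : ℝ, MeasurableSet {μ : ℝ | 0 < s * (2 * μ - σ)} := fun s =>
    measurableSet_lt measurable_const (by fun_prop)
  rw [← lintegral_union (hms _)]
  · rw [← lintegral_indicator ((hms _).union (hms _))]
    refine lintegral_mono fun μ => ?_
    by_cases h : P μ
    · rw [Set.indicator_of_mem]
      rcases lt_or_gt_of_ne (hP μ h) with h | h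
      · right; simp only [Set.mem_ofPred_eq]; linarith
      · left; simp only [Set.mem_ofPred_eq]; linarith
    · simp [h]
  · rw [Set.disjoint_left]
    intro μ h1 h2
    simp only [Set.mem_ofPred_eq] at h1 h2
    linarith

/-- the time frequency -/
def tau (lam μ₁ : ℝ) (j₁ : ℤ) (μ₂ : ℝ) (j₂ : ℤ) : ℝ :=
  (μ₁ ^ 2 + ((j₁ : ℝ) / lam) ^ 2) + (μ₂ ^ 2 + ((j₂ : ℝ) / lam) ^ 2)

lemma measurable_tau (lam : ℝ) (j₁ j₂ : ℤ) :
    Measurable (fun p : ℝ × ℝ => tau lam p.1 j₁ p.2 j₂) := by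
  unfold tau; fun_prop

lemma transfer_fixed (lam M θ : ℝ) (k l : ℤ × ℤ) (hlam : 1 ≤ lam) (hM : 1 ≤ M) (hθ : 0 < θ)
    (K : ℤ) (σ : ℝ) (f : ℝ → ℝ≥0∞) (hf : Measurable f) :
    ∑' j : ℤ, ∫⁻ μ, (if Sreg lam M θ k l μ j (σ - μ) (K - j) then
      f (tau lam μ j (σ - μ) (K - j)) else 0) ≤
    ENNReal.ofReal (2 * (lam * (20 * θ) + 1 / M)) * ∫⁻ τ, f τ := by
  have hM0 : 0 < M := by linarith
  set ρ : ℤ → ℝ → ℝ := fun j τ =>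
    √(2 * (τ - (((j : ℝ) / lam) ^ 2 + (((K - j : ℤ) : ℝ) / lam) ^ 2)) - σ ^ 2) with hρ
  have hρm : ∀ j, Measurable (ρ j) := fun j => by rw [hρ]; fun_prop
  set w : ℝ → ℤ → ℝ → ℝ≥0∞ := fun s j τ => (if 0 < ρ j τ ∧
        Sreg lam M θ k l ((σ + s * ρ j τ) / 2) j ((σ - s * ρ j τ) / 2) (K - j) then
        ENNReal.ofReal (1 / (2 * ρ j τ)) else 0) with hw
  have hwm : ∀ s j, Measurable (w s j) := by
    intro s j
    have hj := hρm j
    refine Measurable.ite ?_ (by fun_prop) measurable_const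
    refine (measurableSet_lt measurable_const hj).inter ?_
    have : Measurable (fun τ => ((σ + s * ρ j τ) / 2, (σ - s * ρ j τ) / 2)) := by fun_prop
    exact this (measurableSet_Sreg lam M θ k l j (K - j))
  have hS : ∀ s : ℝ, s = 1 ∨ s = -1 → ∑' j, ∫⁻ τ, w s j τ * f τ ≤
      ENNReal.ofReal (lam * (20 * θ) + 1 / M) * ∫⁻ τ, f τ := by
    intro s hs
    rw [← lintegral_tsum (f := fun j τ => w s j τ * f τ)
      (fun j => ((hwm s j).mul hf).aemeasurable), ← lintegral_const_mul _ hf]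
    refine lintegral_mono fun τ => ?_
    rw [ENNReal.tsum_mul_right]
    gcongr
    exact point_sum lam M θ k l hlam hM hθ s σ τ hs K (fun j => ρ j τ) (fun j => rfl)
  have hB : ENNReal.ofReal (2 * (lam * (20 * θ) + 1 / M)) = ENNReal.ofReal (lam * (20 * θ) + 1 / M) +
      ENNReal.ofReal (lam * (20 * θ) + 1 / M) := by
    rw [← ENNReal.ofReal_add (by positivity) (by positivity)]; congr 1; ring
  rw [hB, add_mul]
  refine le_trans ?_ (add_le_add (hS 1 (Or.inl rfl)) (hS (-1) (Or.inr rfl)))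
  rw [← ENNReal.tsum_add]
  refine ENNReal.tsum_le_tsum fun j => ?_
  have h := full_cov σ (((j : ℝ) / lam) ^ 2 + (((K - j : ℤ) : ℝ) / lam) ^ 2)
    (fun μ => Sreg lam M θ k l μ j (σ - μ) (K - j)) (by
      rintro μ ⟨⟨h, -⟩, -⟩ rfl
      have : σ / 2 - (σ - σ / 2) = 0 := by ring
      rw [this, abs_zero] at h
      linarith) f
  have e1 : ∀ μ, tau lam μ j (σ - μ) (K - j) = μ ^ 2 + (σ - μ) ^ 2 +
      (((j : ℝ) / lam) ^ 2 + (((K - j : ℤ) : ℝ) / lam) ^ 2) := by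
    intro μ; unfold tau; ring
  simp only [e1]
  refine h.trans (le_of_eq ?_)
  congr 1
  · refine lintegral_congr fun τ => ?_
    simp only [hw]
    have e2 : ∀ x : ℝ, σ - (σ + 1 * x) / 2 = (σ - 1 * x) / 2 := fun x => by ring
    rw [e2]
  · refine lintegral_congr fun τ => ?_
    simp only [hw]
    have e2 : ∀ x : ℝ, σ - (σ + -1 * x) / 2 = (σ - -1 * x) / 2 := fun x => by ring
    rw [e2]

lemma transfer (lam M θ : ℝ) (k l : ℤ × ℤ) (hlam : 1 ≤ lam) (hM : 1 ≤ M) (hθ : 0 < θ)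
    (ψ : ℤ → ℝ × ℝ → ℝ≥0∞) (hψ : ∀ K, Measurable (ψ K)) :
    ∑' j₁ : ℤ, ∑' j₂ : ℤ, ∫⁻ μ₁, ∫⁻ μ₂, (if Sreg lam M θ k l μ₁ j₁ μ₂ j₂ then
      ψ (j₁ + j₂) (μ₁ + μ₂, tau lam μ₁ j₁ μ₂ j₂) else 0) ≤
    ENNReal.ofReal (2 * (lam * (20 * θ) + 1 / M)) * ∑' K, ∫⁻ σ, ∫⁻ τ, ψ K (σ, τ) := by
  have hmeas : ∀ j₁ K : ℤ, Measurable (fun p : ℝ × ℝ =>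
      (if Sreg lam M θ k l p.2 j₁ (p.1 - p.2) (K - j₁) then
      ψ K (p.1, tau lam p.2 j₁ (p.1 - p.2) (K - j₁)) else 0)) := by
    intro j₁ K
    have h1 : Measurable (fun p : ℝ × ℝ => (p.2, p.1 - p.2)) := by fun_prop
    refine Measurable.ite (h1 (measurableSet_Sreg lam M θ k l j₁ (K - j₁))) ?_ measurable_const
    exact (hψ K).comp (measurable_fst.prodMk ((measurable_tau lam j₁ (K - j₁)).comp h1))
  have step1 : ∀ j₁ : ℤ, ∑' j₂ : ℤ, ∫⁻ μ₁, ∫⁻ μ₂, (if Sreg lam M θ k l μ₁ j₁ μ₂ j₂ then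
      ψ (j₁ + j₂) (μ₁ + μ₂, tau lam μ₁ j₁ μ₂ j₂) else 0) =
      ∑' K : ℤ, ∫⁻ σ, ∫⁻ μ, (if Sreg lam M θ k l μ j₁ (σ - μ) (K - j₁) then
      ψ K (σ, tau lam μ j₁ (σ - μ) (K - j₁)) else 0) := by
    intro j₁
    rw [← (Equiv.subRight j₁).tsum_eq]
    refine tsum_congr fun K => ?_
    simp only [Equiv.subRight_apply, add_sub_cancel]
    symm
    rw [lintegral_lintegral_swap (hmeas j₁ K).aemeasurable]
    symm
    refine lintegral_congr fun μ₁ => ?_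
    rw [← lintegral_sub_right_eq_self _ μ₁]
    simp only [add_sub_cancel]
  simp_rw [step1]
  rw [ENNReal.tsum_comm, ← ENNReal.tsum_mul_left]
  refine ENNReal.tsum_le_tsum fun K => ?_
  rw [← lintegral_tsum (fun j => ((hmeas j K).lintegral_prod_right').aemeasurable),
    ← lintegral_const_mul _ ((hψ K).lintegral_prod_right')]
  refine lintegral_mono fun σ => ?_
  exact transfer_fixed lam M θ k l hlam hM hθ K σ (fun τ => ψ K (σ, τ))
    ((hψ K).comp measurable_prodMk_left)

lemma CS_lint {α : Type*} [MeasurableSpace α] (μ : Measure α) (f g : α → ℝ≥0∞)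
    (hf : AEMeasurable f μ) (hg : AEMeasurable g μ) :
    ∫⁻ a, f a * g a ∂μ ≤ (∫⁻ a, f a ^ 2 ∂μ) ^ (1 / 2 : ℝ) * (∫⁻ a, g a ^ 2 ∂μ) ^ (1 / 2 : ℝ) := by
  have := ENNReal.lintegral_mul_le_Lp_mul_Lq μ (p := 2) (q := 2)
    (Real.holderConjugate_iff.mpr ⟨by norm_num, by norm_num⟩) hf hg
  simpa [ENNReal.rpow_two] using this

lemma CS_tsum (f g : ℤ × ℤ → ℝ≥0∞) :
    ∑' k, f k * g k ≤ (∑' k, f k ^ 2) ^ (1 / 2 : ℝ) * (∑' k, g k ^ 2) ^ (1 / 2 : ℝ) := by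
  have := CS_lint (Measure.count : Measure (ℤ × ℤ)) f g (measurable_of_countable _).aemeasurable
    (measurable_of_countable _).aemeasurable
  simpa [lintegral_count] using this

lemma meas_quad (f : ℤ → ℤ → ℝ × ℝ → ℝ≥0∞) (hf : ∀ i j, Measurable (f i j)) :
    Measurable (fun q : (ℤ × ℤ) × (ℝ × ℝ) => f q.1.1 q.1.2 q.2) :=
  measurable_from_prod_countable_right (fun x => hf x.1 x.2)

lemma lint_quad (f : ℤ → ℤ → ℝ × ℝ → ℝ≥0∞) (hf : ∀ i j, Measurable (f i j)) :
    ∫⁻ q, f q.1.1 q.1.2 q.2 ∂((Measure.count : Measure (ℤ × ℤ)).prod (volume : Measure (ℝ × ℝ))) =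
    ∑' i, ∑' j, ∫⁻ x, ∫⁻ y, f i j (x, y) := by
  rw [lintegral_prod _ (meas_quad f hf).aemeasurable, lintegral_count,
    ENNReal.tsum_prod (f := fun i j => ∫⁻ y, f i j y)]
  refine tsum_congr fun i => tsum_congr fun j => ?_
  rw [Measure.volume_eq_prod, lintegral_prod _ (hf i j).aemeasurable]

lemma CS_quad (f g : ℤ → ℤ → ℝ × ℝ → ℝ≥0∞) (hf : ∀ i j, Measurable (f i j))
    (hg : ∀ i j, Measurable (g i j)) :
    ∑' i, ∑' j, ∫⁻ x, ∫⁻ y, f i j (x, y) * g i j (x, y) ≤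
      (∑' i, ∑' j, ∫⁻ x, ∫⁻ y, f i j (x, y) ^ 2) ^ (1 / 2 : ℝ) *
      (∑' i, ∑' j, ∫⁻ x, ∫⁻ y, g i j (x, y) ^ 2) ^ (1 / 2 : ℝ) := by
  have := CS_lint ((Measure.count : Measure (ℤ × ℤ)).prod (volume : Measure (ℝ × ℝ))) _ _
    (meas_quad f hf).aemeasurable (meas_quad g hg).aemeasurable
  rw [lint_quad (fun i j p => f i j p * g i j p) (fun i j => (hf i j).mul (hg i j)),
    lint_quad (fun i j p => f i j p ^ 2) (fun i j => (hf i j).pow_const 2),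
    lint_quad (fun i j p => g i j p ^ 2) (fun i j => (hg i j).pow_const 2)] at this
  exact this

/-- shifts -/
def sh (d : ℤ × ℤ × ℤ) (k : ℤ × ℤ) : ℤ × ℤ := (-(d.1 * k.2) + d.2.1, d.1 * k.1 + d.2.2)

def Dset : Finset (ℤ × ℤ × ℤ) := {1, -1} ×ˢ (Finset.Icc (-3) 3 ×ˢ Finset.Icc (-3) 3)

lemma Dset_card : Dset.card = 98 := by decide

lemma sh_inj (d : ℤ × ℤ × ℤ) (hd : d ∈ Dset) : Function.Injective (sh d) := by
  rintro ⟨x, y⟩ ⟨x', y'⟩ h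
  have h1 : d.1 = 1 ∨ d.1 = -1 := by
    have := (Finset.mem_product.1 hd).1
    simpa using this
  simp only [sh, Prod.mk.injEq] at h ⊢
  rcases h1 with h1 | h1 <;> rw [h1] at h <;> omega

lemma floor_near (s x y : ℝ) (hs : s = 1 ∨ s = -1) (si : ℤ) (hsi : (si : ℝ) = s)
    (h : |x - s * y| ≤ 3 / 2) :
    ⌊x⌋ - si * ⌊y⌋ ∈ Finset.Icc (-3 : ℤ) 3 := by
  have h1 := Int.floor_le x
  have h2 := Int.lt_floor_add_one x
  have h3 := Int.floor_le y
  have h4 := Int.lt_floor_add_one y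
  have h5 := abs_le.1 h
  rw [Finset.mem_Icc]
  have c : ((⌊x⌋ - si * ⌊y⌋ : ℤ) : ℝ) = ⌊x⌋ - s * ⌊y⌋ := by push_cast; rw [hsi]
  have l : (-4 : ℝ) < ((⌊x⌋ - si * ⌊y⌋ : ℤ) : ℝ) := by
    rw [c]; rcases hs with rfl | rfl <;> linarith
  have u : ((⌊x⌋ - si * ⌊y⌋ : ℤ) : ℝ) < 4 := by
    rw [c]; rcases hs with rfl | rfl <;> linarith
  have l' : (-4 : ℤ) < ⌊x⌋ - si * ⌊y⌋ := by exact_mod_cast l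
  have u' : ⌊x⌋ - si * ⌊y⌋ < (4 : ℤ) := by exact_mod_cast u
  constructor <;> omega

lemma cover (θ a₁ b₁ n₁ a₂ b₂ n₂ : ℝ) (hθ : 0 < θ) (hθ1 : θ ≤ 1) (hn₁ : 0 < n₁) (hn₂ : 0 < n₂)
    (e₁ : n₁ ^ 2 = a₁ ^ 2 + b₁ ^ 2) (e₂ : n₂ ^ 2 = a₂ ^ 2 + b₂ ^ 2)
    (d : |a₁ * a₂ + b₁ * b₂| ≤ θ * n₁ * n₂) :
    ∃ d ∈ Dset, cell θ a₂ b₂ n₂ = sh d (cell θ a₁ b₁ n₁) := by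
  unfold cell
  have u1 : (a₁ / n₁) ^ 2 + (b₁ / n₁) ^ 2 = 1 := by
    rw [div_pow, div_pow, ← add_div, ← e₁, div_self (by positivity)]
  have u2 : (a₂ / n₂) ^ 2 + (b₂ / n₂) ^ 2 = 1 := by
    rw [div_pow, div_pow, ← add_div, ← e₂, div_self (by positivity)]
  have dd : |(a₁ / n₁) * (a₂ / n₂) + (b₁ / n₁) * (b₂ / n₂)| ≤ θ := by
    have : (a₁ / n₁) * (a₂ / n₂) + (b₁ / n₁) * (b₂ / n₂) = (a₁ * a₂ + b₁ * b₂) / (n₁ * n₂) := by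
      field_simp
    rw [this, abs_div, abs_of_pos (by positivity : 0 < n₁ * n₂), div_le_iff₀ (by positivity)]
    linarith
  generalize a₁ / n₁ = p₁ at *
  generalize b₁ / n₁ = q₁ at *
  generalize a₂ / n₂ = p₂ at *
  generalize b₂ / n₂ = q₂ at *
  clear d e₁ e₂
  have core : ∃ s : ℤ, (s = 1 ∨ s = -1) ∧ (p₂ - (-(s : ℝ)) * q₁) ^ 2 + (q₂ - s * p₁) ^ 2 ≤ 2 * θ ^ 2 := by
    set c := p₁ * p₂ + q₁ * q₂ with hc
    set b := p₁ * q₂ - q₁ * p₂ with hb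
    have hcb : c ^ 2 + b ^ 2 = 1 := by
      have : c ^ 2 + b ^ 2 = (p₁ ^ 2 + q₁ ^ 2) * (p₂ ^ 2 + q₂ ^ 2) := by rw [hc, hb]; ring
      rw [this, u1, u2]; norm_num
    have hcs : c ^ 2 ≤ θ ^ 2 := sq_le_sq' (abs_le.1 dd).1 (abs_le.1 dd).2
    have hc1 : c ^ 2 ≤ 1 := by nlinarith
    rcases le_total 0 b with h | h
    · refine ⟨1, Or.inl rfl, ?_⟩
      have : (p₂ - (-((1 : ℤ) : ℝ)) * q₁) ^ 2 + (q₂ - ((1 : ℤ) : ℝ) * p₁) ^ 2 = 2 - 2 * b := by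
        rw [hb]; push_cast; linear_combination u1 + u2
      rw [this]
      have : b ≤ 1 := by nlinarith
      nlinarith
    · refine ⟨-1, Or.inr rfl, ?_⟩
      have : (p₂ - (-((-1 : ℤ) : ℝ)) * q₁) ^ 2 + (q₂ - ((-1 : ℤ) : ℝ) * p₁) ^ 2 = 2 + 2 * b := by
        rw [hb]; push_cast; linear_combination u1 + u2
      rw [this]
      have : -1 ≤ b := by nlinarith
      nlinarith
  obtain ⟨s, hs, hcore⟩ := core
  have hsr : (s : ℝ) = 1 ∨ (s : ℝ) = -1 := by
    rcases hs with h | h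
    · left; rw [h]; norm_num
    · right; rw [h]; norm_num
  have hsr' : -(s : ℝ) = 1 ∨ -(s : ℝ) = -1 := by
    rcases hsr with h | h
    · right; rw [h]
    · left; rw [h]; norm_num
  have b1 : |p₂ - (-(s : ℝ)) * q₁| ≤ 3 / 2 * θ :=
    abs_le_of_sq_le_sq (by nlinarith [sq_nonneg (q₂ - s * p₁)]) (by positivity)
  have b2 : |q₂ - s * p₁| ≤ 3 / 2 * θ :=
    abs_le_of_sq_le_sq (by nlinarith [sq_nonneg (p₂ - (-(s : ℝ)) * q₁)]) (by positivity)
  have f1 := floor_near (-(s : ℝ)) (p₂ / θ) (q₁ / θ) hsr' (-s) (by push_cast; rfl) (by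
    rw [← mul_div_assoc, ← sub_div, abs_div, abs_of_pos hθ, div_le_iff₀ hθ]; exact b1)
  have f2 := floor_near (s : ℝ) (q₂ / θ) (p₁ / θ) hsr s rfl (by
    rw [← mul_div_assoc, ← sub_div, abs_div, abs_of_pos hθ, div_le_iff₀ hθ]; exact b2)
  refine ⟨(s, _, _), Finset.mem_product.2 ⟨?_, Finset.mem_product.2 ⟨f1, f2⟩⟩, ?_⟩
  · simpa using hs
  · simp [sh]

lemma cover_reg (lam M θ μ₁ μ₂ : ℝ) (j₁ j₂ : ℤ) (hθ : 0 < θ) (hθ1 : θ ≤ 1)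
    (h₁ : 0 < fnorm lam μ₁ j₁) (h₂ : 0 < fnorm lam μ₂ j₂) (hC : Creg lam M θ μ₁ j₁ μ₂ j₂) :
    ∃ d ∈ Dset, Sreg lam M θ (kap lam θ μ₁ j₁) (sh d (kap lam θ μ₁ j₁)) μ₁ j₁ μ₂ j₂ := by
  obtain ⟨d, hd, h⟩ := cover θ _ _ _ _ _ _ hθ hθ1 h₁ h₂ (fnorm_sq _ _ _) (fnorm_sq _ _ _) hC.2
  exact ⟨d, hd, hC, ⟨h₁, rfl⟩, h₂, h⟩

/-- localisation of a weight to an angular cell -/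
def loc (lam θ : ℝ) (a : ℝ → ℤ → ℝ≥0∞) (k : ℤ × ℤ) (μ : ℝ) (j : ℤ) : ℝ≥0∞ :=
  if 0 < fnorm lam μ j ∧ kap lam θ μ j = k then a μ j else 0

lemma measurable_loc (lam θ : ℝ) (a : ℝ → ℤ → ℝ≥0∞) (ha : ∀ j, Measurable (fun μ => a μ j))
    (k : ℤ × ℤ) (j : ℤ) : Measurable (fun μ => loc lam θ a k μ j) := by
  unfold loc
  exact Measurable.ite (measurableSet_cellset lam θ j k) (ha j) measurable_const

lemma loc_sum (lam θ : ℝ) (a : ℝ → ℤ → ℝ≥0∞) (ha : ∀ j, Measurable (fun μ => a μ j)) :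
    ∑' k, ∑' j, ∫⁻ μ, loc lam θ a k μ j ^ 2 ≤ ∑' j, ∫⁻ μ, a μ j ^ 2 := by
  rw [ENNReal.tsum_comm]
  refine ENNReal.tsum_le_tsum fun j => ?_
  rw [← lintegral_tsum (f := fun k μ => loc lam θ a k μ j ^ 2)
    (fun k => ((measurable_loc lam θ a ha k j).pow_const 2).aemeasurable)]
  refine lintegral_mono fun μ => ?_
  simp only
  rw [tsum_eq_single (kap lam θ μ j)]
  · unfold loc; split_ifs <;> simp
  · intro k hk
    unfold loc
    rw [if_neg (fun h => hk h.2.symm)]; simp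

lemma sq_half (x : ℝ≥0∞) : (x ^ (1 / 2 : ℝ)) ^ 2 = x := by
  rw [← ENNReal.rpow_natCast, ← ENNReal.rpow_mul]; norm_num

lemma half_sq (x : ℝ≥0∞) : (x ^ 2) ^ (1 / 2 : ℝ) = x := by
  rw [← ENNReal.rpow_natCast, ← ENNReal.rpow_mul]; norm_num

lemma meas_comp_tau (lam : ℝ) (ψ : ℤ → ℝ × ℝ → ℝ≥0∞) (hψ : ∀ K, Measurable (ψ K)) (i j : ℤ) :
    Measurable (fun p : ℝ × ℝ => ψ (i + j) (p.1 + p.2, tau lam p.1 i p.2 j)) :=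
  (hψ (i + j)).comp ((measurable_fst.add measurable_snd).prodMk (measurable_tau lam i j))

lemma tri_cell (lam M θ : ℝ) (k l : ℤ × ℤ) (hlam : 1 ≤ lam) (hM : 1 ≤ M) (hθ : 0 < θ)
    (a b : ℝ → ℤ → ℝ≥0∞) (ha : ∀ j, Measurable (fun μ => a μ j))
    (hb : ∀ j, Measurable (fun μ => b μ j))
    (ψ : ℤ → ℝ × ℝ → ℝ≥0∞) (hψ : ∀ K, Measurable (ψ K)) :
    ∑' j₁, ∑' j₂, ∫⁻ μ₁, ∫⁻ μ₂, (if Sreg lam M θ k l μ₁ j₁ μ₂ j₂ then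
      a μ₁ j₁ * b μ₂ j₂ * ψ (j₁ + j₂) (μ₁ + μ₂, tau lam μ₁ j₁ μ₂ j₂) else 0) ≤
    ((∑' j, ∫⁻ μ, loc lam θ a k μ j ^ 2) ^ (1 / 2 : ℝ) *
     (∑' j, ∫⁻ μ, loc lam θ b l μ j ^ 2) ^ (1 / 2 : ℝ)) *
     ((ENNReal.ofReal (2 * (lam * (20 * θ) + 1 / M))) ^ (1 / 2 : ℝ) *
      (∑' K, ∫⁻ σ, ∫⁻ τ, ψ K (σ, τ) ^ 2) ^ (1 / 2 : ℝ)) := by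
  have hma := measurable_loc lam θ a ha k
  have hmb := measurable_loc lam θ b hb l
  have hm := meas_comp_tau lam ψ hψ
  have key := CS_quad (fun i j p => loc lam θ a k p.1 i * loc lam θ b l p.2 j)
    (fun i j p => if Sreg lam M θ k l p.1 i p.2 j then
        ψ (i + j) (p.1 + p.2, tau lam p.1 i p.2 j) else 0)
    (fun i j => ((hma i).comp measurable_fst).mul ((hmb j).comp measurable_snd))
    (fun i j => Measurable.ite (measurableSet_Sreg lam M θ k l i j) (hm i j) measurable_const)
  refine le_trans (le_of_eq ?_) (key.trans (mul_le_mul' (le_of_eq ?_) ?_))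
  · refine tsum_congr fun i => tsum_congr fun j => lintegral_congr fun x => lintegral_congr fun y => ?_
    simp only
    split_ifs with h
    · unfold loc; rw [if_pos h.2.1, if_pos h.2.2]
    · simp
  · rw [← ENNReal.mul_rpow_of_nonneg _ _ (by norm_num : (0:ℝ) ≤ 1 / 2)]
    congr 1
    rw [← ENNReal.tsum_mul_right]
    refine tsum_congr fun i => ?_
    rw [← ENNReal.tsum_mul_left]
    refine tsum_congr fun j => ?_
    rw [← lintegral_mul_const _ ((hma i).pow_const 2)]
    refine lintegral_congr fun x => ?_
    rw [← lintegral_const_mul _ ((hmb j).pow_const 2)]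
    refine lintegral_congr fun y => ?_
    rw [mul_pow]
  · rw [← ENNReal.mul_rpow_of_nonneg _ _ (by norm_num : (0:ℝ) ≤ 1 / 2)]
    refine ENNReal.rpow_le_rpow ?_ (by norm_num)
    refine le_trans (le_of_eq ?_) (transfer lam M θ k l hlam hM hθ (fun K p => ψ K p ^ 2)
      (fun K => (hψ K).pow_const 2))
    refine tsum_congr fun i => tsum_congr fun j => lintegral_congr fun x => lintegral_congr fun y => ?_
    simp only
    split_ifs <;> simp

lemma trilinear (lam M θ : ℝ) (hlam : 1 ≤ lam) (hM : 1 ≤ M) (hθ : 0 < θ) (hθ1 : θ ≤ 1)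
    (a b : ℝ → ℤ → ℝ≥0∞) (ha : ∀ j, Measurable (fun μ => a μ j))
    (hb : ∀ j, Measurable (fun μ => b μ j))
    (ha0 : ∀ μ j, a μ j ≠ 0 → 0 < fnorm lam μ j) (hb0 : ∀ μ j, b μ j ≠ 0 → 0 < fnorm lam μ j)
    (ψ : ℤ → ℝ × ℝ → ℝ≥0∞) (hψ : ∀ K, Measurable (ψ K)) :
    ∑' j₁, ∑' j₂, ∫⁻ μ₁, ∫⁻ μ₂, (if Creg lam M θ μ₁ j₁ μ₂ j₂ then
      a μ₁ j₁ * b μ₂ j₂ * ψ (j₁ + j₂) (μ₁ + μ₂, tau lam μ₁ j₁ μ₂ j₂) else 0) ≤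
    98 * (((∑' j, ∫⁻ μ, a μ j ^ 2) ^ (1 / 2 : ℝ) *
     (∑' j, ∫⁻ μ, b μ j ^ 2) ^ (1 / 2 : ℝ)) *
     ((ENNReal.ofReal (2 * (lam * (20 * θ) + 1 / M))) ^ (1 / 2 : ℝ) *
      (∑' K, ∫⁻ σ, ∫⁻ τ, ψ K (σ, τ) ^ 2) ^ (1 / 2 : ℝ))) := by
  set Z := ((ENNReal.ofReal (2 * (lam * (20 * θ) + 1 / M))) ^ (1 / 2 : ℝ) *
      (∑' K, ∫⁻ σ, ∫⁻ τ, ψ K (σ, τ) ^ 2) ^ (1 / 2 : ℝ)) with hZ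
  have hm := meas_comp_tau lam ψ hψ
  have hm' : ∀ i j, Measurable (fun p : ℝ × ℝ =>
      a p.1 i * b p.2 j * ψ (i + j) (p.1 + p.2, tau lam p.1 i p.2 j)) := fun i j =>
    (((ha i).comp measurable_fst).mul ((hb j).comp measurable_snd)).mul (hm i j)
  set G : (ℤ × ℤ) → (ℤ × ℤ) → ℤ → ℤ → ℝ × ℝ → ℝ≥0∞ := fun k l i j p =>
    if Sreg lam M θ k l p.1 i p.2 j then
      a p.1 i * b p.2 j * ψ (i + j) (p.1 + p.2, tau lam p.1 i p.2 j) else 0 with hG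
  have hGm : ∀ k l i j, Measurable (G k l i j) := fun k l i j =>
    Measurable.ite (measurableSet_Sreg lam M θ k l i j) (hm' i j) measurable_const
  rw [← lint_quad (fun i j p => if Creg lam M θ p.1 i p.2 j then
      a p.1 i * b p.2 j * ψ (i + j) (p.1 + p.2, tau lam p.1 i p.2 j) else 0)
      (fun i j => Measurable.ite (measurableSet_Creg lam M θ i j) (hm' i j) measurable_const)]
  have step : ∀ d ∈ Dset, ∑' k, ∑' j₁, ∑' j₂, ∫⁻ μ₁, ∫⁻ μ₂, G k (sh d k) j₁ j₂ (μ₁, μ₂) ≤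
      ((∑' j, ∫⁻ μ, a μ j ^ 2) ^ (1 / 2 : ℝ) * (∑' j, ∫⁻ μ, b μ j ^ 2) ^ (1 / 2 : ℝ)) * Z := by
    intro d hd
    refine (ENNReal.tsum_le_tsum fun k => tri_cell lam M θ k (sh d k) hlam hM hθ a b ha hb ψ hψ).trans ?_
    rw [ENNReal.tsum_mul_right]
    gcongr
    refine (CS_tsum _ _).trans ?_
    simp only [sq_half]
    gcongr
    · exact loc_sum lam θ a ha
    · exact (ENNReal.tsum_comp_le_tsum_of_injective (sh_inj d hd)
        (fun l => ∑' j, ∫⁻ μ, loc lam θ b l μ j ^ 2)).trans (loc_sum lam θ b hb)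
  calc _ ≤ ∫⁻ q, ∑ d ∈ Dset, ∑' k, G k (sh d k) q.1.1 q.1.2 q.2
          ∂((Measure.count : Measure (ℤ × ℤ)).prod (volume : Measure (ℝ × ℝ))) := by
        refine lintegral_mono fun q => ?_
        simp only
        split_ifs with h
        · by_cases h1 : a q.2.1 q.1.1 = 0
          · simp [h1]
          by_cases h2 : b q.2.2 q.1.2 = 0
          · simp [h2]
          obtain ⟨d, hd, hS⟩ := cover_reg lam M θ _ _ _ _ hθ hθ1 (ha0 _ _ h1) (hb0 _ _ h2) h
          refine le_trans ?_ (Finset.single_le_sum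
            (f := fun d => ∑' k, G k (sh d k) q.1.1 q.1.2 q.2) (fun _ _ => zero_le) hd)
          refine le_trans ?_ (ENNReal.le_tsum (kap lam θ q.2.1 q.1.1))
          simp only [hG]
          rw [if_pos hS]
        · exact zero_le
    _ = ∑ d ∈ Dset, ∑' k, ∑' j₁, ∑' j₂, ∫⁻ μ₁, ∫⁻ μ₂, G k (sh d k) j₁ j₂ (μ₁, μ₂) := by
        rw [lintegral_finset_sum _ (fun d _ => Measurable.ennreal_tsum fun k =>
          meas_quad _ (hGm k (sh d k)))]
        refine Finset.sum_congr rfl fun d _ => ?_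
        rw [lintegral_tsum (f := fun k (q : (ℤ × ℤ) × (ℝ × ℝ)) => G k (sh d k) q.1.1 q.1.2 q.2)
          (fun k => (meas_quad _ (hGm k (sh d k))).aemeasurable)]
        refine tsum_congr fun k => ?_
        rw [lint_quad _ (hGm k (sh d k))]
    _ ≤ ∑ d ∈ Dset, ((∑' j, ∫⁻ μ, a μ j ^ 2) ^ (1 / 2 : ℝ) *
          (∑' j, ∫⁻ μ, b μ j ^ 2) ^ (1 / 2 : ℝ)) * Z := Finset.sum_le_sum step
    _ = _ := by
        rw [Finset.sum_const, Dset_card]; simp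

/-- the phase `e^{ir}` -/
def ee (r : ℝ) : ℂ := Complex.exp (Complex.I * (r : ℂ))

lemma ee_add (r s : ℝ) : ee (r + s) = ee r * ee s := by
  unfold ee; push_cast; rw [mul_add, Complex.exp_add]

lemma norm_ee (r : ℝ) : ‖ee r‖ = 1 := by
  unfold ee; rw [mul_comm]; exact Complex.norm_exp_ofReal_mul_I r

lemma continuous_ee : Continuous ee := by unfold ee; fun_prop

lemma measurable_ee : Measurable ee := continuous_ee.measurable

lemma enorm_ee (r : ℝ) : ‖ee r‖ₑ = 1 := by
  rw [← ofReal_norm, norm_ee]; simp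

lemma parseval (a b : ℝ) (hab : a < b) (f : ℝ → ℂ) (hf : MemLp f 2 (volume.restrict (Set.Ioc a b))) :
    ∑' n : ℤ, ‖∫ x in Set.Ioc a b, ee (2 * Real.pi * n / (b - a) * x) * f x‖ₑ ^ 2 =
      ENNReal.ofReal (b - a) * ∫⁻ x in Set.Ioc a b, ‖f x‖ₑ ^ 2 := by
  have hT : 0 < b - a := by linarith
  have h := hasSum_sq_fourierCoeffOn hab hf
  have hc : ∀ n : ℤ, fourierCoeffOn hab f n = ((b - a)⁻¹ : ℝ) •
      ∫ x in Set.Ioc a b, ee (2 * Real.pi * (-n : ℤ) / (b - a) * x) * f x := by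
    intro n
    rw [fourierCoeffOn_eq_integral, intervalIntegral.integral_of_le hab.le, one_div]
    congr 1
    refine integral_congr_ae (Filter.Eventually.of_forall fun x => ?_)
    simp only [smul_eq_mul]
    rw [fourier_coe_apply]
    unfold ee
    congr 2
    push_cast
    ring
  have e1 : ∑' n : ℤ, ENNReal.ofReal (‖fourierCoeffOn hab f n‖ ^ 2) =
      ENNReal.ofReal ((b - a)⁻¹ * ∫ x in Set.Ioc a b, ‖f x‖ ^ 2) := by
    rw [← ENNReal.ofReal_tsum_of_nonneg (fun n => by positivity) h.summable, h.tsum_eq,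
      intervalIntegral.integral_of_le hab.le, smul_eq_mul]
  have e2 : ∫ x in Set.Ioc a b, ‖f x‖ ^ 2 = (∫⁻ x in Set.Ioc a b, ‖f x‖ₑ ^ 2).toReal := by
    rw [integral_eq_lintegral_of_nonneg_ae (f := fun x => ‖f x‖ ^ 2) (Filter.Eventually.of_forall fun x => by positivity)
      (hf.1.norm.pow 2)]
    congr 1
    refine lintegral_congr fun x => ?_
    rw [← ofReal_norm, ENNReal.ofReal_pow (norm_nonneg _)]
  have fin : ∫⁻ x in Set.Ioc a b, ‖f x‖ₑ ^ 2 ≠ ⊤ := by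
    have := (eLpNorm_lt_top_iff_lintegral_rpow_enorm_lt_top (p := 2) (by norm_num) (by norm_num)).1 hf.2
    simpa using this.ne
  rw [← Equiv.tsum_eq (Equiv.neg ℤ)]
  have e3 : ∀ n : ℤ, ‖∫ x in Set.Ioc a b, ee (2 * Real.pi * ((Equiv.neg ℤ n : ℤ) : ℝ) / (b - a) * x) * f x‖ₑ ^ 2 =
     ENNReal.ofReal ((b - a) ^ 2) * ENNReal.ofReal (‖fourierCoeffOn hab f n‖ ^ 2) := by
    intro n
    rw [hc n, ← ENNReal.ofReal_mul (by positivity), norm_smul, ← ofReal_norm,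
      ← ENNReal.ofReal_pow (norm_nonneg _)]
    congr 1
    simp only [Equiv.neg_apply]
    rw [Real.norm_of_nonneg (by positivity)]
    field_simp
  simp_rw [e3]
  rw [ENNReal.tsum_mul_left, e1, ← ENNReal.ofReal_mul (by positivity)]
  rw [show (b - a) ^ 2 * ((b - a)⁻¹ * ∫ x in Set.Ioc a b, ‖f x‖ ^ 2) =
    (b - a) * ∫ x in Set.Ioc a b, ‖f x‖ ^ 2 by field_simp, ENNReal.ofReal_mul hT.le, e2,
    ENNReal.ofReal_toReal fin]

lemma parseval_shift (a b s : ℝ) (hab : a < b) (f : ℝ → ℂ)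
    (hf : MemLp f 2 (volume.restrict (Set.Ioc a b))) :
    ∑' n : ℤ, ‖∫ x in Set.Ioc a b, ee ((s + n * (2 * Real.pi / (b - a))) * x) * f x‖ₑ ^ 2 =
      ENNReal.ofReal (b - a) * ∫⁻ x in Set.Ioc a b, ‖f x‖ₑ ^ 2 := by
  have hm : MemLp (fun x => ee (s * x) * f x) 2 (volume.restrict (Set.Ioc a b)) := by
    refine hf.of_le ((measurable_ee.comp (measurable_const_mul s)).aestronglyMeasurable.mul hf.1) ?_
    exact Filter.Eventually.of_forall fun x => by simp [norm_ee]
  have := parseval a b hab _ hm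
  simp only [enorm_mul, enorm_ee, one_mul] at this
  rw [← this]
  refine tsum_congr fun n => ?_
  congr 3
  ext x
  rw [← mul_assoc, ← ee_add]
  congr 2; ring

lemma meas_int_ee {α : Type*} [MeasurableSpace α] (f : α → ℝ → ℂ)
    (hf : Measurable (fun p : α × ℝ => f p.1 p.2)) (m : Measure ℝ) [SFinite m] (h : α → ℝ → ℝ)
    (hh : Measurable (fun p : α × ℝ => h p.1 p.2)) :
    Measurable (fun s => ∫ x, ee (h s x) * f s x ∂m) := by
  have : StronglyMeasurable (fun p : α × ℝ => ee (h p.1 p.2) * f p.1 p.2) :=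
    ((measurable_ee.comp hh).mul hf).stronglyMeasurable
  exact this.integral_prod_right.measurable

lemma lint_period (P : ℝ) (hP : 0 < P) (H : ℝ → ℝ≥0∞) :
    ∫⁻ σ, H σ ≤ ∑' n : ℤ, ∫⁻ s in Set.Ioc 0 P, H (s + n * P) := by
  have hu : (⋃ n : ℤ, Set.Ioc (0 + n • P) (0 + (n + 1) • P)) = Set.univ := iUnion_Ioc_add_zsmul hP 0
  rw [← setLIntegral_univ, ← hu]
  refine (lintegral_iUnion_le _ _).trans (ENNReal.tsum_le_tsum fun n => le_of_eq ?_)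
  rw [← (measurePreserving_add_right volume ((n : ℝ) * P)).setLIntegral_comp_preimage_emb
    (measurableEmbedding_addRight _)]
  congr 2
  ext s
  simp only [zsmul_eq_mul, Set.mem_Ioc, Set.mem_preimage]
  push_cast
  constructor <;> intro h <;> constructor <;> linarith [h.1, h.2]

lemma bessel1 (a b : ℝ) (hab : a < b) (f : ℝ → ℂ) (hm : Measurable f)
    (hf : MemLp f 2 (volume.restrict (Set.Ioc a b))) :
    ∫⁻ σ : ℝ, ‖∫ x in Set.Ioc a b, ee (σ * x) * f x‖ₑ ^ 2 ≤
      ENNReal.ofReal (2 * Real.pi) * ∫⁻ x in Set.Ioc a b, ‖f x‖ₑ ^ 2 := by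
  have hT : 0 < b - a := by linarith
  have hP : 0 < 2 * Real.pi / (b - a) := by have := Real.pi_pos; positivity
  refine (lint_period _ hP _).trans ?_
  have hmm : Measurable (fun σ : ℝ => ∫ x in Set.Ioc a b, ee (σ * x) * f x) :=
    meas_int_ee (fun _ x => f x) (hm.comp measurable_snd) _ (fun σ x => σ * x)
      (measurable_fst.mul measurable_snd)
  rw [← lintegral_tsum (f := fun (n : ℤ) s =>
    ‖∫ x in Set.Ioc a b, ee ((s + n * (2 * Real.pi / (b - a))) * x) * f x‖ₑ ^ 2)]
  · simp_rw [parseval_shift a b _ hab f hf]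
    rw [lintegral_const, Measure.restrict_apply_univ, Real.volume_Ioc, mul_right_comm,
      ← ENNReal.ofReal_mul hT.le, sub_zero]
    rw [mul_div_cancel₀ _ hT.ne']
  · intro n
    exact ((hmm.comp (measurable_add_const _)).enorm.pow_const 2).aemeasurable

lemma bessel1_neg (a b : ℝ) (hab : a < b) (f : ℝ → ℂ) (hm : Measurable f)
    (hf : MemLp f 2 (volume.restrict (Set.Ioc a b))) :
    ∫⁻ σ : ℝ, ‖∫ x in Set.Ioc a b, ee (-(x * σ)) * f x‖ₑ ^ 2 ≤
      ENNReal.ofReal (2 * Real.pi) * ∫⁻ x in Set.Ioc a b, ‖f x‖ₑ ^ 2 := by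
  refine le_trans (le_of_eq ?_) (bessel1 a b hab f hm hf)
  rw [← (Measure.measurePreserving_neg (volume : Measure ℝ)).lintegral_comp_emb
    (MeasurableEquiv.neg ℝ).measurableEmbedding]
  refine lintegral_congr fun σ => ?_
  congr 3; ext x; congr 2; ring

lemma zero_of_transform (a b : ℝ) (hab : a < b) (f : ℝ → ℂ)
    (hf : MemLp f 2 (volume.restrict (Set.Ioc a b)))
    (h : ∀ σ : ℝ, ∫ x in Set.Ioc a b, ee (σ * x) * f x = 0) :
    ∀ᵐ x ∂(volume.restrict (Set.Ioc a b)), f x = 0 := by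
  have := parseval_shift a b 0 hab f hf
  simp only [h, enorm_zero] at this
  simp only [ne_eq, OfNat.ofNat_ne_zero, not_false_eq_true, zero_pow, tsum_zero] at this
  have h0 : ENNReal.ofReal (b - a) ≠ 0 := by simpa using hab
  have h2 := (mul_eq_zero.1 this.symm).resolve_left h0
  rw [lintegral_eq_zero_iff' (hf.1.enorm.pow_const 2)] at h2
  filter_upwards [h2] with x hx
  simpa using hx

/-- space-time Fourier transform over the box, iterated -/
def hatY (lam : ℝ) (φ : ℝ × ℝ × ℝ → ℂ) (K : ℤ) (t x : ℝ) : ℂ :=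
  ∫ y in Set.Ioc 0 (2 * Real.pi * lam), ee (y * ((K : ℝ) / lam)) * φ (t, x, y)

def hatX (lam R : ℝ) (φ : ℝ × ℝ × ℝ → ℂ) (K : ℤ) (σ t : ℝ) : ℂ :=
  ∫ x in Set.Ioc (-R) R, ee (σ * x) * hatY lam φ K t x

def hatT (lam R : ℝ) (φ : ℝ × ℝ × ℝ → ℂ) (K : ℤ) (p : ℝ × ℝ) : ℂ :=
  ∫ t in Set.Ioc (0 : ℝ) 1, ee (-(t * p.2)) * hatX lam R φ K p.1 t

lemma measurable_hatY (lam : ℝ) (φ : ℝ × ℝ × ℝ → ℂ) (hφ : Measurable φ) (K : ℤ) :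
    Measurable (fun q : ℝ × ℝ => hatY lam φ K q.1 q.2) := by
  unfold hatY
  exact meas_int_ee (fun (q : ℝ × ℝ) y => φ (q.1, q.2, y)) (hφ.comp (by fun_prop)) _
    (fun _ y => y * ((K : ℝ) / lam)) (by fun_prop)

lemma measurable_hatX (lam R : ℝ) (φ : ℝ × ℝ × ℝ → ℂ) (hφ : Measurable φ) (K : ℤ) :
    Measurable (fun q : ℝ × ℝ => hatX lam R φ K q.1 q.2) := by
  unfold hatX
  exact meas_int_ee (fun (q : ℝ × ℝ) x => hatY lam φ K q.2 x)
    ((measurable_hatY lam φ hφ K).comp (f := fun p : (ℝ × ℝ) × ℝ => (p.1.2, p.2)) (by fun_prop)) _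
    (fun q x => q.1 * x) (by fun_prop)

lemma measurable_hatT (lam R : ℝ) (φ : ℝ × ℝ × ℝ → ℂ) (hφ : Measurable φ) (K : ℤ) :
    Measurable (hatT lam R φ K) := by
  unfold hatT
  exact meas_int_ee (fun (q : ℝ × ℝ) t => hatX lam R φ K q.1 t)
    ((measurable_hatX lam R φ hφ K).comp (f := fun p : (ℝ × ℝ) × ℝ => (p.1.1, p.2)) (by fun_prop)) _
    (fun q t => -(t * q.2)) (by fun_prop)

lemma int_bdd (a b B : ℝ) (h : ℝ → ℝ) (f : ℝ → ℂ) (hf : ∀ x, ‖f x‖ ≤ B) (hab : a ≤ b) :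
    ‖∫ x in Set.Ioc a b, ee (h x) * f x‖ ≤ B * (b - a) := by
  have := norm_setIntegral_le_of_norm_le_const (μ := volume) (s := Set.Ioc a b)
    (f := fun x => ee (h x) * f x) (C := B) (by simp)
    (fun x _ => by rw [norm_mul, norm_ee, one_mul]; exact hf x)
  simpa [Measure.real, Real.volume_Ioc, ENNReal.toReal_ofReal (sub_nonneg.2 hab)] using this

lemma memLp_bdd (a b B : ℝ) (f : ℝ → ℂ) (hm : Measurable f) (hf : ∀ x, ‖f x‖ ≤ B) :
    MemLp f 2 (volume.restrict (Set.Ioc a b)) :=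
  MemLp.of_bound hm.aestronglyMeasurable B (Filter.Eventually.of_forall hf)

lemma hatY_bdd (lam B : ℝ) (hlam : 0 < lam) (φ : ℝ × ℝ × ℝ → ℂ) (hB : ∀ p, ‖φ p‖ ≤ B) (K : ℤ) (t x : ℝ) :
    ‖hatY lam φ K t x‖ ≤ B * (2 * Real.pi * lam - 0) :=
  int_bdd _ _ _ _ _ (fun y => hB _) (by have := Real.pi_pos; positivity)

lemma hatX_bdd (lam R B : ℝ) (hlam : 0 < lam) (hR : 0 < R) (φ : ℝ × ℝ × ℝ → ℂ)
    (hB : ∀ p, ‖φ p‖ ≤ B) (K : ℤ) (σ t : ℝ) :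
    ‖hatX lam R φ K σ t‖ ≤ B * (2 * Real.pi * lam - 0) * (R - -R) :=
  int_bdd _ _ _ _ _ (fun x => hatY_bdd lam B hlam φ hB K t x) (by linarith)

lemma bessel3 (lam R B : ℝ) (hlam : 0 < lam) (hR : 0 < R) (φ : ℝ × ℝ × ℝ → ℂ) (hφ : Measurable φ)
    (hB : ∀ p, ‖φ p‖ ≤ B) :
    ∑' K, ∫⁻ σ, ∫⁻ τ, ‖hatT lam R φ K (σ, τ)‖ₑ ^ 2 ≤
    ENNReal.ofReal ((2 * Real.pi) ^ 3 * lam) * ∫⁻ t in Set.Ioc (0 : ℝ) 1, ∫⁻ x in Set.Ioc (-R) R,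
      ∫⁻ y in Set.Ioc 0 (2 * Real.pi * lam), ‖φ (t, x, y)‖ₑ ^ 2 := by
  have hpi := Real.pi_pos
  have mX := measurable_hatX lam R φ hφ
  have mY := measurable_hatY lam φ hφ
  have s1 : ∀ K σ, ∫⁻ τ, ‖hatT lam R φ K (σ, τ)‖ₑ ^ 2 ≤
      ENNReal.ofReal (2 * Real.pi) * ∫⁻ t in Set.Ioc (0 : ℝ) 1, ‖hatX lam R φ K σ t‖ₑ ^ 2 := by
    intro K σ
    have m : Measurable (fun t => hatX lam R φ K σ t) := (mX K).comp measurable_prodMk_left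
    have hh : MemLp (fun t => hatX lam R φ K σ t) 2 (volume.restrict (Set.Ioc (0:ℝ) 1)) :=
      memLp_bdd _ _ _ _ m (hatX_bdd lam R B hlam hR φ hB K σ)
    have := bessel1_neg 0 1 one_pos _ m hh
    simp only [hatT]
    exact this
  have s2 : ∀ K t, ∫⁻ σ, ‖hatX lam R φ K σ t‖ₑ ^ 2 ≤
      ENNReal.ofReal (2 * Real.pi) * ∫⁻ x in Set.Ioc (-R) R, ‖hatY lam φ K t x‖ₑ ^ 2 := by
    intro K t
    have m : Measurable (fun x => hatY lam φ K t x) := (mY K).comp measurable_prodMk_left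
    have hh : MemLp (fun x => hatY lam φ K t x) 2 (volume.restrict (Set.Ioc (-R) R)) :=
      memLp_bdd _ _ _ _ m (hatY_bdd lam B hlam φ hB K t)
    have := bessel1 (-R) R (by linarith) _ m hh
    simp only [hatX]
    exact this
  have s3 : ∀ t x, ∑' K, ‖hatY lam φ K t x‖ₑ ^ 2 =
      ENNReal.ofReal (2 * Real.pi * lam) *
        ∫⁻ y in Set.Ioc 0 (2 * Real.pi * lam), ‖φ (t, x, y)‖ₑ ^ 2 := by
    intro t x
    have m : Measurable (fun y => φ (t, x, y)) := hφ.comp (by fun_prop)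
    have := parseval 0 (2 * Real.pi * lam) (by positivity) _ (memLp_bdd _ _ B _ m fun y => hB _)
    rw [sub_zero] at this
    rw [← this]
    refine tsum_congr fun K => ?_
    unfold hatY
    congr 3
    ext y
    congr 2
    field_simp
  calc _ ≤ ∑' K, ∫⁻ σ, ENNReal.ofReal (2 * Real.pi) *
        ∫⁻ t in Set.Ioc (0 : ℝ) 1, ‖hatX lam R φ K σ t‖ₑ ^ 2 :=
        ENNReal.tsum_le_tsum fun K => lintegral_mono fun σ => s1 K σ
    _ = ENNReal.ofReal (2 * Real.pi) * ∑' K, ∫⁻ t in Set.Ioc (0 : ℝ) 1, ∫⁻ σ,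
        ‖hatX lam R φ K σ t‖ₑ ^ 2 := by
        rw [← ENNReal.tsum_mul_left]
        refine tsum_congr fun K => ?_
        rw [lintegral_const_mul' _ _ ENNReal.ofReal_ne_top]
        rw [lintegral_lintegral_swap ((mX K).enorm.pow_const 2).aemeasurable]
    _ ≤ ENNReal.ofReal (2 * Real.pi) * ∑' K, ∫⁻ t in Set.Ioc (0 : ℝ) 1,
        ENNReal.ofReal (2 * Real.pi) * ∫⁻ x in Set.Ioc (-R) R, ‖hatY lam φ K t x‖ₑ ^ 2 := by
        gcongr with K t; exact s2 K t
    _ = ENNReal.ofReal (2 * Real.pi) * (ENNReal.ofReal (2 * Real.pi) * ∑' K,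
        ∫⁻ t in Set.Ioc (0 : ℝ) 1, ∫⁻ x in Set.Ioc (-R) R, ‖hatY lam φ K t x‖ₑ ^ 2) := by
        congr 1
        rw [← ENNReal.tsum_mul_left]
        refine tsum_congr fun K => ?_
        rw [lintegral_const_mul' _ _ ENNReal.ofReal_ne_top]
    _ = ENNReal.ofReal (2 * Real.pi) * (ENNReal.ofReal (2 * Real.pi) *
        (∫⁻ t in Set.Ioc (0 : ℝ) 1, ∫⁻ x in Set.Ioc (-R) R, ∑' K, ‖hatY lam φ K t x‖ₑ ^ 2)) := by
        congr 2
        rw [← lintegral_tsum (f := fun K t => ∫⁻ x in Set.Ioc (-R) R, ‖hatY lam φ K t x‖ₑ ^ 2)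
          (fun K => (((mY K).enorm.pow_const 2).lintegral_prod_right').aemeasurable)]
        refine lintegral_congr fun t => ?_
        rw [lintegral_tsum (f := fun K x => ‖hatY lam φ K t x‖ₑ ^ 2)
          (fun K => ((((mY K).comp measurable_prodMk_left).enorm).pow_const 2).aemeasurable)]
    _ = ENNReal.ofReal (2 * Real.pi) * (ENNReal.ofReal (2 * Real.pi) *
        (ENNReal.ofReal (2 * Real.pi * lam) * (∫⁻ t in Set.Ioc (0 : ℝ) 1, ∫⁻ x in Set.Ioc (-R) R,
        ∫⁻ y in Set.Ioc 0 (2 * Real.pi * lam), ‖φ (t, x, y)‖ₑ ^ 2))) := by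
        congr 2
        simp_rw [s3]
        rw [← lintegral_const_mul' _ _ ENNReal.ofReal_ne_top]
        refine lintegral_congr fun t => ?_
        rw [lintegral_const_mul' _ _ ENNReal.ofReal_ne_top]
    _ = _ := by
        rw [← mul_assoc, ← mul_assoc, ← ENNReal.ofReal_mul (by positivity),
          ← ENNReal.ofReal_mul (by positivity)]
        congr 2; ring

/-- the phase appearing in the bilinear expression -/
def ph (lam : ℝ) (j₁ j₂ : ℤ) (p : ℝ × ℝ × ℝ) (q : ℝ × ℝ) : ℝ :=
  (p.2.1 * (q.1 + q.2) + p.2.2 * ((j₁ : ℝ) / lam + (j₂ : ℝ) / lam))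
          - p.1 * ((q.1 ^ 2 + ((j₁ : ℝ) / lam) ^ 2) + (q.2 ^ 2 + ((j₂ : ℝ) / lam) ^ 2))

lemma measurable_ph (lam : ℝ) (j₁ j₂ : ℤ) :
    Measurable (fun z : (ℝ × ℝ × ℝ) × (ℝ × ℝ) => ph lam j₁ j₂ z.1 z.2) := by
  unfold ph; fun_prop

/-- box measure -/
def mE (lam R : ℝ) : Measure (ℝ × ℝ × ℝ) :=
  (volume.restrict (Set.Ioc (0 : ℝ) 1)).prod ((volume.restrict (Set.Ioc (-R) R)).prod
    (volume.restrict (Set.Ioc 0 (2 * Real.pi * lam))))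

instance (lam R : ℝ) : IsFiniteMeasure (mE lam R) := by unfold mE; infer_instance

lemma lint_mE (lam R : ℝ) (f : ℝ × ℝ × ℝ → ℝ≥0∞) (hf : Measurable f) :
    ∫⁻ p, f p ∂(mE lam R) = ∫⁻ t in Set.Ioc (0 : ℝ) 1, ∫⁻ x in Set.Ioc (-R) R,
      ∫⁻ y in Set.Ioc 0 (2 * Real.pi * lam), f (t, x, y) := by
  unfold mE
  rw [lintegral_prod _ hf.aemeasurable]
  refine lintegral_congr fun t => ?_
  have h2 : Measurable (fun z : ℝ × ℝ => f (t, z)) := hf.comp measurable_prodMk_left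
  rw [lintegral_prod _ h2.aemeasurable]

lemma int_bd {α : Type*} [MeasurableSpace α] (m : Measure α) [IsFiniteMeasure m] (f : α → ℂ)
    (hf : Measurable f) (B : ℝ) (hB : ∀ x, ‖f x‖ ≤ B) : Integrable f m :=
  Integrable.of_bound hf.aestronglyMeasurable B (Filter.Eventually.of_forall hB)

lemma hatT_eq (lam R B : ℝ) (j₁ j₂ : ℤ) (φ : ℝ × ℝ × ℝ → ℂ) (hφ : Measurable φ)
    (hB : ∀ p, ‖φ p‖ ≤ B) (q : ℝ × ℝ) :
    ∫ p, ee (ph lam j₁ j₂ p q) * φ p ∂(mE lam R) =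
      hatT lam R φ (j₁ + j₂) (q.1 + q.2, tau lam q.1 j₁ q.2 j₂) := by
  have hm : Measurable (fun p => ee (ph lam j₁ j₂ p q) * φ p) :=
    (measurable_ee.comp ((measurable_ph lam j₁ j₂).comp measurable_prodMk_right)).mul hφ
  have hb : ∀ p, ‖ee (ph lam j₁ j₂ p q) * φ p‖ ≤ B := fun p => by
    rw [norm_mul, norm_ee, one_mul]; exact hB p
  unfold mE
  rw [integral_prod _ (int_bd _ _ hm B hb)]
  unfold hatT
  refine integral_congr_ae (Filter.Eventually.of_forall fun t => ?_)
  simp only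
  have h2 : Measurable (fun z : ℝ × ℝ => ee (ph lam j₁ j₂ (t, z) q) * φ (t, z)) :=
    hm.comp measurable_prodMk_left
  rw [integral_prod _ (int_bd _ _ h2 B (fun p => hb _))]
  unfold hatX
  rw [← integral_const_mul]
  refine integral_congr_ae (Filter.Eventually.of_forall fun x => ?_)
  simp only
  unfold hatY
  rw [← integral_const_mul, ← integral_const_mul]
  refine integral_congr_ae (Filter.Eventually.of_forall fun y => ?_)
  simp only
  rw [← mul_assoc, ← mul_assoc, ← ee_add, ← ee_add]
  congr 2
  unfold ph tau
  push_cast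
  ring

/-- finite bilinear sum with integrable weights -/
def Fsum (lam : ℝ) (J : Finset ℤ) (W : ℤ → ℤ → ℝ × ℝ → ℂ) (p : ℝ × ℝ × ℝ) : ℂ :=
  ∑ j₁ ∈ J, ∑ j₂ ∈ J, ∫ q, ee (ph lam j₁ j₂ p q) * W j₁ j₂ q

lemma measurable_Fsum (lam : ℝ) (J : Finset ℤ) (W : ℤ → ℤ → ℝ × ℝ → ℂ)
    (hW : ∀ i j, Measurable (W i j)) : Measurable (Fsum lam J W) := by
  unfold Fsum
  refine Finset.measurable_sum _ fun i _ => Finset.measurable_sum _ fun j _ => ?_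
  have : StronglyMeasurable (fun z : (ℝ × ℝ × ℝ) × (ℝ × ℝ) => ee (ph lam i j z.1 z.2) * W i j z.2) :=
    ((measurable_ee.comp (measurable_ph lam i j)).mul ((hW i j).comp measurable_snd)).stronglyMeasurable
  exact this.integral_prod_right.measurable

lemma dual_step (lam R : ℝ) (J : Finset ℤ) (W : ℤ → ℤ → ℝ × ℝ → ℂ)
    (hW : ∀ i j, Measurable (W i j)) (hWi : ∀ i j, Integrable (W i j))
    (φ : ℝ × ℝ × ℝ → ℂ) (hφ : Measurable φ) (B : ℝ) (hB : ∀ p, ‖φ p‖ ≤ B) :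
    ∫ p, Fsum lam J W p * φ p ∂(mE lam R) = ∑ j₁ ∈ J, ∑ j₂ ∈ J, ∫ q : ℝ × ℝ, W j₁ j₂ q *
      hatT lam R φ (j₁ + j₂) (q.1 + q.2, tau lam q.1 j₁ q.2 j₂) := by
  have hI : ∀ i j, Integrable (fun z : (ℝ × ℝ × ℝ) × (ℝ × ℝ) =>
      ee (ph lam i j z.1 z.2) * W i j z.2 * φ z.1) ((mE lam R).prod volume) := by
    intro i j
    have h1 : Integrable (fun z : (ℝ × ℝ × ℝ) × (ℝ × ℝ) => φ z.1 * W i j z.2)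
        ((mE lam R).prod volume) := (int_bd _ φ hφ B hB).mul_prod (hWi i j)
    refine h1.mono ?_ (Filter.Eventually.of_forall fun z => ?_)
    · exact (((measurable_ee.comp (measurable_ph lam i j)).mul
        ((hW i j).comp measurable_snd)).mul (hφ.comp measurable_fst)).aestronglyMeasurable
    · simp only [norm_mul, norm_ee, one_mul]; rw [mul_comm]
  have hI2 : ∀ i j, Integrable (fun p => (∫ q, ee (ph lam i j p q) * W i j q) * φ p) (mE lam R) := by
    intro i j
    have := (hI i j).integral_prod_left
    refine this.congr (Filter.Eventually.of_forall fun p => ?_)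
    simp only
    rw [integral_mul_const]
  unfold Fsum
  simp_rw [Finset.sum_mul]
  rw [integral_finsetSum _ (fun i _ => integrable_finsetSum _ fun j _ => hI2 i j)]
  refine Finset.sum_congr rfl fun i _ => ?_
  rw [integral_finsetSum _ (fun j _ => hI2 i j)]
  refine Finset.sum_congr rfl fun j _ => ?_
  simp_rw [← integral_mul_const]
  rw [integral_integral_swap (hI i j)]
  refine integral_congr_ae (Filter.Eventually.of_forall fun q => ?_)
  simp only
  rw [← hatT_eq lam R B i j φ hφ hB q, ← integral_const_mul]
  refine integral_congr_ae (Filter.Eventually.of_forall fun p => ?_)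
  simp only
  ring

lemma Fsum_bdd (lam : ℝ) (J : Finset ℤ) (W : ℤ → ℤ → ℝ × ℝ → ℂ) (p : ℝ × ℝ × ℝ) :
    ‖Fsum lam J W p‖ ≤ ∑ j₁ ∈ J, ∑ j₂ ∈ J, ∫ q, ‖W j₁ j₂ q‖ := by
  unfold Fsum
  refine norm_sum_le_of_le _ fun i _ => norm_sum_le_of_le _ fun j _ => ?_
  refine (norm_integral_le_integral_norm _).trans (le_of_eq ?_)
  simp [norm_ee]

lemma half_absorb (X c : ℝ≥0∞) (hX : X ≠ ⊤) (h : X ≤ c * X ^ (1 / 2 : ℝ)) :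
    X ^ (1 / 2 : ℝ) ≤ c := by
  rcases eq_or_ne X 0 with h0 | h0
  · rw [h0]; simp
  have hs : X ^ (1 / 2 : ℝ) ≠ 0 := by simp [h0, hX]
  have ht : X ^ (1 / 2 : ℝ) ≠ ⊤ := by simp [h0, hX]
  have : X ^ (1 / 2 : ℝ) * X ^ (1 / 2 : ℝ) ≤ c * X ^ (1 / 2 : ℝ) := by
    rw [← sq, sq_half]; exact h
  exact (ENNReal.mul_le_mul_iff_left hs ht).1 this

lemma box_est (lam M θ R : ℝ) (hlam : 1 ≤ lam) (hM : 1 ≤ M) (hθ : 0 < θ) (hθ1 : θ ≤ 1)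
    (hR : 0 < R) (J : Finset ℤ) (W : ℤ → ℤ → ℝ × ℝ → ℂ)
    (hW : ∀ i j, Measurable (W i j)) (hWi : ∀ i j, Integrable (W i j))
    (a b : ℝ → ℤ → ℝ≥0∞) (ha : ∀ j, Measurable (fun μ => a μ j))
    (hb : ∀ j, Measurable (fun μ => b μ j))
    (ha0 : ∀ μ j, a μ j ≠ 0 → 0 < fnorm lam μ j) (hb0 : ∀ μ j, b μ j ≠ 0 → 0 < fnorm lam μ j)
    (hWab : ∀ i j q, ‖W i j q‖ₑ ≤ if Creg lam M θ q.1 i q.2 j then a q.1 i * b q.2 j else 0) :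
    (∫⁻ t in Set.Ioc (0 : ℝ) 1, ∫⁻ x in Set.Ioc (-R) R,
      ∫⁻ y in Set.Ioc 0 (2 * Real.pi * lam), ‖Fsum lam J W (t, x, y)‖ₑ ^ 2) ^ (1 / 2 : ℝ) ≤
    98 * (((∑' j, ∫⁻ μ, a μ j ^ 2) ^ (1 / 2 : ℝ) *
     (∑' j, ∫⁻ μ, b μ j ^ 2) ^ (1 / 2 : ℝ)) *
     ((ENNReal.ofReal (2 * (lam * (20 * θ) + 1 / M))) ^ (1 / 2 : ℝ) *
       ENNReal.ofReal ((2 * Real.pi) ^ 3 * lam) ^ (1 / 2 : ℝ))) := by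
  have hmF := measurable_Fsum lam J W hW
  set F := Fsum lam J W with hF
  set B := ∑ j₁ ∈ J, ∑ j₂ ∈ J, ∫ q, ‖W j₁ j₂ q‖ with hBdef
  have hFB : ∀ p, ‖F p‖ ≤ B := fun p => Fsum_bdd lam J W p
  have hmφ : Measurable (fun p => (starRingEnd ℂ) (F p)) := Complex.continuous_conj.measurable.comp hmF
  set φ : ℝ × ℝ × ℝ → ℂ := fun p => (starRingEnd ℂ) (F p) with hφ
  have hφB : ∀ p, ‖φ p‖ ≤ B := fun p => by rw [hφ]; simpa using hFB p
  have hφe : ∀ p, ‖φ p‖ₑ = ‖F p‖ₑ := fun p => by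
    rw [← ofReal_norm, ← ofReal_norm, hφ]; simp
  have hl := lint_mE lam R (fun p => ‖F p‖ₑ ^ 2) (hmF.enorm.pow_const 2)
  rw [← hl]
  set X := ∫⁻ p, ‖F p‖ₑ ^ 2 ∂(mE lam R) with hX
  have hXtop : X ≠ ⊤ := by
    have : X ≤ ∫⁻ p, ENNReal.ofReal B ^ 2 ∂(mE lam R) := lintegral_mono fun p => by
      gcongr; rw [← ofReal_norm]; exact ENNReal.ofReal_le_ofReal (hFB p)
    refine ne_top_of_le_ne_top ?_ this
    rw [lintegral_const]
    exact ENNReal.mul_ne_top (by simp) (measure_ne_top _ _)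
  have hXe : X = ‖∫ p, F p * φ p ∂(mE lam R)‖ₑ := by
    have e : ∀ p, F p * φ p = ((‖F p‖ ^ 2 : ℝ) : ℂ) := fun p => by
      rw [hφ]; simp only; rw [Complex.mul_conj, Complex.normSq_eq_norm_sq]
    simp_rw [e]
    rw [integral_complex_ofReal, ← ofReal_norm, Complex.norm_real, Real.norm_eq_abs, abs_of_nonneg (by positivity)]
    rw [integral_eq_lintegral_of_nonneg_ae (f := fun p => ‖F p‖ ^ 2)
      (Filter.Eventually.of_forall fun x => by positivity)
      (hmF.norm.pow_const 2).aestronglyMeasurable]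
    have : ∫⁻ p, ENNReal.ofReal (‖F p‖ ^ 2) ∂(mE lam R) = X := by
      refine lintegral_congr fun p => ?_
      rw [← ofReal_norm, ENNReal.ofReal_pow (norm_nonneg _)]
    rw [this, ENNReal.ofReal_toReal hXtop]
  refine half_absorb _ _ hXtop ?_
  have mT := measurable_hatT lam R φ hmφ
  calc X = ‖∑ j₁ ∈ J, ∑ j₂ ∈ J, ∫ q : ℝ × ℝ, W j₁ j₂ q *
      hatT lam R φ (j₁ + j₂) (q.1 + q.2, tau lam q.1 j₁ q.2 j₂)‖ₑ := by
        rw [hXe, hF, dual_step lam R J W hW hWi φ hmφ B hφB]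
    _ ≤ ∑ j₁ ∈ J, ∑ j₂ ∈ J, ∫⁻ q : ℝ × ℝ, ‖W j₁ j₂ q *
      hatT lam R φ (j₁ + j₂) (q.1 + q.2, tau lam q.1 j₁ q.2 j₂)‖ₑ := by
        refine (enorm_sum_le _ _).trans (Finset.sum_le_sum fun i _ => ?_)
        refine (enorm_sum_le _ _).trans (Finset.sum_le_sum fun j _ => ?_)
        exact enorm_integral_le_lintegral_enorm _
    _ ≤ ∑ j₁ ∈ J, ∑ j₂ ∈ J, ∫⁻ q : ℝ × ℝ, if Creg lam M θ q.1 j₁ q.2 j₂ then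
      a q.1 j₁ * b q.2 j₂ * ‖hatT lam R φ (j₁ + j₂) (q.1 + q.2, tau lam q.1 j₁ q.2 j₂)‖ₑ else 0 := by
        refine Finset.sum_le_sum fun i _ => Finset.sum_le_sum fun j _ => lintegral_mono fun q => ?_
        simp only
        rw [enorm_mul]
        have := hWab i j q
        split_ifs at this ⊢ with h
        · gcongr
        · have h0 : ‖W i j q‖ₑ = 0 := le_antisymm this zero_le
          rw [h0, zero_mul]
    _ ≤ ∑' j₁, ∑' j₂, ∫⁻ q : ℝ × ℝ, if Creg lam M θ q.1 j₁ q.2 j₂ then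
      a q.1 j₁ * b q.2 j₂ * ‖hatT lam R φ (j₁ + j₂) (q.1 + q.2, tau lam q.1 j₁ q.2 j₂)‖ₑ else 0 := by
        refine (Finset.sum_le_sum fun i _ => ENNReal.sum_le_tsum J).trans (ENNReal.sum_le_tsum J)
    _ = ∑' j₁, ∑' j₂, ∫⁻ μ₁, ∫⁻ μ₂, if Creg lam M θ μ₁ j₁ μ₂ j₂ then
      a μ₁ j₁ * b μ₂ j₂ * ‖hatT lam R φ (j₁ + j₂) (μ₁ + μ₂, tau lam μ₁ j₁ μ₂ j₂)‖ₑ else 0 := by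
        refine tsum_congr fun i => tsum_congr fun j => ?_
        rw [Measure.volume_eq_prod, lintegral_prod]
        refine (Measurable.ite (measurableSet_Creg lam M θ i j) ?_ measurable_const).aemeasurable
        exact (((ha i).comp measurable_fst).mul ((hb j).comp measurable_snd)).mul
          (meas_comp_tau lam (fun K p => ‖hatT lam R φ K p‖ₑ) (fun K => (mT K).enorm) i j)
    _ ≤ _ := trilinear lam M θ hlam hM hθ hθ1 a b ha hb ha0 hb0
          (fun K p => ‖hatT lam R φ K p‖ₑ) (fun K => (mT K).enorm)
    _ ≤ _ := by
        have e2 : ∀ u v w z x : ℝ≥0∞, u * (v * (w * z)) * x = u * (v * (w * (z * x))) := by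
          intros; ring
        rw [e2, ← ENNReal.mul_rpow_of_nonneg _ X (by norm_num : (0:ℝ) ≤ 1 / 2)]
        gcongr
        have := bessel3 lam R B (by linarith) hR φ hmφ hφB
        simp_rw [hφe] at this
        rw [← hl] at this
        exact this

lemma meas_core (f : ℝ → ℂ) : ∃ U : Set ℝ, MeasurableSet U ∧ Measurable (U.indicator f) ∧
    ∀ V : Set ℝ, MeasurableSet V → AEMeasurable f (volume.restrict V) → volume (V \ U) = 0 := by
  obtain ⟨ν, hν, hvn, hnv⟩ := exists_isFiniteMeasure_absolutelyContinuous (volume : Measure ℝ)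
  set 𝒱 : Set (Set ℝ) := {V | MeasurableSet V ∧ AEMeasurable f (volume.restrict V)} with h𝒱
  have hne : (ν '' 𝒱).Nonempty := ⟨ν ∅, ∅, ⟨MeasurableSet.empty, by simp⟩, rfl⟩
  obtain ⟨u, -, hu, hmem⟩ := exists_seq_tendsto_sSup hne (OrderTop.bddAbove _)
  choose V hV hVu using hmem
  set U0 := ⋃ n, V n with hU0
  have hU0m : MeasurableSet U0 := MeasurableSet.iUnion fun n => (hV n).1
  have hU0f : AEMeasurable f (volume.restrict U0) := aemeasurable_iUnion_iff.2 fun n => (hV n).2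
  have hsup : sSup (ν '' 𝒱) ≤ ν U0 := by
    refine le_of_tendsto' hu fun n => ?_
    rw [← hVu n]
    exact measure_mono (Set.subset_iUnion V n)
  have key : ∀ W : Set ℝ, MeasurableSet W → AEMeasurable f (volume.restrict W) →
      volume (W \ U0) = 0 := by
    intro W hW hWf
    apply hvn
    have h1 : U0 ∪ W ∈ 𝒱 := by
      refine ⟨hU0m.union hW, ?_⟩
      rw [aemeasurable_union_iff]
      exact ⟨hU0f, hWf⟩
    have h2 : ν (U0 ∪ W) ≤ ν U0 := (le_sSup (Set.mem_image_of_mem ν h1)).trans hsup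
    have h3 : W \ U0 = (U0 ∪ W) \ U0 := by ext z; simp
    rw [h3, measure_sdiff Set.subset_union_left hU0m.nullMeasurableSet (measure_ne_top _ _)]
    exact tsub_eq_zero_of_le h2
  obtain ⟨g, hg, hfg⟩ := hU0f
  rw [Filter.EventuallyEq, ae_restrict_iff' hU0m] at hfg
  have hN : volume {x | ¬ (x ∈ U0 → f x = g x)} = 0 := hfg
  obtain ⟨N, hsub, hNm, hN0⟩ := exists_measurable_superset_of_null hN
  refine ⟨U0 \ N, hU0m.diff hNm, ?_, ?_⟩
  · have : (U0 \ N).indicator f = (U0 \ N).indicator g := by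
      refine Set.indicator_congr fun x hx => ?_
      by_contra h
      exact hx.2 (hsub (fun h' => h (h' hx.1)))
    rw [this]
    exact hg.indicator (hU0m.diff hNm)
  · intro W hW hWf
    refine measure_mono_null (t := (W \ U0) ∪ N) ?_ (measure_union_null (key W hW hWf) hN0)
    intro x hx
    by_cases h : x ∈ U0
    · right
      by_contra h'
      exact hx.2 ⟨h, h'⟩
    · left; exact ⟨hx.1, h⟩

lemma entire_transform (A : ℝ) (hA : 0 < A) (h : ℝ → ℂ) (hm : Measurable h)
    (hi : Integrable h) (hs : ∀ x, h x ≠ 0 → |x| ≤ A) :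
    Differentiable ℂ (fun z : ℂ => ∫ x : ℝ, Complex.exp (Complex.I * (z * x)) * h x) := by
  intro z₀
  have hb : ∀ z ∈ Metric.ball z₀ 1, ∀ x : ℝ,
      ‖Complex.exp (Complex.I * (z * x)) * h x‖ ≤ Real.exp ((‖z₀‖ + 1) * A) * ‖h x‖ := by
    intro z hz x
    rw [norm_mul]
    by_cases h0 : h x = 0
    · simp [h0]
    gcongr
    rw [Complex.norm_exp]
    gcongr
    refine (Complex.re_le_norm _).trans ?_
    rw [norm_mul, norm_mul, Complex.norm_I, one_mul, Complex.norm_real, Real.norm_eq_abs]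
    have : ‖z‖ ≤ ‖z₀‖ + 1 := by
      have := norm_sub_norm_le z z₀
      rw [Metric.mem_ball, dist_eq_norm] at hz
      linarith
    exact mul_le_mul this (hs x h0) (abs_nonneg _) (by positivity)
  have hmz : ∀ z : ℂ, AEStronglyMeasurable (fun x : ℝ => Complex.exp (Complex.I * (z * x)) * h x)
      volume := fun z => by
    have : Measurable (fun x : ℝ => Complex.exp (Complex.I * (z * x))) := by fun_prop
    exact (this.mul hm).aestronglyMeasurable
  have := hasDerivAt_integral_of_dominated_loc_of_deriv_le (μ := (volume : Measure ℝ))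
    (F := fun (z : ℂ) (x : ℝ) => Complex.exp (Complex.I * (z * x)) * h x)
    (F' := fun (z : ℂ) (x : ℝ) => (Complex.I * x) * (Complex.exp (Complex.I * (z * x)) * h x))
    (bound := fun x => A * (Real.exp ((‖z₀‖ + 1) * A) * ‖h x‖))
    (x₀ := z₀) (s := Metric.ball z₀ 1) (Metric.ball_mem_nhds _ one_pos)
    (Filter.Eventually.of_forall fun z => hmz z)
    ((hi.norm.const_mul (Real.exp ((‖z₀‖ + 1) * A))).mono' (hmz z₀)
      (Filter.Eventually.of_forall fun x => hb z₀ (Metric.mem_ball_self one_pos) x))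
    (by
      have : Measurable (fun x : ℝ => (Complex.I * (x : ℂ))) := by fun_prop
      exact this.aestronglyMeasurable.mul (hmz z₀))
    (Filter.Eventually.of_forall fun x z hz => by
      rw [norm_mul, norm_mul, Complex.norm_I, one_mul, Complex.norm_real, Real.norm_eq_abs]
      by_cases h0 : h x = 0
      · simp [h0]
      exact mul_le_mul (hs x h0) (hb z hz x) (norm_nonneg _) hA.le)
    ((hi.norm.const_mul _).const_mul _)
    (Filter.Eventually.of_forall fun x z hz => by
      have h1 : HasDerivAt (fun z : ℂ => Complex.I * (z * x)) (Complex.I * (1 * x)) z :=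
        ((hasDerivAt_id z).mul_const (x : ℂ)).const_mul Complex.I
      refine (h1.cexp.mul_const (h x)).congr_deriv ?_
      ring)
  exact this.2.differentiableAt

lemma lemmaZ (A : ℝ) (hA : 0 < A) (h : ℝ → ℂ) (hm : Measurable h)
    (hL2 : ∫⁻ x, ‖h x‖ₑ ^ 2 ≠ ⊤) (hi : Integrable h) (hs : ∀ x, h x ≠ 0 → |x| ≤ A)
    (hne : ¬ (∀ᵐ x : ℝ, h x = 0)) :
    ∀ᵐ x : ℝ, ∫ μ : ℝ, ee (x * μ) * h μ ≠ 0 := by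
  have hd := entire_transform A hA h hm hi hs
  set H : ℂ → ℂ := fun z : ℂ => ∫ x : ℝ, Complex.exp (Complex.I * (z * x)) * h x with hH
  have hHe : ∀ x : ℝ, H x = ∫ μ : ℝ, ee (x * μ) * h μ := by
    intro x
    rw [hH]; simp only
    unfold ee
    push_cast; rfl
  have han : AnalyticOnNhd ℝ (fun x : ℝ => H x) Set.univ := by
    intro x _
    have h1 : AnalyticAt ℂ H (x : ℂ) := hd.analyticAt _
    exact (h1.restrictScalars (𝕜 := ℝ)).comp (Complex.ofRealCLM.analyticAt x)
  have hex : ∃ x : ℝ, H x ≠ 0 := by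
    by_contra hcon
    push Not at hcon
    apply hne
    have hset : ∀ σ : ℝ, ∫ x in Set.Ioc (-A - 1) A, ee (σ * x) * h x = 0 := by
      intro σ
      rw [setIntegral_eq_integral_of_forall_compl_eq_zero, ← hHe, hcon]
      intro x hx
      by_contra h0
      have h1 : h x ≠ 0 := fun h' => h0 (by rw [h', mul_zero])
      have := abs_le.1 (hs x h1)
      exact hx ⟨by linarith [this.1], this.2⟩
    have hmem : MemLp h 2 (volume.restrict (Set.Ioc (-A - 1) A)) := by
      refine MemLp.restrict _ ⟨hm.aestronglyMeasurable, ?_⟩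
      rw [eLpNorm_lt_top_iff_lintegral_rpow_enorm_lt_top (p := 2) (by norm_num) (by norm_num)]
      simpa using hL2.lt_top
    have := zero_of_transform (-A - 1) A (by linarith) h hmem hset
    rw [ae_restrict_iff' measurableSet_Ioc] at this
    filter_upwards [this] with x hx
    by_contra h0
    have h2 := abs_le.1 (hs x h0)
    exact h0 (hx ⟨by linarith [h2.1], h2.2⟩)
  obtain ⟨x₀, hx₀⟩ := hex
  have hcod := han.preimage_zero_mem_codiscrete (x := x₀) hx₀
  have := ae_restrict_le_codiscreteWithin (μ := (volume : Measure ℝ)) MeasurableSet.univ hcod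
  rw [Measure.restrict_univ] at this
  filter_upwards [this] with x hx
  rw [← hHe]
  exact hx

lemma integrable_cpt (A : ℝ) (f : ℝ → ℂ) (hm : Measurable f) (hL : ∫⁻ x, ‖f x‖ₑ ^ 2 ≠ ⊤)
    (hs : ∀ x, f x ≠ 0 → |x| ≤ A) : Integrable f := by
  have hmem : MemLp f 2 (volume.restrict (Set.Icc (-A) A)) := by
    refine MemLp.restrict _ ⟨hm.aestronglyMeasurable, ?_⟩
    rw [eLpNorm_lt_top_iff_lintegral_rpow_enorm_lt_top (p := 2) (by norm_num) (by norm_num)]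
    simpa using hL.lt_top
  have h1 : IntegrableOn f (Set.Icc (-A) A) := hmem.integrable (by norm_num)
  rwa [integrableOn_iff_integrable_of_support_subset] at h1
  intro x hx
  exact abs_le.1 (hs x hx)

lemma ee_ne (r : ℝ) : ee r ≠ 0 := by unfold ee; exact Complex.exp_ne_zero _

/-- If a unimodular (nonvanishing measurable) multiple is measurable on a set, so is the function. -/
lemma aem_of_mul (V : Set ℝ) (hV : MeasurableSet V) (f k : ℝ → ℂ) (hk : Measurable k)
    (hk0 : ∀ᵐ x, x ∈ V → k x ≠ 0)
    (h : AEMeasurable (fun x => if x ∈ V then k x * f x else 0) volume) :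
    AEMeasurable f (volume.restrict V) := by
  have h1 : AEMeasurable (fun x => (k x)⁻¹ * (if x ∈ V then k x * f x else 0))
      (volume.restrict V) := (hk.inv.aemeasurable.mul h).restrict
  refine h1.congr ?_
  rw [Filter.EventuallyEq, ae_restrict_iff' hV]
  filter_upwards [hk0] with x hx hxV
  rw [if_pos hxV, ← mul_assoc, inv_mul_cancel₀ (hx hxV), one_mul]

lemma ee_mul_integral_core (S : Set ℝ) (hS : MeasurableSet S) (f k : ℝ → ℂ) (hk : Measurable k)
    (hk0 : ∀ x, k x ≠ 0) (U : Set ℝ) (hU : MeasurableSet U)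
    (hmax : ∀ V : Set ℝ, MeasurableSet V → AEMeasurable f (volume.restrict V) → volume (V \ U) = 0) :
    ∫ x, (if x ∈ S then k x * f x else 0) =
      if volume (S \ U) = 0 then ∫ x, (if x ∈ S then k x * U.indicator f x else 0) else 0 := by
  split_ifs with h
  · refine integral_congr_ae ?_
    have : ∀ᵐ x, x ∉ S \ U := measure_eq_zero_iff_ae_notMem.1 h
    filter_upwards [this] with x hx
    by_cases hxS : x ∈ S
    · have hxU : x ∈ U := by by_contra h'; exact hx ⟨hxS, h'⟩
      simp [hxS, hxU]
    · simp [hxS]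
  · refine integral_non_aestronglyMeasurable fun hae => h (hmax S hS ?_)
    exact aem_of_mul S hS f k hk (Filter.Eventually.of_forall fun x _ => hk0 x) hae.aemeasurable

lemma pair_red (S : Set (ℝ × ℝ)) (hS : MeasurableSet S) (f₁ f₂ : ℝ → ℂ) (A : ℝ) (hA : 0 < A)
    (hs₁ : ∀ x, f₁ x ≠ 0 → |x| ≤ A) (hs₂ : ∀ x, f₂ x ≠ 0 → |x| ≤ A)
    (hL₁ : ∫⁻ x, ‖f₁ x‖ₑ ^ 2 ≠ ⊤) (hL₂ : ∫⁻ x, ‖f₂ x‖ₑ ^ 2 ≠ ⊤) (U₁ U₂ : Set ℝ)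
    (hU₁ : MeasurableSet U₁) (hU₂ : MeasurableSet U₂)
    (hm₁ : Measurable (U₁.indicator f₁)) (hm₂ : Measurable (U₂.indicator f₂))
    (hx₁ : ∀ V : Set ℝ, MeasurableSet V → AEMeasurable f₁ (volume.restrict V) → volume (V \ U₁) = 0)
    (hx₂ : ∀ V : Set ℝ, MeasurableSet V → AEMeasurable f₂ (volume.restrict V) → volume (V \ U₂) = 0) :
    ∃ W : ℝ × ℝ → ℂ, Measurable W ∧ Integrable W ∧
      (∀ q, ‖W q‖ₑ ≤ if q ∈ S then ‖U₁.indicator f₁ q.1‖ₑ * ‖U₂.indicator f₂ q.2‖ₑ else 0) ∧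
      ∀ t : ℝ, ∀ᵐ x : ℝ, ∫ μ₁ : ℝ, ∫ μ₂ : ℝ, (if (μ₁, μ₂) ∈ S then
        ee (x * μ₁ - t * μ₁ ^ 2) * ee (x * μ₂ - t * μ₂ ^ 2) * f₁ μ₁ * f₂ μ₂ else 0) =
        ∫ q : ℝ × ℝ, ee (x * q.1 - t * q.1 ^ 2) * ee (x * q.2 - t * q.2 ^ 2) * W q := by
  set F₁ := U₁.indicator f₁ with hF₁
  set F₂ := U₂.indicator f₂ with hF₂
  have sF₁ : ∀ x, F₁ x ≠ 0 → |x| ≤ A := fun x hx => hs₁ x fun h => hx (by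
    rw [hF₁, Set.indicator_apply, h]; simp)
  have sF₂ : ∀ x, F₂ x ≠ 0 → |x| ≤ A := fun x hx => hs₂ x fun h => hx (by
    rw [hF₂, Set.indicator_apply, h]; simp)
  have lF₁ : ∫⁻ x, ‖F₁ x‖ₑ ^ 2 ≠ ⊤ := ne_top_of_le_ne_top hL₁ (lintegral_mono fun x => by
    gcongr; exact enorm_indicator_le_enorm_self _ _)
  have lF₂ : ∫⁻ x, ‖F₂ x‖ₑ ^ 2 ≠ ⊤ := ne_top_of_le_ne_top hL₂ (lintegral_mono fun x => by
    gcongr; exact enorm_indicator_le_enorm_self _ _)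
  have iF₁ := integrable_cpt A F₁ hm₁ lF₁ sF₁
  have iF₂ := integrable_cpt A F₂ hm₂ lF₂ sF₂
  have hSl : ∀ μ₁ : ℝ, MeasurableSet {μ₂ : ℝ | (μ₁, μ₂) ∈ S} := fun μ₁ => measurable_prodMk_left hS
  -- the slice sets
  set D0 : Set ℝ := {μ₁ | volume ({μ₂ : ℝ | (μ₁, μ₂) ∈ S} \ U₂) = 0} with hD0
  set Nz : Set (ℝ × ℝ) := S ∩ {q | F₂ q.2 ≠ 0} with hNz
  have hNzm : MeasurableSet Nz := hS.inter
    ((measurable_snd (hm₂ (measurableSet_singleton (0 : ℂ)).compl)))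
  set D1 : Set ℝ := D0 ∩ {μ₁ | volume (Prod.mk μ₁ ⁻¹' Nz) ≠ 0} with hD1
  have hD0m : MeasurableSet D0 := by
    have h1 : MeasurableSet (S \ (Prod.snd ⁻¹' U₂)) := hS.diff (measurable_snd hU₂)
    have := measurable_measure_prodMk_left (ν := (volume : Measure ℝ)) h1
    exact this (measurableSet_singleton 0)
  have hD1m : MeasurableSet D1 := by
    refine hD0m.inter ?_
    have := measurable_measure_prodMk_left (ν := (volume : Measure ℝ)) hNzm
    exact this (measurableSet_singleton 0).compl
  -- transform of the second factor
  set Q : ℝ → ℝ × ℝ → ℂ := fun t z => ∫ μ₂, ee (z.2 * μ₂) *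
    (if (z.1, μ₂) ∈ S then ee (-(t * μ₂ ^ 2)) * F₂ μ₂ else 0) with hQ
  have hQm : ∀ t, Measurable (Q t) := by
    intro t
    refine meas_int_ee (fun (z : ℝ × ℝ) μ₂ => if (z.1, μ₂) ∈ S then ee (-(t * μ₂ ^ 2)) * F₂ μ₂ else 0)
      ?_ volume (fun z μ₂ => z.2 * μ₂) (by fun_prop)
    have hmS : Measurable (fun p : (ℝ × ℝ) × ℝ => (p.1.1, p.2)) := by fun_prop
    refine Measurable.ite (hmS hS) ?_ measurable_const
    have h1 : Measurable (fun p : (ℝ × ℝ) × ℝ => -(t * p.2 ^ 2)) := by fun_prop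
    exact (measurable_ee.comp h1).mul (hm₂.comp measurable_snd)
  have hph : ∀ t x μ : ℝ, ee (x * μ - t * μ ^ 2) = ee (x * μ) * ee (-(t * μ ^ 2)) := by
    intro t x μ; rw [← ee_add, sub_eq_add_neg]
  -- inner integral
  have inner : ∀ t x μ₁ : ℝ, ∫ μ₂ : ℝ, (if (μ₁, μ₂) ∈ S then
        ee (x * μ₁ - t * μ₁ ^ 2) * ee (x * μ₂ - t * μ₂ ^ 2) * f₁ μ₁ * f₂ μ₂ else 0) =
      if μ₁ ∈ D1 then (ee (x * μ₁ - t * μ₁ ^ 2) * Q t (μ₁, x)) * f₁ μ₁ else 0 := by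
    intro t x μ₁
    have e1 : ∀ μ₂ : ℝ, (if (μ₁, μ₂) ∈ S then
        ee (x * μ₁ - t * μ₁ ^ 2) * ee (x * μ₂ - t * μ₂ ^ 2) * f₁ μ₁ * f₂ μ₂ else 0) =
        (ee (x * μ₁ - t * μ₁ ^ 2) * f₁ μ₁) * (if μ₂ ∈ {μ₂ : ℝ | (μ₁, μ₂) ∈ S} then
          ee (x * μ₂ - t * μ₂ ^ 2) * f₂ μ₂ else 0) := by
      intro μ₂
      by_cases h : (μ₁, μ₂) ∈ S
      · simp [h]; ring
      · simp [h]
    simp_rw [e1]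
    rw [integral_const_mul, ee_mul_integral_core _ (hSl μ₁) f₂ (fun μ₂ => ee (x * μ₂ - t * μ₂ ^ 2))
      (measurable_ee.comp (by fun_prop)) (fun _ => ee_ne _) U₂ hU₂ hx₂]
    have e2 : ∫ μ₂, (if μ₂ ∈ {μ₂ : ℝ | (μ₁, μ₂) ∈ S} then
        ee (x * μ₂ - t * μ₂ ^ 2) * U₂.indicator f₂ μ₂ else 0) = Q t (μ₁, x) := by
      rw [hQ]
      refine integral_congr_ae (Filter.Eventually.of_forall fun μ₂ => ?_)
      by_cases h : (μ₁, μ₂) ∈ S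
      · simp only [h, Set.mem_ofPred_eq, if_true]
        rw [hph]; ring
      · simp [h]
    rw [e2]
    by_cases h1 : μ₁ ∈ D0
    · have h1' : volume ({μ₂ : ℝ | (μ₁, μ₂) ∈ S} \ U₂) = 0 := h1
      rw [if_pos h1']
      by_cases h2 : μ₁ ∈ D1
      · rw [if_pos h2]; ring
      · rw [if_neg h2]
        have h3 : volume (Prod.mk μ₁ ⁻¹' Nz) = 0 := by
          by_contra h'; exact h2 ⟨h1, h'⟩
        have : Q t (μ₁, x) = 0 := by
          rw [hQ]
          refine integral_eq_zero_of_ae ?_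
          filter_upwards [measure_eq_zero_iff_ae_notMem.1 h3] with μ₂ hμ
          by_cases hS' : (μ₁, μ₂) ∈ S
          · have : F₂ μ₂ = 0 := by by_contra h'; exact hμ ⟨hS', h'⟩
            simp [this]
          · simp [hS']
        rw [this, mul_zero]
    · have h1' : ¬ volume ({μ₂ : ℝ | (μ₁, μ₂) ∈ S} \ U₂) = 0 := h1
      rw [if_neg h1', if_neg (fun h => h1 h.1), mul_zero]
  by_cases hcase : volume (D1 \ U₁) = 0
  · refine ⟨fun q => if q ∈ S ∩ Prod.fst ⁻¹' D1 then F₁ q.1 * F₂ q.2 else 0, ?_, ?_, ?_, ?_⟩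
    · exact Measurable.ite (hS.inter (measurable_fst hD1m))
        ((hm₁.comp measurable_fst).mul (hm₂.comp measurable_snd)) measurable_const
    · refine (iF₁.mul_prod iF₂).mono ?_ (Filter.Eventually.of_forall fun q => ?_)
      · exact (Measurable.ite (hS.inter (measurable_fst hD1m))
          ((hm₁.comp measurable_fst).mul (hm₂.comp measurable_snd)) measurable_const).aestronglyMeasurable
      · by_cases hq : q ∈ S ∩ Prod.fst ⁻¹' D1
        · rw [if_pos hq]
        · rw [if_neg hq, norm_zero]; exact norm_nonneg _
    · intro q
      beta_reduce
      by_cases h : q ∈ S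
      · rw [if_pos h]
        by_cases hq : q ∈ S ∩ Prod.fst ⁻¹' D1
        · rw [if_pos hq, enorm_mul]
        · rw [if_neg hq]; simp
      · rw [if_neg h, if_neg (fun h' => h h'.1)]; simp
    · intro t
      refine Filter.Eventually.of_forall fun x => ?_
      simp_rw [inner t x]
      have hk : Measurable (fun μ₁ => ee (x * μ₁ - t * μ₁ ^ 2) * Q t (μ₁, x)) :=
        (measurable_ee.comp (by fun_prop)).mul ((hQm t).comp measurable_prodMk_right)
      have e3 : ∫ μ₁, (if μ₁ ∈ D1 then ee (x * μ₁ - t * μ₁ ^ 2) * Q t (μ₁, x) * f₁ μ₁ else 0) =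
          ∫ μ₁, (if μ₁ ∈ D1 then ee (x * μ₁ - t * μ₁ ^ 2) * Q t (μ₁, x) * F₁ μ₁ else 0) := by
        refine integral_congr_ae ?_
        filter_upwards [measure_eq_zero_iff_ae_notMem.1 hcase] with μ hμ
        by_cases h : μ ∈ D1
        · have hU : μ ∈ U₁ := by by_contra h'; exact hμ ⟨h, h'⟩
          simp [h, hF₁, hU]
        · simp [h]
      rw [e3, Measure.volume_eq_prod, integral_prod]
      · refine integral_congr_ae (Filter.Eventually.of_forall fun μ₁ => ?_)
        simp only
        by_cases h : μ₁ ∈ D1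
        · rw [if_pos h, hQ]
          simp only
          rw [mul_right_comm, ← integral_const_mul]
          refine integral_congr_ae (Filter.Eventually.of_forall fun μ₂ => ?_)
          by_cases h' : (μ₁, μ₂) ∈ S
          · simp only [h', h, Set.mem_inter_iff, Set.mem_preimage, if_true, and_self]
            rw [hph t x μ₂]; ring
          · simp [h']
        · rw [if_neg h]
          simp [h]
      · refine (iF₁.mul_prod iF₂).mono ?_ (Filter.Eventually.of_forall fun q => ?_)
        · refine (Measurable.mul ?_ (Measurable.ite (hS.inter (measurable_fst hD1m))
            ((hm₁.comp measurable_fst).mul (hm₂.comp measurable_snd))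
            measurable_const)).aestronglyMeasurable
          exact (measurable_ee.comp (by fun_prop)).mul (measurable_ee.comp (by fun_prop))
        · rw [norm_mul, norm_mul, norm_ee, norm_ee, one_mul, one_mul]
          by_cases hq : q ∈ S ∩ Prod.fst ⁻¹' D1
          · rw [if_pos hq]
          · rw [if_neg hq, norm_zero]; exact norm_nonneg _
  · refine ⟨fun _ => 0, measurable_const, integrable_zero _ _ _, fun q => by simp, fun t => ?_⟩
    simp only [mul_zero, integral_zero]
    have hz : ∀ᵐ μ₁ : ℝ, ∀ᵐ x : ℝ, (μ₁ ∈ D1 → Q t (μ₁, x) ≠ 0) := by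
      refine Filter.Eventually.of_forall fun μ₁ => ?_
      by_cases h : μ₁ ∈ D1
      · have hmh : Measurable (fun μ₂ => if (μ₁, μ₂) ∈ S then ee (-(t * μ₂ ^ 2)) * F₂ μ₂ else 0) :=
          Measurable.ite (hSl μ₁) ((measurable_ee.comp (by fun_prop)).mul hm₂) measurable_const
        have hle : ∀ μ₂, ‖(if (μ₁, μ₂) ∈ S then ee (-(t * μ₂ ^ 2)) * F₂ μ₂ else 0)‖ₑ ≤ ‖F₂ μ₂‖ₑ := by
          intro μ₂
          split_ifs
          · rw [enorm_mul, enorm_ee, one_mul]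
          · simp
        have hsp : ∀ μ₂, (if (μ₁, μ₂) ∈ S then ee (-(t * μ₂ ^ 2)) * F₂ μ₂ else 0) ≠ 0 → |μ₂| ≤ A := by
          intro μ₂ h0
          refine sF₂ μ₂ fun h' => h0 (by rw [h']; simp)
        have hL : ∫⁻ μ₂, ‖(if (μ₁, μ₂) ∈ S then ee (-(t * μ₂ ^ 2)) * F₂ μ₂ else 0)‖ₑ ^ 2 ≠ ⊤ :=
          ne_top_of_le_ne_top lF₂ (lintegral_mono fun μ₂ => by gcongr; exact hle μ₂)
        have := lemmaZ A hA _ hmh hL (integrable_cpt A _ hmh hL hsp) hsp ?_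
        · filter_upwards [this] with x hx _
          exact hx
        · intro hae
          apply h.2
          rw [measure_eq_zero_iff_ae_notMem]
          filter_upwards [hae] with μ₂ hμ hin
          have h1 : (μ₁, μ₂) ∈ S := hin.1
          rw [if_pos h1] at hμ
          exact hin.2 ((mul_eq_zero.1 hμ).resolve_left (ee_ne _))
      · exact Filter.Eventually.of_forall fun x h' => absurd h' h
    have hmeas : MeasurableSet {z : ℝ × ℝ | z.1 ∈ D1 → Q t (z.1, z.2) ≠ 0} := by
      have h1 : MeasurableSet {z : ℝ × ℝ | z.1 ∈ D1} := measurable_fst hD1m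
      have h2 : MeasurableSet {z : ℝ × ℝ | Q t (z.1, z.2) ≠ 0} :=
        hQm t (measurableSet_singleton (0 : ℂ)).compl
      exact h1.imp h2
    rw [Measure.ae_ae_comm hmeas] at hz
    filter_upwards [hz] with x hx
    simp_rw [inner t x]
    refine integral_non_aestronglyMeasurable fun hae => hcase (hx₁ D1 hD1m ?_)
    refine aem_of_mul D1 hD1m f₁ (fun μ₁ => ee (x * μ₁ - t * μ₁ ^ 2) * Q t (μ₁, x))
      ((measurable_ee.comp (by fun_prop)).mul ((hQm t).comp measurable_prodMk_right)) ?_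
      (by convert hae.aemeasurable)
    filter_upwards [hx] with μ hμ hin
    exact mul_ne_zero (ee_ne _) (hμ hin)

lemma lint_exhaust (f : ℝ → ℝ → ℝ≥0∞) (hf : Measurable (Function.uncurry f)) (K : ℝ≥0∞)
    (ν : Measure ℝ)
    (h : ∀ R : ℝ, 0 < R → ∫⁻ t, (∫⁻ x in Set.Ioc (-R) R, f t x) ∂ν ≤ K) :
    ∫⁻ t, (∫⁻ x, f t x) ∂ν ≤ K := by
  have hmono : Monotone (fun n : ℕ => Set.Ioc (-((n : ℝ) + 1)) ((n : ℝ) + 1)) := by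
    intro m n hmn
    have : (m : ℝ) ≤ n := by exact_mod_cast hmn
    exact Set.Ioc_subset_Ioc (by linarith) (by linarith)
  have hU : (⋃ n : ℕ, Set.Ioc (-((n : ℝ) + 1)) ((n : ℝ) + 1)) = Set.univ := by
    refine Set.eq_univ_of_forall fun x => ?_
    obtain ⟨n, hn⟩ := exists_nat_ge |x|
    have := abs_le.1 hn
    exact Set.mem_iUnion.2 ⟨n, by linarith, by linarith⟩
  have h1 : ∀ t, ∫⁻ x, f t x = ⨆ n : ℕ, ∫⁻ x in Set.Ioc (-((n : ℝ) + 1)) ((n : ℝ) + 1), f t x := by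
    intro t
    rw [← setLIntegral_iUnion_of_directed _ hmono.directed_le, hU, Measure.restrict_univ]
  simp_rw [h1]
  rw [lintegral_iSup]
  · exact iSup_le fun n => h _ (by positivity)
  · intro n
    exact hf.lintegral_prod_right'
  · intro m n hmn t
    exact lintegral_mono_set (hmono hmn)

lemma full_est (lam M θ : ℝ) (hlam : 1 ≤ lam) (hM : 1 ≤ M) (hθ : 0 < θ) (hθ1 : θ ≤ 1)
    (J : Finset ℤ) (W : ℤ → ℤ → ℝ × ℝ → ℂ)
    (hW : ∀ i j, Measurable (W i j)) (hWi : ∀ i j, Integrable (W i j))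
    (a b : ℝ → ℤ → ℝ≥0∞) (ha : ∀ j, Measurable (fun μ => a μ j))
    (hb : ∀ j, Measurable (fun μ => b μ j))
    (ha0 : ∀ μ j, a μ j ≠ 0 → 0 < fnorm lam μ j) (hb0 : ∀ μ j, b μ j ≠ 0 → 0 < fnorm lam μ j)
    (hWab : ∀ i j q, ‖W i j q‖ₑ ≤ if Creg lam M θ q.1 i q.2 j then a q.1 i * b q.2 j else 0) :
    (∫⁻ t in Set.Ioc (0 : ℝ) 1, ∫⁻ x : ℝ,
      ∫⁻ y in Set.Ioc 0 (2 * Real.pi * lam), ‖Fsum lam J W (t, x, y)‖ₑ ^ 2) ^ (1 / 2 : ℝ) ≤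
    98 * (((∑' j, ∫⁻ μ, a μ j ^ 2) ^ (1 / 2 : ℝ) *
     (∑' j, ∫⁻ μ, b μ j ^ 2) ^ (1 / 2 : ℝ)) *
     ((ENNReal.ofReal (2 * (lam * (20 * θ) + 1 / M))) ^ (1 / 2 : ℝ) *
       ENNReal.ofReal ((2 * Real.pi) ^ 3 * lam) ^ (1 / 2 : ℝ))) := by
  set K := 98 * (((∑' j, ∫⁻ μ, a μ j ^ 2) ^ (1 / 2 : ℝ) *
     (∑' j, ∫⁻ μ, b μ j ^ 2) ^ (1 / 2 : ℝ)) *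
     ((ENNReal.ofReal (2 * (lam * (20 * θ) + 1 / M))) ^ (1 / 2 : ℝ) *
       ENNReal.ofReal ((2 * Real.pi) ^ 3 * lam) ^ (1 / 2 : ℝ))) with hK
  have key : ∫⁻ t in Set.Ioc (0 : ℝ) 1, ∫⁻ x : ℝ,
      ∫⁻ y in Set.Ioc 0 (2 * Real.pi * lam), ‖Fsum lam J W (t, x, y)‖ₑ ^ 2 ≤ K ^ 2 := by
    refine lint_exhaust (fun t x => ∫⁻ y in Set.Ioc 0 (2 * Real.pi * lam),
      ‖Fsum lam J W (t, x, y)‖ₑ ^ 2) ?_ (K ^ 2) _ ?_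
    · have h0 := measurable_Fsum lam J W hW
      have h1 : Measurable (fun z : (ℝ × ℝ) × ℝ => ‖Fsum lam J W (z.1.1, z.1.2, z.2)‖ₑ ^ 2) := by
        have : Measurable (fun z : (ℝ × ℝ) × ℝ => (z.1.1, z.1.2, z.2)) := by fun_prop
        exact ((h0.comp this).enorm).pow_const 2
      exact h1.lintegral_prod_right'
    · intro R hR
      have := box_est lam M θ R hlam hM hθ hθ1 hR J W hW hWi a b ha hb ha0 hb0 hWab
      rw [← hK] at this
      rw [← sq_half (∫⁻ t in Set.Ioc (0 : ℝ) 1, ∫⁻ x in Set.Ioc (-R) R,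
        ∫⁻ y in Set.Ioc 0 (2 * Real.pi * lam), ‖Fsum lam J W (t, x, y)‖ₑ ^ 2)]
      gcongr
  calc _ ≤ (K ^ 2) ^ (1 / 2 : ℝ) := by gcongr
    _ = K := half_sq K

lemma Fbilin_eq (lam M θ : ℝ) (g₁ g₂ : ℝ → ℤ → ℂ) (J : Finset ℤ)
    (hJ₁ : ∀ j, j ∉ J → ∀ μ, g₁ μ j = 0) (hJ₂ : ∀ j, j ∉ J → ∀ μ, g₂ μ j = 0)
    (W : ℤ → ℤ → ℝ × ℝ → ℂ) (t x y : ℝ)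
    (h : ∀ i j : ℤ, ∫ μ₁ : ℝ, ∫ μ₂ : ℝ, (if (μ₁, μ₂) ∈ {p : ℝ × ℝ | Creg lam M θ p.1 i p.2 j} then
        ee (x * μ₁ - t * μ₁ ^ 2) * ee (x * μ₂ - t * μ₂ ^ 2) * g₁ μ₁ i * g₂ μ₂ j else 0) =
        ∫ q : ℝ × ℝ, ee (x * q.1 - t * q.1 ^ 2) * ee (x * q.2 - t * q.2 ^ 2) * W i j q) :
    Fbilin lam M θ g₁ g₂ t x y = ((1 / lam ^ 2 : ℝ) : ℂ) * Fsum lam J W (t, x, y) := by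
  unfold Fbilin Fsum
  congr 1
  rw [tsum_eq_sum (s := J)]
  · refine Finset.sum_congr rfl fun i _ => ?_
    rw [tsum_eq_sum (s := J)]
    · refine Finset.sum_congr rfl fun j _ => ?_
      set c : ℂ := ee (y * ((i : ℝ) / lam + (j : ℝ) / lam) -
        t * (((i : ℝ) / lam) ^ 2 + ((j : ℝ) / lam) ^ 2)) with hc
      have e1 : ∀ q, ee (ph lam i j (t, x, y) q) * W i j q =
          c * (ee (x * q.1 - t * q.1 ^ 2) * ee (x * q.2 - t * q.2 ^ 2) * W i j q) := by
        intro q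
        rw [hc, ← mul_assoc, ← ee_add, ← ee_add]
        congr 2
        unfold ph; ring
      simp_rw [e1]
      rw [integral_const_mul, ← h i j, ← integral_const_mul]
      refine integral_congr_ae (Filter.Eventually.of_forall fun μ₁ => ?_)
      beta_reduce
      rw [← integral_const_mul]
      refine integral_congr_ae (Filter.Eventually.of_forall fun μ₂ => ?_)
      beta_reduce
      by_cases hC : Creg lam M θ μ₁ i μ₂ j
      · have hC' : (μ₁, μ₂) ∈ {p : ℝ × ℝ | Creg lam M θ p.1 i p.2 j} := hC
        rw [if_pos hC']
        unfold Creg at hC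
        rw [if_pos hC, ← mul_assoc, ← mul_assoc, hc, ← ee_add, ← ee_add]
        congr 2
        unfold ee
        congr 3
        ring
      · have hC' : (μ₁, μ₂) ∉ {p : ℝ × ℝ | Creg lam M θ p.1 i p.2 j} := hC
        rw [if_neg hC']
        unfold Creg at hC
        rw [if_neg hC, mul_zero]
    · intro j hj
      simp [hJ₂ j hj]
  · intro i hi
    simp [hJ₁ i hi]

lemma exists_J (lam A : ℝ) (hlam : 1 ≤ lam) : ∃ J : Finset ℤ, ∀ j, j ∉ J → ∀ μ, A < fnorm lam μ j := by
  refine ⟨Finset.Icc (-⌈lam * A⌉) ⌈lam * A⌉, fun j hj μ => ?_⟩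
  by_contra hle
  push Not at hle
  apply hj
  have h1 : |(j : ℝ) / lam| ≤ fnorm lam μ j := by
    unfold fnorm; exact Real.abs_le_sqrt (by nlinarith [sq_nonneg μ])
  have h0 : 0 < lam := by linarith
  have h2 : |(j : ℝ)| ≤ lam * A := by
    have := h1.trans hle
    rw [abs_div, abs_of_pos h0, div_le_iff₀ h0] at this
    linarith
  have h3 := abs_le.1 (h2.trans (Int.le_ceil _))
  rw [Finset.mem_Icc]
  constructor
  · exact_mod_cast h3.1
  · exact_mod_cast h3.2

lemma abs_le_fnorm (lam μ : ℝ) (j : ℤ) : |μ| ≤ fnorm lam μ j := by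
  unfold fnorm; exact Real.abs_le_sqrt (by nlinarith [sq_nonneg ((j : ℝ) / lam)])

lemma l2sq_mul (lam : ℝ) (hlam : 1 ≤ lam) (g : ℝ → ℤ → ℂ) :
    ∑' j : ℤ, ∫⁻ μ : ℝ, ‖g μ j‖ₑ ^ 2 = ENNReal.ofReal lam * l2sq lam g := by
  unfold l2sq
  rw [← mul_assoc, ← ENNReal.ofReal_mul (by linarith), mul_one_div_cancel (by linarith)]
  simp [enorm_eq_nnnorm]

lemma const_combine (lam M θ : ℝ) (hlam : 1 ≤ lam) (hM : 1 ≤ M) (hθ : 0 < θ) (X Y : ℝ≥0∞) :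
    ENNReal.ofReal (1 / lam ^ 2) * (98 * (((ENNReal.ofReal lam * X) ^ (1 / 2 : ℝ) *
     (ENNReal.ofReal lam * Y) ^ (1 / 2 : ℝ)) *
     ((ENNReal.ofReal (2 * (lam * (20 * θ) + 1 / M))) ^ (1 / 2 : ℝ) *
       ENNReal.ofReal ((2 * Real.pi) ^ 3 * lam) ^ (1 / 2 : ℝ)))) ≤
    ENNReal.ofReal ((98 * Real.sqrt (40 * (2 * Real.pi) ^ 3)) * Real.sqrt (1 / (lam * M) + θ)) *
      X ^ (1 / 2 : ℝ) * Y ^ (1 / 2 : ℝ) := by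
  have h0 : 0 < lam := by linarith
  have hM0 : 0 < M := by linarith
  have hs : ∀ r : ℝ, 0 ≤ r → ENNReal.ofReal r ^ (1 / 2 : ℝ) = ENNReal.ofReal (Real.sqrt r) := by
    intro r hr
    rw [ENNReal.ofReal_rpow_of_nonneg hr (by norm_num), Real.sqrt_eq_rpow]
  have hπ := Real.pi_pos
  rw [ENNReal.mul_rpow_of_nonneg _ _ (by norm_num : (0 : ℝ) ≤ 1 / 2),
    ENNReal.mul_rpow_of_nonneg _ _ (by norm_num : (0 : ℝ) ≤ 1 / 2),
    hs _ h0.le, hs _ (by positivity), hs _ (by positivity)]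
  have e98 : (98 : ℝ≥0∞) = ENNReal.ofReal 98 := by simp
  rw [e98]
  calc _ = ENNReal.ofReal (1 / lam ^ 2 * (98 * ((Real.sqrt lam * Real.sqrt lam) *
        (Real.sqrt (2 * (lam * (20 * θ) + 1 / M)) * Real.sqrt ((2 * Real.pi) ^ 3 * lam))))) *
        X ^ (1 / 2 : ℝ) * Y ^ (1 / 2 : ℝ) := by
        rw [ENNReal.ofReal_mul (by positivity), ENNReal.ofReal_mul (by positivity),
          ENNReal.ofReal_mul (by positivity), ENNReal.ofReal_mul (by positivity),
          ENNReal.ofReal_mul (by positivity)]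
        ring
    _ ≤ _ := by
        gcongr ?_ * _ * _
        apply ENNReal.ofReal_le_ofReal
        rw [Real.mul_self_sqrt h0.le, ← Real.sqrt_mul (by positivity), mul_assoc 98,
          ← Real.sqrt_mul (by positivity)]
        have e1 : 1 / lam ^ 2 * (98 * (lam * Real.sqrt (2 * (lam * (20 * θ) + 1 / M) * ((2 * Real.pi) ^ 3 * lam))))
          = 98 * (1 / lam * Real.sqrt (2 * (lam * (20 * θ) + 1 / M) * ((2 * Real.pi) ^ 3 * lam))) := by
          field_simp
        rw [e1]
        gcongr
        have e2 : (1 / lam : ℝ) = Real.sqrt ((1 / lam) ^ 2) := by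
          rw [Real.sqrt_sq (by positivity)]
        rw [e2, ← Real.sqrt_mul (by positivity)]
        apply Real.sqrt_le_sqrt
        have e3 : (1 / lam) ^ 2 * (2 * (lam * (20 * θ) + 1 / M) * ((2 * Real.pi) ^ 3 * lam)) =
          (40 * (2 * Real.pi) ^ 3) * ((1 / 20) * (1 / (lam * M)) + θ) := by
          field_simp
          ring
        rw [e3]
        have : 0 ≤ 1 / (lam * M) := by positivity
        gcongr
        linarith

/-- **Angularly refined bilinear Strichartz estimate on `ℝ × 𝕋_λ`.** -/
theorem angular_bilinear_estimate : ∃ C : ℝ, 0 < C ∧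
    ∀ (lam M θ N₁ N₂ : ℝ) (g₁ g₂ : ℝ → ℤ → ℂ),
      1 ≤ lam → 1 ≤ M → 0 < θ → θ ≤ 1 → N₂ ≤ N₁ → 1 < N₂ →
      (∀ μ j, g₁ μ j ≠ 0 → N₁ ≤ fnorm lam μ j ∧ fnorm lam μ j ≤ 2 * N₁) →
      (∀ μ j, g₂ μ j ≠ 0 → N₂ ≤ fnorm lam μ j ∧ fnorm lam μ j ≤ 2 * N₂) →
      l2sq lam g₁ < ⊤ → l2sq lam g₂ < ⊤ →
      (∫⁻ t in Set.Icc (0 : ℝ) 1, ∫⁻ x : ℝ, ∫⁻ y in Set.Icc (0 : ℝ) (2 * Real.pi * lam),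
          (‖Fbilin lam M θ g₁ g₂ t x y‖₊ : ℝ≥0∞) ^ 2) ^ (1 / 2 : ℝ)
        ≤ ENNReal.ofReal (C * Real.sqrt (1 / (lam * M) + θ))
            * (l2sq lam g₁) ^ (1 / 2 : ℝ) * (l2sq lam g₂) ^ (1 / 2 : ℝ) := by
  refine ⟨98 * Real.sqrt (40 * (2 * Real.pi) ^ 3), by positivity, ?_⟩
  intro lam M θ N₁ N₂ g₁ g₂ hlam hM hθ hθ1 hN hN2 hg₁ hg₂ hl₁ hl₂
  have h0 : 0 < lam := by linarith
  obtain ⟨J, hJ⟩ := exists_J lam (2 * N₁) hlam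
  have hJ₁ : ∀ j, j ∉ J → ∀ μ, g₁ μ j = 0 := by
    intro j hj μ
    by_contra h
    have := hJ j hj μ
    linarith [(hg₁ μ j h).2]
  have hJ₂ : ∀ j, j ∉ J → ∀ μ, g₂ μ j = 0 := by
    intro j hj μ
    by_contra h
    have := hJ j hj μ
    linarith [(hg₂ μ j h).2]
  have hs₁ : ∀ j μ, g₁ μ j ≠ 0 → |μ| ≤ 2 * N₁ := fun j μ h =>
    (abs_le_fnorm lam μ j).trans (hg₁ μ j h).2
  have hs₂ : ∀ j μ, g₂ μ j ≠ 0 → |μ| ≤ 2 * N₁ := fun j μ h =>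
    ((abs_le_fnorm lam μ j).trans (hg₂ μ j h).2).trans (by linarith)
  have hL₁ : ∀ j, ∫⁻ μ, ‖g₁ μ j‖ₑ ^ 2 ≠ ⊤ := by
    intro j
    refine ne_top_of_le_ne_top ?_ (ENNReal.le_tsum (f := fun j : ℤ => ∫⁻ μ, ‖g₁ μ j‖ₑ ^ 2) j)
    rw [l2sq_mul lam hlam]
    exact ENNReal.mul_ne_top ENNReal.ofReal_ne_top hl₁.ne
  have hL₂ : ∀ j, ∫⁻ μ, ‖g₂ μ j‖ₑ ^ 2 ≠ ⊤ := by
    intro j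
    refine ne_top_of_le_ne_top ?_ (ENNReal.le_tsum (f := fun j : ℤ => ∫⁻ μ, ‖g₂ μ j‖ₑ ^ 2) j)
    rw [l2sq_mul lam hlam]
    exact ENNReal.mul_ne_top ENNReal.ofReal_ne_top hl₂.ne
  choose U₁ hU₁ hm₁ hx₁ using fun j => meas_core (fun μ => g₁ μ j)
  choose U₂ hU₂ hm₂ hx₂ using fun j => meas_core (fun μ => g₂ μ j)
  choose W hW hWi hWb hWe using fun i j => pair_red {p : ℝ × ℝ | Creg lam M θ p.1 i p.2 j}
    (measurableSet_Creg lam M θ i j) (fun μ => g₁ μ i) (fun μ => g₂ μ j) (2 * N₁) (by linarith)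
    (hs₁ i) (hs₂ j) (hL₁ i) (hL₂ j) (U₁ i) (U₂ j) (hU₁ i) (hU₂ j) (hm₁ i) (hm₂ j) (hx₁ i) (hx₂ j)
  have hfull := full_est lam M θ hlam hM hθ hθ1 J W hW hWi
    (fun μ j => ‖(U₁ j).indicator (fun μ => g₁ μ j) μ‖ₑ)
    (fun μ j => ‖(U₂ j).indicator (fun μ => g₂ μ j) μ‖ₑ)
    (fun j => (hm₁ j).enorm) (fun j => (hm₂ j).enorm)
    (by
      intro μ j h
      have : g₁ μ j ≠ 0 := fun h' => h (by simp [Set.indicator_apply, h'])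
      linarith [(hg₁ μ j this).1])
    (by
      intro μ j h
      have : g₂ μ j ≠ 0 := fun h' => h (by simp [Set.indicator_apply, h'])
      linarith [(hg₂ μ j this).1])
    (by
      intro i j q
      have := hWb i j q
      convert this using 2
      exact Iff.rfl)
  have ha : ∑' j, ∫⁻ μ, ‖(U₁ j).indicator (fun μ => g₁ μ j) μ‖ₑ ^ 2 ≤
      ENNReal.ofReal lam * l2sq lam g₁ := by
    rw [← l2sq_mul lam hlam]
    refine ENNReal.tsum_le_tsum fun j => lintegral_mono fun μ => ?_
    gcongr
    exact enorm_indicator_le_enorm_self _ _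
  have hb : ∑' j, ∫⁻ μ, ‖(U₂ j).indicator (fun μ => g₂ μ j) μ‖ₑ ^ 2 ≤
      ENNReal.ofReal lam * l2sq lam g₂ := by
    rw [← l2sq_mul lam hlam]
    refine ENNReal.tsum_le_tsum fun j => lintegral_mono fun μ => ?_
    gcongr
    exact enorm_indicator_le_enorm_self _ _
  have hc : ‖((1 / lam ^ 2 : ℝ) : ℂ)‖ₑ = ENNReal.ofReal (1 / lam ^ 2) := by
    rw [← ofReal_norm, Complex.norm_real, Real.norm_of_nonneg (by positivity)]
  set c : ℝ≥0∞ := ENNReal.ofReal (1 / lam ^ 2) with hcdef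
  have hct : c ^ 2 ≠ ⊤ := ENNReal.pow_ne_top ENNReal.ofReal_ne_top
  have hred : ∫⁻ t in Set.Icc (0 : ℝ) 1, ∫⁻ x : ℝ, ∫⁻ y in Set.Icc (0 : ℝ) (2 * Real.pi * lam),
      (‖Fbilin lam M θ g₁ g₂ t x y‖₊ : ℝ≥0∞) ^ 2 =
      c ^ 2 * ∫⁻ t in Set.Ioc (0 : ℝ) 1, ∫⁻ x : ℝ,
        ∫⁻ y in Set.Ioc 0 (2 * Real.pi * lam), ‖Fsum lam J W (t, x, y)‖ₑ ^ 2 := by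
    rw [← lintegral_const_mul' _ _ hct, Measure.restrict_congr_set Ioc_ae_eq_Icc.symm]
    refine lintegral_congr fun t => ?_
    rw [← lintegral_const_mul' _ _ hct]
    have hae : ∀ᵐ x : ℝ, ∀ i j : ℤ, _ := ae_all_iff.2 fun i => ae_all_iff.2 fun j => hWe i j t
    refine lintegral_congr_ae ?_
    filter_upwards [hae] with x hx
    rw [← lintegral_const_mul' _ _ hct, Measure.restrict_congr_set Ioc_ae_eq_Icc.symm]
    refine lintegral_congr fun y => ?_
    rw [Fbilin_eq lam M θ g₁ g₂ J hJ₁ hJ₂ W t x y hx, ← enorm_eq_nnnorm,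
      enorm_mul, hc, mul_pow]
  rw [hred, ENNReal.mul_rpow_of_nonneg _ _ (by norm_num : (0 : ℝ) ≤ 1 / 2), half_sq]
  refine le_trans ?_ (const_combine lam M θ hlam hM hθ _ _)
  gcongr
  refine hfull.trans ?_
  gcongr
end
end

section
/- There is an absolute constant C > 0 such that for all λ ≥ 1, M ≥ 1, 0 < θ ≤ 1, reals N₁ ≥ N₂ > 1, all τ ∈ ℝ, all ξ = (μ,η) ∈ ℝ×(1/λ)ℤ, and all angles α₁, α₂ ∈ ℝ, the set M(τ,ξ) of all ξ₂ = (μ₂,η₂) ∈ ℝ×(1/λ)ℤ satisfying: (i) ξ₂ lies in the sector of aperture θ about α₁; (ii) ξ−ξ₂ lies in the sector of aperture θ about α₂; (iii) |ξ₂·(ξ−ξ₂)| ≤ θ|ξ₂||ξ−ξ₂|; (iv) N₂ ≤ |ξ₂| ≤ 2N₂ and N₁ ≤ |ξ−ξ₂| ≤ 2N₁; (v) |μ − 2μ₂| ≥ M; (vi) |τ − |ξ₂|² − |ξ−ξ₂|²| ≤ 1, has measure μ_λ(M(τ,ξ)) ≤ C (1/(λM) + θ). -/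
noncomputable section
open MeasureTheory
open scoped ENNReal Classical

/-- The vector `(vx, vy)` lies in the sector of aperture `θ` about the angle `α`:
`v·(cos α, sin α) ≥ |v| cos θ`. -/
def inSector (θ α vx vy : ℝ) : Prop :=
  Real.sqrt (vx ^ 2 + vy ^ 2) * Real.cos θ ≤ vx * Real.cos α + vy * Real.sin α

lemma rs_range (S : ℤ → Set ℝ) (δ r : ℝ) (hδ : 0 < δ)
    (hb : ∀ j j' : ℤ, (S j).Nonempty → (S j').Nonempty → δ * ((j' : ℝ) - j) ≤ r) :
    (∀ j, S j = ∅) ∨ ∃ a b : ℤ, a ≤ b ∧ (S a).Nonempty ∧ (S b).Nonempty ∧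
      ∀ j, j ∉ Finset.Icc a b → S j = ∅ := by
  by_cases hne : ∃ j, (S j).Nonempty
  · right
    obtain ⟨j0, hj0⟩ := hne
    obtain ⟨a, ha, ha'⟩ := Int.exists_least_of_bdd (P := fun j => (S j).Nonempty)
      ⟨j0 - ⌈r / δ⌉, fun z hz => by
        have h1 := hb z j0 hz hj0
        have h2 : (j0 : ℝ) - z ≤ r / δ := by rw [le_div_iff₀ hδ]; linarith
        have h3 := Int.le_ceil (r / δ)
        have h4 : (j0 : ℝ) - z ≤ (⌈r / δ⌉ : ℤ) := h2.trans h3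
        have h5 : j0 - z ≤ ⌈r / δ⌉ := by exact_mod_cast h4
        linarith⟩ ⟨j0, hj0⟩
    obtain ⟨b, hb1, hb'⟩ := Int.exists_greatest_of_bdd (P := fun j => (S j).Nonempty)
      ⟨j0 + ⌈r / δ⌉, fun z hz => by
        have h1 := hb j0 z hj0 hz
        have h2 : (z : ℝ) - j0 ≤ r / δ := by rw [le_div_iff₀ hδ]; linarith
        have h3 := Int.le_ceil (r / δ)
        have h4 : (z : ℝ) - j0 ≤ (⌈r / δ⌉ : ℤ) := h2.trans h3
        have h5 : z - j0 ≤ ⌈r / δ⌉ := by exact_mod_cast h4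
        linarith⟩ ⟨j0, hj0⟩
    refine ⟨a, b, ha' b hb1, ha, hb1, fun j hj => ?_⟩
    by_contra hc
    have hn := Set.nonempty_iff_ne_empty.mpr hc
    exact hj (Finset.mem_Icc.mpr ⟨ha' j hn, hb' j hn⟩)
  · left
    intro j
    by_contra hc
    exact hne ⟨j, Set.nonempty_iff_ne_empty.mpr hc⟩

lemma rs_sum (S : ℤ → Set ℝ) (g : ℤ → ℝ) (a b : ℤ) (u : ℝ → ℝ)
    (hu : ∀ x y, |x - y| ≤ |u x - u y|)
    (hg : ∀ j ∈ Finset.Icc a b, 0 ≤ g j)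
    (hS : ∀ j ∈ Finset.Icc a b, ∀ x ∈ S j, ∀ y ∈ S j, |u x - u y| ≤ g j)
    (hS0 : ∀ j, j ∉ Finset.Icc a b → S j = ∅) :
    ∑' j, volume (S j) ≤ ENNReal.ofReal (∑ j ∈ Finset.Icc a b, g j) := by
  rw [tsum_eq_sum (s := Finset.Icc a b) (fun j hj => by rw [hS0 j hj]; simp),
    ENNReal.ofReal_sum_of_nonneg hg]
  refine Finset.sum_le_sum fun j hj => (Real.volume_le_diam _).trans ?_
  refine Metric.ediam_le fun x hx y hy => ?_
  rw [edist_dist, Real.dist_eq]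
  exact ENNReal.ofReal_le_ofReal ((hu x y).trans (hS j hj x hx y hy))

lemma rs_card (a b : ℤ) (h : a ≤ b) : ((Finset.Icc a b).card : ℝ) = (b : ℝ) - a + 1 := by
  rw [Int.card_Icc]
  have : ((b + 1 - a).toNat : ℤ) = b + 1 - a := Int.toNat_of_nonneg (by linarith)
  have h2 : (((b + 1 - a).toNat : ℤ) : ℝ) = ((b + 1 - a : ℤ) : ℝ) := by rw [this]
  push_cast at h2 ⊢
  linarith

lemma rs_tele (f : ℤ → ℝ) (U : ℤ → ℝ) (a b : ℤ) (h : a ≤ b)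
    (hf : ∀ j, a ≤ j → j < b → f j ≤ U j - U (j + 1)) :
    ∑ j ∈ Finset.Icc a b, f j ≤ U a - U b + f b := by
  induction b, h using Int.leInduction with
  | base => simp
  | succ n hn ih =>
    have e : Finset.Icc a (n + 1) = insert (n + 1) (Finset.Icc a n) := by
      ext z; simp only [Finset.mem_Icc, Finset.mem_insert]; omega
    rw [e, Finset.sum_insert (by simp)]
    have := ih (fun j h1 h2 => hf j h1 (by linarith))
    have := hf n hn (by linarith)
    linarith

/-- the slice away from the top -/
lemma rs_B (S : ℤ → Set ℝ) (δ b0 ρ M r : ℝ) (u : ℝ → ℝ) (h : ℤ → ℝ)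
    (hδ : 0 < δ) (hρ : 0 < ρ) (hM : 1 ≤ M) (hr : 0 < r)
    (hu : ∀ x y, |x - y| ≤ |u x - u y|) (hh : ∀ j : ℤ, h j = b0 + δ * j)
    (h1 : ∀ j, ∀ x ∈ S j, M ≤ u x ∧ ρ ^ 2 - 4 ≤ u x ^ 2 + h j ^ 2 ∧ u x ^ 2 + h j ^ 2 ≤ ρ ^ 2)
    (h2 : ∀ j, ∀ x ∈ S j, |h j| ≤ ρ / 2)
    (h3 : ∀ j j', ∀ x ∈ S j, ∀ x' ∈ S j', |u x - u x'| ≤ r ∧ |h j - h j'| ≤ r) :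
    ∑' j, volume (S j) ≤ ENNReal.ofReal (30 * (r / (δ * ρ)) + 6 / M) := by
  rcases rs_range S δ r hδ (fun j j' ⟨x, hx⟩ ⟨x', hx'⟩ => by
    have := (h3 j j' x hx x' hx').2
    rw [hh, hh] at this
    have := neg_abs_le (b0 + δ * j - (b0 + δ * j'))
    linarith) with h0 | ⟨a, b, hab, ⟨xa, hxa⟩, ⟨xb, hxb⟩, hS0⟩
  · simp [h0]
  have key : ∀ j, ∀ x ∈ S j, ρ / 3 ≤ u x := by
    intro j x hx
    obtain ⟨p1, p2, p3⟩ := h1 j x hx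
    have q := h2 j x hx
    have q2 : h j ^ 2 ≤ (ρ / 2) ^ 2 := sq_le_sq' (by linarith [neg_abs_le (h j)]) (by linarith [le_abs_self (h j)])
    nlinarith
  have hMρ : M ≤ ρ := by
    obtain ⟨p1, p2, p3⟩ := h1 a xa hxa
    nlinarith [sq_nonneg (h a)]
  refine (rs_sum S (fun _ => 6 / ρ) a b u hu (fun _ _ => by positivity) ?_ hS0).trans ?_
  · intro j _ x hx y hy
    obtain ⟨p1, p2, p3⟩ := h1 j x hx
    obtain ⟨q1, q2, q3⟩ := h1 j y hy
    have k1 := key j x hx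
    have k2 := key j y hy
    rw [le_div_iff₀ hρ]
    rcases abs_cases (u x - u y) with ⟨e, _⟩ | ⟨e, _⟩ <;> rw [e] <;> nlinarith
  · apply ENNReal.ofReal_le_ofReal
    rw [Finset.sum_const, nsmul_eq_mul, rs_card a b hab]
    have hb := (h3 a b xa hxa xb hxb).2
    rw [hh, hh] at hb
    have hb' : (b : ℝ) - a ≤ r / δ := by
      rw [le_div_iff₀ hδ]
      have := neg_abs_le (b0 + δ * a - (b0 + δ * b))
      linarith
    have e1 : 6 / ρ ≤ 6 / M := by gcongr
    have e2 : ((b : ℝ) - a) * (6 / ρ) ≤ r / δ * (6 / ρ) := by gcongr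
    have e3 : r / δ * (6 / ρ) = 6 * (r / (δ * ρ)) := by field_simp
    have e4 : 0 ≤ r / (δ * ρ) := by positivity
    linarith

lemma rs_slice1 (p q U : ℝ) (hU : 0 < U) (hp : U * (4 / 9) ≤ p) (hq : U * (4 / 9) ≤ q)
    (hpq : p ^ 2 - q ^ 2 ≤ 4) : (p - q) * U ≤ 5 := by
  by_cases h : p ≤ q
  · nlinarith
  · push Not at h
    nlinarith [mul_nonneg (sub_nonneg.mpr h.le) (by linarith : 0 ≤ p + q - U * (8 / 9))]

lemma rs_slice0 (p U : ℝ) (_ : 0 < U) (_ : 1 ≤ p) (_ : U ^ 2 ≤ p ^ 2 + 4) :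
    U * (4 / 9) ≤ p := by
  nlinarith

/-- the slice near the top -/
lemma rs_A (S : ℤ → Set ℝ) (δ b0 ρ M r : ℝ) (u : ℝ → ℝ) (h : ℤ → ℝ)
    (hδ : 0 < δ) (hρ : 0 < ρ) (hM : 1 ≤ M) (hr : 0 < r)
    (hu : ∀ x y, |x - y| ≤ |u x - u y|) (hh : ∀ j : ℤ, h j = b0 + δ * j)
    (h1 : ∀ j, ∀ x ∈ S j, M ≤ u x ∧ ρ ^ 2 - 4 ≤ u x ^ 2 + h j ^ 2 ∧ u x ^ 2 + h j ^ 2 ≤ ρ ^ 2)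
    (h2 : ∀ j, ∀ x ∈ S j, ρ / 2 ≤ h j)
    (h3 : ∀ j j', ∀ x ∈ S j, ∀ x' ∈ S j', |u x - u x'| ≤ r ∧ |h j - h j'| ≤ r) :
    ∑' j, volume (S j) ≤ ENNReal.ofReal (30 * (r / (δ * ρ)) + 6 / M) := by
  rcases rs_range S δ r hδ (fun j j' ⟨x, hx⟩ ⟨x', hx'⟩ => by
    have := (h3 j j' x hx x' hx').2
    rw [hh, hh] at this
    have := neg_abs_le (b0 + δ * j - (b0 + δ * j'))
    linarith) with h0 | ⟨a, b, hab, ⟨xa, hxa⟩, ⟨xb, hxb⟩, hS0⟩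
  · simp [h0]
  have hM0 : 0 < M := by linarith
  obtain ⟨a1, a2, a3⟩ := h1 a xa hxa
  obtain ⟨b1, b2, b3⟩ := h1 b xb hxb
  have ah := h2 a xa hxa
  have bh := h2 b xb hxb
  have ab := (h3 a b xa hxa xb hxb).1
  have e4 : 0 ≤ r / (δ * ρ) := by positivity
  have e5 : 0 < 1 / M := by positivity
  have e6 : 6 / M = 6 * (1 / M) := by ring
  have hmono : ∀ j, a ≤ j → j ≤ b → h a ≤ h j ∧ h j ≤ h b := by
    intro j j1 j2
    have j1' : (a : ℝ) ≤ j := by exact_mod_cast j1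
    have j2' : (j : ℝ) ≤ b := by exact_mod_cast j2
    rw [hh, hh, hh]
    constructor <;> gcongr
  by_cases hc : 1 ≤ u xa * r
  · -- telescoping
    set U : ℤ → ℝ := fun j => Real.sqrt (ρ ^ 2 - h j ^ 2) with hU
    have hpos : ∀ j, a ≤ j → j ≤ b → M ^ 2 ≤ ρ ^ 2 - h j ^ 2 := by
      intro j j1 j2
      obtain ⟨p, q⟩ := hmono j j1 j2
      nlinarith
    have hUsq : ∀ j, a ≤ j → j ≤ b → U j ^ 2 = ρ ^ 2 - h j ^ 2 := by
      intro j j1 j2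
      exact Real.sq_sqrt (by nlinarith [hpos j j1 j2])
    have hUM : ∀ j, a ≤ j → j ≤ b → M ≤ U j := by
      intro j j1 j2
      exact Real.le_sqrt_of_sq_le (hpos j j1 j2)
    refine (rs_sum S (fun j => 5 / U j) a b u hu (fun _ _ => by positivity) ?_ hS0).trans ?_
    · intro j hj x hx y hy
      obtain ⟨j1, j2⟩ := Finset.mem_Icc.mp hj
      obtain ⟨p1, p2, p3⟩ := h1 j x hx
      obtain ⟨q1, q2, q3⟩ := h1 j y hy
      have k := hUM j j1 j2
      have k2 := hUsq j j1 j2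
      have kx : U j * (4 / 9) ≤ u x := rs_slice0 _ _ (by linarith) (by linarith) (by linarith)
      have ky : U j * (4 / 9) ≤ u y := rs_slice0 _ _ (by linarith) (by linarith) (by linarith)
      rw [le_div_iff₀ (by linarith)]
      rcases abs_cases (u x - u y) with ⟨e, _⟩ | ⟨e, _⟩ <;> rw [e]
      · exact rs_slice1 _ _ _ (by linarith) kx ky (by linarith)
      · rw [neg_sub]
        exact rs_slice1 _ _ _ (by linarith) ky kx (by linarith)
    · apply ENNReal.ofReal_le_ofReal
      have ht := rs_tele (fun j => 5 / U j) (fun j => 10 / (δ * ρ) * U j) a b hab (by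
        intro j j1 j2
        have k1 := hUM j j1 j2.le
        have k2 := hUsq j j1 j2.le
        have k3 := hUM (j + 1) (by linarith) (by linarith)
        have k4 := hUsq (j + 1) (by linarith) (by linarith)
        have hj := (hmono j j1 j2.le).1
        have hs : h (j + 1) = h j + δ := by rw [hh, hh]; push_cast; ring
        rw [hs] at k4
        have hd : U j ^ 2 - U (j + 1) ^ 2 ≥ δ * ρ := by nlinarith
        have hd2 : U (j + 1) ≤ U j := by
          have : 0 < δ * ρ := by positivity
          nlinarith
        have hU0 : 0 < U j := by linarith
        have : δ * ρ ≤ (U j - U (j + 1)) * (2 * U j) := by nlinarith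
        have e : 10 / (δ * ρ) * U j - 10 / (δ * ρ) * U (j + 1)
          = 10 * (U j - U (j + 1)) / (δ * ρ) := by ring
        rw [e, div_le_div_iff₀ hU0 (by positivity)]
        linarith)
      refine ht.trans ?_
      have kb := hUM b hab le_rfl
      have kb2 := hUsq b hab le_rfl
      have ka := hUM a le_rfl hab
      have ka2 := hUsq a le_rfl hab
      have f1 : 5 / U b ≤ 5 / M := by gcongr
      have f2 : u xb ≤ U b := Real.le_sqrt_of_sq_le (by linarith)
      have f3' : u xa ≤ U a := Real.le_sqrt_of_sq_le (by linarith)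
      have f3 : U a ≤ u xa + 2 * r := by nlinarith
      have f4 : U a - U b ≤ 3 * r := by linarith [le_abs_self (u xa - u xb)]
      have f5 : 10 / (δ * ρ) * (U a - U b) ≤ 10 / (δ * ρ) * (3 * r) := by gcongr
      have f6 : 10 / (δ * ρ) * (3 * r) = 30 * (r / (δ * ρ)) := by ring
      have f7 : 5 / M = 5 * (1 / M) := by ring
      linarith
  · push Not at hc
    have hrM : r ≤ 1 / M := by
      rw [le_div_iff₀ hM0]; nlinarith
    have hr1 : r ≤ 1 := by nlinarith
    refine (rs_sum S (fun _ => r) a b u hu (fun _ _ => hr.le)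
      (fun j _ x hx y hy => (h3 j j x hx y hy).1) hS0).trans ?_
    apply ENNReal.ofReal_le_ofReal
    rw [Finset.sum_const, nsmul_eq_mul, rs_card a b hab]
    have g1 : u xa ^ 2 - u xb ^ 2 ≤ 3 := by
      have := abs_le.mp ab
      nlinarith
    have g2 : (h b - h a) * ρ ≤ 7 := by
      have := (hmono b hab le_rfl).1
      nlinarith
    have g3 : (b : ℝ) - a ≤ 7 / (δ * ρ) := by
      rw [le_div_iff₀ (by positivity)]
      rw [hh, hh] at g2
      linarith
    have g4 : ((b : ℝ) - a) * r ≤ 7 / (δ * ρ) * r := by gcongr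
    have g5 : 7 / (δ * ρ) * r = 7 * (r / (δ * ρ)) := by ring
    linarith

lemma rs_C (S : ℤ → Set ℝ) (δ b0 ρ M r : ℝ) (u : ℝ → ℝ) (h : ℤ → ℝ)
    (hδ : 0 < δ) (hρ : 0 < ρ) (hM : 1 ≤ M) (hr : 0 < r)
    (hu : ∀ x y, |x - y| ≤ |u x - u y|) (hh : ∀ j : ℤ, h j = b0 - δ * j)
    (h1 : ∀ j, ∀ x ∈ S j, M ≤ u x ∧ ρ ^ 2 - 4 ≤ u x ^ 2 + h j ^ 2 ∧ u x ^ 2 + h j ^ 2 ≤ ρ ^ 2)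
    (h3 : ∀ j j', ∀ x ∈ S j, ∀ x' ∈ S j', |u x - u x'| ≤ r ∧ |h j - h j'| ≤ r) :
    ∑' j, volume (S j) ≤ 3 * ENNReal.ofReal (30 * (r / (δ * ρ)) + 6 / M) := by
  have hA : ∑' j, volume {x ∈ S j | ρ / 2 ≤ h j} ≤
      ENNReal.ofReal (30 * (r / (δ * ρ)) + 6 / M) := by
    rw [← (Equiv.neg ℤ).tsum_eq]
    exact rs_A (fun j => {x ∈ S (-j) | ρ / 2 ≤ h (-j)}) δ b0 ρ M r u (fun j => h (-j)) hδ hρ hM hr hu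
      (fun j => by rw [hh]; push_cast; ring) (fun j x hx => h1 _ x hx.1) (fun j x hx => hx.2)
      (fun j j' x hx x' hx' => h3 _ _ x hx.1 x' hx'.1)
  have hA2 : ∑' j, volume {x ∈ S j | ρ / 2 ≤ -h j} ≤
      ENNReal.ofReal (30 * (r / (δ * ρ)) + 6 / M) := by
    exact rs_A (fun j => {x ∈ S j | ρ / 2 ≤ -h j}) δ (-b0) ρ M r u (fun j => -h j) hδ hρ hM hr hu
      (fun j => by rw [hh]; ring) (fun j x hx => by simpa using h1 _ x hx.1) (fun j x hx => hx.2)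
      (fun j j' x hx x' hx' => by
        have := h3 _ _ x hx.1 x' hx'.1
        rw [← abs_neg (h j - h j')] at this
        rwa [show -h j - -h j' = -(h j - h j') by ring])
  have hB : ∑' j, volume {x ∈ S j | |h j| ≤ ρ / 2} ≤
      ENNReal.ofReal (30 * (r / (δ * ρ)) + 6 / M) := by
    exact rs_B (fun j => {x ∈ S j | |h j| ≤ ρ / 2}) δ (-b0) ρ M r u (fun j => -h j) hδ hρ hM hr hu
      (fun j => by rw [hh]; ring) (fun j x hx => by simpa using h1 _ x hx.1)
      (fun j x hx => by simpa using hx.2)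
      (fun j j' x hx x' hx' => by
        have := h3 _ _ x hx.1 x' hx'.1
        rw [← abs_neg (h j - h j')] at this
        rwa [show -h j - -h j' = -(h j - h j') by ring])
  calc ∑' j, volume (S j) ≤ ∑' j, (volume {x ∈ S j | ρ / 2 ≤ h j} +
        volume {x ∈ S j | ρ / 2 ≤ -h j} + volume {x ∈ S j | |h j| ≤ ρ / 2}) := by
        refine ENNReal.tsum_le_tsum fun j => ?_
        refine (measure_mono ?_).trans ((measure_union_le _ _).trans
          (add_le_add (measure_union_le _ _) le_rfl))
        intro x hx
        by_cases c1 : ρ / 2 ≤ h j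
        · exact Or.inl (Or.inl ⟨hx, c1⟩)
        by_cases c2 : ρ / 2 ≤ -h j
        · exact Or.inl (Or.inr ⟨hx, c2⟩)
        · exact Or.inr ⟨hx, abs_le.mpr ⟨by linarith, by linarith⟩⟩
    _ ≤ _ := by
        rw [ENNReal.tsum_add, ENNReal.tsum_add]
        refine (add_le_add (add_le_add hA hA2) hB).trans (le_of_eq ?_)
        ring

lemma rs_D (S : ℤ → Set ℝ) (δ b0 ρ M r : ℝ) (u : ℝ → ℝ) (h : ℤ → ℝ)
    (hδ : 0 < δ) (hρ : 0 < ρ) (hM : 1 ≤ M) (hr : 0 < r)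
    (hu : ∀ x y, |x - y| ≤ |u x - u y|) (hh : ∀ j : ℤ, h j = b0 - δ * j)
    (h1 : ∀ j, ∀ x ∈ S j, M ≤ |u x| ∧ ρ ^ 2 - 4 ≤ u x ^ 2 + h j ^ 2 ∧ u x ^ 2 + h j ^ 2 ≤ ρ ^ 2)
    (h3 : ∀ j j', ∀ x ∈ S j, ∀ x' ∈ S j', |u x - u x'| ≤ r ∧ |h j - h j'| ≤ r) :
    ∑' j, volume (S j) ≤ ENNReal.ofReal (180 * (r / (δ * ρ)) + 36 / M) := by
  have hP := rs_C (fun j => {x ∈ S j | M ≤ u x}) δ b0 ρ M r u h hδ hρ hM hr hu hh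
    (fun j x hx => ⟨hx.2, (h1 j x hx.1).2⟩) (fun j j' x hx x' hx' => h3 _ _ x hx.1 x' hx'.1)
  have hN := rs_C (fun j => {x ∈ S j | M ≤ -u x}) δ b0 ρ M r (fun x => -u x) h hδ hρ hM hr
    (fun x y => by
      rw [show -u x - -u y = -(u x - u y) by ring, abs_neg]; exact hu x y) hh
    (fun j x hx => ⟨hx.2, by simpa using (h1 j x hx.1).2⟩)
    (fun j j' x hx x' hx' => by
      rw [show -u x - -u x' = -(u x - u x') by ring, abs_neg]; exact h3 _ _ x hx.1 x' hx'.1)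
  calc ∑' j, volume (S j) ≤ ∑' j, (volume {x ∈ S j | M ≤ u x} +
        volume {x ∈ S j | M ≤ -u x}) := by
        refine ENNReal.tsum_le_tsum fun j => ?_
        refine (measure_mono ?_).trans (measure_union_le _ _)
        intro x hx
        rcases le_abs.mp (h1 j x hx).1 with c | c
        · exact Or.inl ⟨hx, c⟩
        · exact Or.inr ⟨hx, c⟩
    _ ≤ _ := by
        rw [ENNReal.tsum_add]
        refine (add_le_add hP hN).trans (le_of_eq ?_)
        rw [← add_mul, show 180 * (r / (δ * ρ)) + 36 / M = 6 * (30 * (r / (δ * ρ)) + 6 / M) by ring,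
          ENNReal.ofReal_mul (by norm_num)]
        norm_num

lemma rs_perp (θ α x y n : ℝ) (h0 : 0 < θ) (h1 : θ ≤ 1) (hn : 0 ≤ n) (hn2 : n ^ 2 = x ^ 2 + y ^ 2)
    (hs : n * Real.cos θ ≤ x * Real.cos α + y * Real.sin α) :
    |x * Real.cos α + y * Real.sin α| ≤ n ∧ |y * Real.cos α - x * Real.sin α| ≤ θ * n := by
  have e := Real.sin_sq_add_cos_sq α
  have e2 := Real.sin_sq_add_cos_sq θ
  have id1 : (x * Real.cos α + y * Real.sin α) ^ 2 + (y * Real.cos α - x * Real.sin α) ^ 2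
      = n ^ 2 := by
    rw [hn2]; linear_combination (x ^ 2 + y ^ 2) * e
  have hc : 0 ≤ Real.cos θ := Real.cos_nonneg_of_neg_pi_div_two_le_of_le
    (by linarith [Real.pi_gt_three]) (by linarith [Real.pi_gt_three])
  have hsin : Real.sin θ ≤ θ := Real.sin_le h0.le
  have hsin0 : 0 ≤ Real.sin θ := Real.sin_nonneg_of_nonneg_of_le_pi h0.le (by linarith [Real.pi_gt_three])
  have h3 : (n * Real.cos θ) ^ 2 ≤ (x * Real.cos α + y * Real.sin α) ^ 2 :=
    pow_le_pow_left₀ (by positivity) hs 2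
  have h4 : Real.sin θ ^ 2 ≤ θ ^ 2 := pow_le_pow_left₀ hsin0 hsin 2
  constructor
  · apply abs_le_of_sq_le_sq _ hn
    nlinarith [sq_nonneg (y * Real.cos α - x * Real.sin α)]
  · apply abs_le_of_sq_le_sq _ (by positivity)
    have : n ^ 2 * Real.sin θ ^ 2 ≤ n ^ 2 * θ ^ 2 := by gcongr
    nlinarith

lemma rs_cross (θ α x y n x' y' n' : ℝ) (h0 : 0 < θ) (h1 : θ ≤ 1)
    (hn : 0 ≤ n) (hn2 : n ^ 2 = x ^ 2 + y ^ 2)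
    (hn' : 0 ≤ n') (hn2' : n' ^ 2 = x' ^ 2 + y' ^ 2)
    (hs : n * Real.cos θ ≤ x * Real.cos α + y * Real.sin α)
    (hs' : n' * Real.cos θ ≤ x' * Real.cos α + y' * Real.sin α) :
    |x * y' - y * x'| ≤ 2 * θ * n * n' := by
  obtain ⟨a1, a2⟩ := rs_perp θ α x y n h0 h1 hn hn2 hs
  obtain ⟨b1, b2⟩ := rs_perp θ α x' y' n' h0 h1 hn' hn2' hs'
  have e := Real.sin_sq_add_cos_sq α
  have id1 : x * y' - y * x' = (x * Real.cos α + y * Real.sin α) * (y' * Real.cos α - x' * Real.sin α)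
     - (y * Real.cos α - x * Real.sin α) * (x' * Real.cos α + y' * Real.sin α) := by
    linear_combination (-(x * y' - y * x')) * e
  rw [id1]
  refine (abs_sub _ _).trans ?_
  rw [abs_mul, abs_mul]
  have t1 : |x * Real.cos α + y * Real.sin α| * |y' * Real.cos α - x' * Real.sin α| ≤ n * (θ * n') := by
    gcongr
  have t2 : |y * Real.cos α - x * Real.sin α| * |x' * Real.cos α + y' * Real.sin α| ≤ θ * n * n' := by
    gcongr
  linarith

lemma rs_comp (D X A B a b θ n m n' m' : ℝ) (hθ : 0 < θ) (hn : 0 < n) (hm : 0 < m)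
    (id : D * X = A * a - B * b) (hX : n * m / 2 ≤ |X|)
    (hA : |A| ≤ 2 * θ * m' * m) (hB : |B| ≤ 2 * θ * n' * n) (ha : |a| ≤ n) (hb : |b| ≤ m)
    (hn' : 0 ≤ n') (hm' : 0 ≤ m') : |D| ≤ 4 * θ * (n' + m') := by
  have h1 : |D| * |X| ≤ 2 * θ * m' * m * n + 2 * θ * n' * n * m := by
    rw [← abs_mul, id]
    refine (abs_sub _ _).trans ?_
    rw [abs_mul, abs_mul]
    gcongr
  have h2 : |D| * (n * m / 2) ≤ |D| * |X| := by gcongr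
  have h3 : 0 < n * m := by positivity
  by_contra hc
  push Not at hc
  nlinarith

lemma rs_geo (θ α₁ α₂ x1 x2 y1 y2 x1' x2' y1' y2' n m n' m' N : ℝ)
    (h0 : 0 < θ) (h1 : θ ≤ 1 / 2) (e1 : x1 + y1 = x1' + y1') (e2 : x2 + y2 = x2' + y2')
    (hn : 0 < n) (hn2 : n ^ 2 = x1 ^ 2 + x2 ^ 2)
    (hm : 0 < m) (hm2 : m ^ 2 = y1 ^ 2 + y2 ^ 2)
    (hn' : 0 < n') (hn2' : n' ^ 2 = x1' ^ 2 + x2' ^ 2)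
    (hm' : 0 < m') (hm2' : m' ^ 2 = y1' ^ 2 + y2' ^ 2)
    (sx : n * Real.cos θ ≤ x1 * Real.cos α₁ + x2 * Real.sin α₁)
    (sx' : n' * Real.cos θ ≤ x1' * Real.cos α₁ + x2' * Real.sin α₁)
    (sy : m * Real.cos θ ≤ y1 * Real.cos α₂ + y2 * Real.sin α₂)
    (sy' : m' * Real.cos θ ≤ y1' * Real.cos α₂ + y2' * Real.sin α₂)
    (ho : |x1 * y1 + x2 * y2| ≤ θ * n * m)
    (hN1 : n' ≤ 2 * N) (hN2 : m' ≤ 2 * N) :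
    |x1 - x1'| ≤ 16 * θ * N ∧ |x2 - x2'| ≤ 16 * θ * N := by
  have cx := rs_cross θ α₁ x1' x2' n' x1 x2 n h0 (by linarith) hn'.le hn2' hn.le hn2 sx' sx
  have cy := rs_cross θ α₂ y1' y2' m' y1 y2 m h0 (by linarith) hm'.le hm2' hm.le hm2 sy' sy
  have hX : n * m / 2 ≤ |x1 * y2 - x2 * y1| := by
    have id1 : (x1 * y1 + x2 * y2) ^ 2 + (x1 * y2 - x2 * y1) ^ 2 = (n * m) ^ 2 := by
      rw [mul_pow, hn2, hm2]; ring
    have k : |x1 * y1 + x2 * y2| ≤ n * m / 2 := by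
      have h5 : 0 < n * m := by positivity
      have : θ * (n * m) ≤ 1 / 2 * (n * m) := mul_le_mul_of_nonneg_right h1 h5.le
      linarith
    have k2 : (x1 * y1 + x2 * y2) ^ 2 ≤ (n * m / 2) ^ 2 := by
      rw [← sq_abs]; gcongr
    refine (sq_le_sq₀ (by positivity) (abs_nonneg _)).1 ?_
    rw [sq_abs]
    linarith [sq_nonneg (n * m)]
  have b1 : |x1| ≤ n := abs_le_of_sq_le_sq (by linarith [sq_nonneg x2]) hn.le
  have b2 : |x2| ≤ n := abs_le_of_sq_le_sq (by linarith [sq_nonneg x1]) hn.le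
  have b3 : |y1| ≤ m := abs_le_of_sq_le_sq (by linarith [sq_nonneg y2]) hm.le
  have b4 : |y2| ≤ m := abs_le_of_sq_le_sq (by linarith [sq_nonneg y1]) hm.le
  have fin : 4 * θ * (n' + m') ≤ 16 * θ * N := by
    have : 4 * θ * (n' + m') ≤ 4 * θ * (4 * N) := by
      apply mul_le_mul_of_nonneg_left _ (by positivity)
      linarith
    linarith
  have hy1 : y1' = x1 + y1 - x1' := by linarith
  have hy2 : y2' = x2 + y2 - x2' := by linarith
  refine ⟨(rs_comp (x1 - x1') (x1 * y2 - x2 * y1) (y1' * y2 - y2' * y1) (-(x1' * x2 - x2' * x1)) x1 y1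
    θ n m n' m' h0 hn hm ?_ hX cy (by rwa [abs_neg]) b1 b3 hn'.le hm'.le).trans fin,
    (rs_comp (x2 - x2') (x1 * y2 - x2 * y1) (y1' * y2 - y2' * y1) (-(x1' * x2 - x2' * x1)) x2 y2
    θ n m n' m' h0 hn hm ?_ hX cy (by rwa [abs_neg]) b2 b4 hn'.le hm'.le).trans fin⟩
  · rw [hy1, hy2]; ring
  · rw [hy1, hy2]; ring

/-- **Measure bound for the angularly refined resonance set `M(τ,ξ)`.**
Here `ξ = (μ, i/λ)` and points `ξ₂ = (μ₂, j/λ)` of `ℝ × (1/λ)ℤ` are parametrized by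
`μ₂ : ℝ` and `j : ℤ`; the measure `μ_λ` of a set is `(1/λ) ∑_j Leb` of its horizontal slices. -/
theorem resonance_set_measure : ∃ C : ℝ, 0 < C ∧
    ∀ (lam M θ N₁ N₂ τ μ : ℝ) (i : ℤ) (α₁ α₂ : ℝ),
      1 ≤ lam → 1 ≤ M → 0 < θ → θ ≤ 1 → N₂ ≤ N₁ → 1 < N₂ →
      ENNReal.ofReal (1 / lam) * ∑' j : ℤ, volume {μ₂ : ℝ |
          inSector θ α₁ μ₂ ((j : ℝ) / lam) ∧
          inSector θ α₂ (μ - μ₂) (((i - j : ℤ) : ℝ) / lam) ∧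
          |μ₂ * (μ - μ₂) + ((j : ℝ) / lam) * (((i - j : ℤ) : ℝ) / lam)| ≤
            θ * fnorm lam μ₂ j * fnorm lam (μ - μ₂) (i - j) ∧
          (N₂ ≤ fnorm lam μ₂ j ∧ fnorm lam μ₂ j ≤ 2 * N₂) ∧
          (N₁ ≤ fnorm lam (μ - μ₂) (i - j) ∧ fnorm lam (μ - μ₂) (i - j) ≤ 2 * N₁) ∧
          M ≤ |μ - 2 * μ₂| ∧
          |τ - (μ₂ ^ 2 + ((j : ℝ) / lam) ^ 2)
             - ((μ - μ₂) ^ 2 + (((i - j : ℤ) : ℝ) / lam) ^ 2)| ≤ 1}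
        ≤ ENNReal.ofReal (C * (1 / (lam * M) + θ)) := by
  refine ⟨6000, by norm_num, ?_⟩
  intro lam M θ N₁ N₂ τ μ i α₁ α₂ hlam hM hθ hθ1 hN hN2
  have hl0 : 0 < lam := by linarith
  have hM0 : 0 < M := by linarith
  generalize hS : (fun j : ℤ => {μ₂ : ℝ |
          inSector θ α₁ μ₂ ((j : ℝ) / lam) ∧
          inSector θ α₂ (μ - μ₂) (((i - j : ℤ) : ℝ) / lam) ∧
          |μ₂ * (μ - μ₂) + ((j : ℝ) / lam) * (((i - j : ℤ) : ℝ) / lam)| ≤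
            θ * fnorm lam μ₂ j * fnorm lam (μ - μ₂) (i - j) ∧
          (N₂ ≤ fnorm lam μ₂ j ∧ fnorm lam μ₂ j ≤ 2 * N₂) ∧
          (N₁ ≤ fnorm lam (μ - μ₂) (i - j) ∧ fnorm lam (μ - μ₂) (i - j) ≤ 2 * N₁) ∧
          M ≤ |μ - 2 * μ₂| ∧
          |τ - (μ₂ ^ 2 + ((j : ℝ) / lam) ^ 2)
             - ((μ - μ₂) ^ 2 + (((i - j : ℤ) : ℝ) / lam) ^ 2)| ≤ 1}) = S
  suffices hsuff : ENNReal.ofReal (1 / lam) * ∑' j : ℤ, volume (S j) ≤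
      ENNReal.ofReal (6000 * (1 / (lam * M) + θ)) by
    rw [← hS] at hsuff
    exact hsuff
  by_cases hne : ∃ j, (S j).Nonempty
  swap
  · have : ∀ j, S j = ∅ := fun j => by
      by_contra hc
      exact hne ⟨j, Set.nonempty_iff_ne_empty.mpr hc⟩
    simp [this]
  have hij : ∀ j : ℤ, (((i - j : ℤ) : ℝ) / lam) = (i : ℝ) / lam - (j : ℝ) / lam := by
    intro j; push_cast; ring
  have ann : ∀ j, ∀ x ∈ S j, M ≤ |μ - 2 * x| ∧
      (2 * τ - (μ ^ 2 + ((i : ℝ) / lam) ^ 2) + 2) - 4 ≤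
        (μ - 2 * x) ^ 2 + ((i : ℝ) / lam - 2 / lam * j) ^ 2 ∧
      (μ - 2 * x) ^ 2 + ((i : ℝ) / lam - 2 / lam * j) ^ 2 ≤
        2 * τ - (μ ^ 2 + ((i : ℝ) / lam) ^ 2) + 2 := by
    intro j x hx
    have hxs := hx
    rw [← hS] at hxs
    obtain ⟨-, -, -, -, -, k1, k2⟩ := hxs
    rw [hij] at k2
    rw [show 2 / lam * (j : ℝ) = 2 * (j / lam) by ring]
    obtain ⟨k3, k4⟩ := abs_le.mp k2
    refine ⟨k1, ?_, ?_⟩ <;> nlinarith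
  obtain ⟨j0, x0, hx0⟩ := hne
  generalize hQ : 2 * τ - (μ ^ 2 + ((i : ℝ) / lam) ^ 2) + 2 = Q at ann
  have hQ0 : M ^ 2 ≤ Q := by
    obtain ⟨p1, -, p3⟩ := ann j0 x0 hx0
    have : M ^ 2 ≤ |μ - 2 * x0| ^ 2 := by gcongr
    rw [sq_abs] at this
    nlinarith [sq_nonneg ((i : ℝ) / lam - 2 / lam * j0)]
  have hρ2 : Real.sqrt Q ^ 2 = Q := Real.sq_sqrt (by nlinarith)
  have hρM : M ≤ Real.sqrt Q := Real.le_sqrt_of_sq_le hQ0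
  generalize Real.sqrt Q = ρ at hρ2 hρM
  have hρ : 0 < ρ := by linarith
  obtain ⟨r, hr, hrρ, hpair⟩ : ∃ r : ℝ, 0 < r ∧ r ≤ 64 * θ * ρ ∧
      ∀ j j', ∀ x ∈ S j, ∀ x' ∈ S j', |(μ - 2 * x) - (μ - 2 * x')| ≤ r ∧
        |((i : ℝ) / lam - 2 / lam * j) - ((i : ℝ) / lam - 2 / lam * j')| ≤ r := by
    by_cases hc : θ ≤ 1 / 2
    · have hN1 : 0 < N₁ := by linarith
      have hf : ∀ (x : ℝ) (j : ℤ), fnorm lam x j ^ 2 = x ^ 2 + ((j : ℝ) / lam) ^ 2 := by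
        intro x j
        exact Real.sq_sqrt (by positivity)
      refine ⟨32 * θ * N₁, by positivity, ?_, ?_⟩
      · have hx0s := hx0
        rw [← hS] at hx0s
        obtain ⟨-, -, k3, ⟨k4, k4'⟩, ⟨k5, k5'⟩, -, -⟩ := hx0s
        obtain ⟨-, -, p3⟩ := ann j0 x0 hx0
        have f1 := hf x0 j0
        have f2 := hf (μ - x0) (i - j0)
        rw [hij] at k3 f2
        generalize fnorm lam x0 j0 = n at *
        generalize fnorm lam (μ - x0) (i - j0) = m at *
        rw [show 2 / lam * (j0 : ℝ) = 2 * (j0 / lam) by ring] at p3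
        generalize (j0 : ℝ) / lam = a at *
        generalize (i : ℝ) / lam = b at *
        have id : (μ - 2 * x0) ^ 2 + (b - 2 * a) ^ 2
          = n ^ 2 + m ^ 2 - 2 * (x0 * (μ - x0) + a * (b - a)) := by rw [f1, f2]; ring
        have q1 : x0 * (μ - x0) + a * (b - a) ≤ θ * n * m := (le_abs_self _).trans k3
        have q2 : 0 ≤ n * m := mul_nonneg (by linarith) (by linarith)
        have q3 : θ * n * m ≤ 1 / 2 * (n * m) := by rw [mul_assoc]; gcongr
        have q4 : N₁ ^ 2 ≤ m ^ 2 := by gcongr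
        have q5 : (N₁ / 2) ^ 2 ≤ ρ ^ 2 := by nlinarith [sq_nonneg (n - m)]
        have q6 : N₁ / 2 ≤ ρ := (sq_le_sq₀ (by positivity) hρ.le).1 q5
        nlinarith
      · intro j j' x hx x' hx'
        have hxs := hx
        rw [← hS] at hxs
        obtain ⟨k1, k2, k3, ⟨k4, k4'⟩, ⟨k5, k5'⟩, -, -⟩ := hxs
        have hx's := hx'
        rw [← hS] at hx's
        obtain ⟨l1, l2, l3, ⟨l4, l4'⟩, ⟨l5, l5'⟩, -, -⟩ := hx's
        have g := rs_geo θ α₁ α₂ x (j / lam) (μ - x) (((i - j : ℤ) : ℝ) / lam)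
          x' (j' / lam) (μ - x') (((i - j' : ℤ) : ℝ) / lam) (fnorm lam x j)
          (fnorm lam (μ - x) (i - j)) (fnorm lam x' j') (fnorm lam (μ - x') (i - j')) N₁
          hθ hc (by ring) (by rw [hij, hij]; ring)
          (by linarith) (hf _ _) (by linarith) (hf _ _) (by linarith) (hf _ _) (by linarith) (hf _ _)
          k1 l1 k2 l2 k3 (by linarith) (by linarith)
        obtain ⟨g1, g2⟩ := g
        rw [show (μ - 2 * x) - (μ - 2 * x') = -2 * (x - x') by ring,
          show ((i : ℝ) / lam - 2 / lam * j) - ((i : ℝ) / lam - 2 / lam * j')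
            = -2 * (j / lam - j' / lam) by ring, abs_mul, abs_mul]
        norm_num
        constructor <;> linarith
    · push Not at hc
      refine ⟨2 * ρ, by positivity, by nlinarith, ?_⟩
      intro j j' x hx x' hx'
      obtain ⟨-, -, p⟩ := ann j x hx
      obtain ⟨-, -, p'⟩ := ann j' x' hx'
      rw [← hρ2] at p p'
      have t1 := abs_le.mp (abs_le_of_sq_le_sq (a := μ - 2 * x) (b := ρ)
        (by nlinarith [sq_nonneg ((i : ℝ) / lam - 2 / lam * j)]) hρ.le)
      have t2 := abs_le.mp (abs_le_of_sq_le_sq (a := μ - 2 * x') (b := ρ)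
        (by nlinarith [sq_nonneg ((i : ℝ) / lam - 2 / lam * j')]) hρ.le)
      have t3 := abs_le.mp (abs_le_of_sq_le_sq (a := (i : ℝ) / lam - 2 / lam * j) (b := ρ)
        (by nlinarith [sq_nonneg (μ - 2 * x)]) hρ.le)
      have t4 := abs_le.mp (abs_le_of_sq_le_sq (a := (i : ℝ) / lam - 2 / lam * j') (b := ρ)
        (by nlinarith [sq_nonneg (μ - 2 * x')]) hρ.le)
      constructor <;> rw [abs_le] <;> constructor <;> linarith
  have main := rs_D S (2 / lam) (i / lam) ρ M r (fun x => μ - 2 * x)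
    (fun j => (i : ℝ) / lam - 2 / lam * j) (by positivity) hρ hM hr
    (fun x y => by
      rw [show (μ - 2 * x) - (μ - 2 * y) = -2 * (x - y) by ring, abs_mul]
      norm_num
      linarith [abs_nonneg (x - y)]) (fun j => rfl)
    (fun j x hx => by rw [hρ2]; exact ann j x hx) hpair
  refine (mul_le_mul_right main _).trans ?_
  rw [← ENNReal.ofReal_mul (by positivity)]
  apply ENNReal.ofReal_le_ofReal
  have e1 : 1 / lam * (180 * (r / (2 / lam * ρ)) + 36 / M) = 90 * (r / ρ) + 36 * (1 / (lam * M)) := by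
    field_simp
    ring
  have e2 : r / ρ ≤ 64 * θ := by rw [div_le_iff₀ hρ]; exact hrρ
  have e3 : 0 < 1 / (lam * M) := by positivity
  rw [e1]
  linarith
end
end

section
/- There is an absolute constant C > 0 such that for all λ ≥ 1, M ≥ 1, reals N₁ ≥ N₂ > 1, all τ ∈ ℝ and all ξ = (μ,η) ∈ ℝ×(1/λ)ℤ, the set M₁(τ,ξ) of all ξ₂ = (μ₂,η₂) ∈ ℝ×(1/λ)ℤ satisfying N₂ ≤ |ξ₂| ≤ 2N₂, N₁ ≤ |ξ−ξ₂| ≤ 2N₁, |μ − 2μ₂| ≥ M, and |τ − |ξ₂|² − |ξ−ξ₂|²| ≤ 1, has measure μ_λ(M₁(τ,ξ)) ≤ C (1/(λM) + N₂/M). -/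
noncomputable section
open MeasureTheory
open scoped ENNReal Classical

lemma half_slice (M A μ s : ℝ) (hM : 1 ≤ M) (hs : s = 1 ∨ s = -1) :
    volume {x : ℝ | M ≤ s * (μ - 2 * x) ∧ |A - (μ - 2 * x) ^ 2 / 2| ≤ 1}
      ≤ ENNReal.ofReal (1 / M) := by
  refine (Real.volume_le_diam _).trans (Metric.ediam_le ?_)
  rintro x ⟨hx1, hx2⟩ y ⟨hy1, hy2⟩
  rw [edist_dist, Real.dist_eq]
  apply ENNReal.ofReal_le_ofReal
  have hM0 : 0 < M := by linarith
  rw [le_div_iff₀ hM0]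
  rw [abs_le] at hx2 hy2
  have hsum : 2 * M ≤ |(μ - 2 * x) + (μ - 2 * y)| := by
    rcases hs with rfl | rfl
    · exact le_trans (by linarith) (le_abs_self _)
    · exact le_trans (by linarith) (neg_le_abs _)
  have hprod : |x - y| * |(μ - 2 * x) + (μ - 2 * y)| ≤ 2 := by
    rw [← abs_mul, abs_le]
    constructor <;> nlinarith
  nlinarith [abs_nonneg (x - y)]

lemma slice (M A μ : ℝ) (hM : 1 ≤ M) :
    volume {x : ℝ | M ≤ |μ - 2 * x| ∧ |A - (μ - 2 * x) ^ 2 / 2| ≤ 1}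
      ≤ ENNReal.ofReal (2 / M) := by
  have h1 := half_slice M A μ 1 hM (Or.inl rfl)
  have h2 := half_slice M A μ (-1) hM (Or.inr rfl)
  have hM0 : 0 < M := by linarith
  have e : (2 : ℝ) / M = 1 / M + 1 / M := by ring
  rw [e, ENNReal.ofReal_add (by positivity) (by positivity)]
  refine le_trans (le_trans (measure_mono ?_) (measure_union_le _ _)) (add_le_add h1 h2)
  rintro x ⟨hx1, hx2⟩
  rcases le_abs.1 hx1 with h | h
  · left; exact ⟨by linarith, hx2⟩
  · right; exact ⟨by linarith, hx2⟩

/-- **Measure bound for the resonance set `M₁(τ,ξ)` (no angular restriction).**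
Here `ξ = (μ, i/λ)` and points `ξ₂ = (μ₂, j/λ)` of `ℝ × (1/λ)ℤ` are parametrized by
`μ₂ : ℝ` and `j : ℤ`; the measure `μ_λ` of a set is `(1/λ) ∑_j Leb` of its horizontal slices. -/
theorem resonance_set_measure_no_angle : ∃ C : ℝ, 0 < C ∧
    ∀ (lam M N₁ N₂ τ μ : ℝ) (i : ℤ),
      1 ≤ lam → 1 ≤ M → N₂ ≤ N₁ → 1 < N₂ →
      ENNReal.ofReal (1 / lam) * ∑' j : ℤ, volume {μ₂ : ℝ |
          (N₂ ≤ fnorm lam μ₂ j ∧ fnorm lam μ₂ j ≤ 2 * N₂) ∧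
          (N₁ ≤ fnorm lam (μ - μ₂) (i - j) ∧ fnorm lam (μ - μ₂) (i - j) ≤ 2 * N₁) ∧
          M ≤ |μ - 2 * μ₂| ∧
          |τ - (μ₂ ^ 2 + ((j : ℝ) / lam) ^ 2)
             - ((μ - μ₂) ^ 2 + (((i - j : ℤ) : ℝ) / lam) ^ 2)| ≤ 1}
        ≤ ENNReal.ofReal (C * (1 / (lam * M) + N₂ / M)) := by
  refine ⟨8, by norm_num, ?_⟩
  intro lam M N₁ N₂ τ μ i hl hM hN hN2
  have hl0 : 0 < lam := by linarith
  have hM0 : 0 < M := by linarith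
  set n : ℤ := ⌊2 * N₂ * lam⌋ with hn
  have hn0 : 0 ≤ n := Int.floor_nonneg.2 (by positivity)
  have hnle : (n : ℝ) ≤ 2 * N₂ * lam := Int.floor_le _
  rw [tsum_eq_sum (s := Finset.Icc (-n) n)]
  · have hb : ∀ j ∈ Finset.Icc (-n) n, volume {μ₂ : ℝ |
          (N₂ ≤ fnorm lam μ₂ j ∧ fnorm lam μ₂ j ≤ 2 * N₂) ∧
          (N₁ ≤ fnorm lam (μ - μ₂) (i - j) ∧ fnorm lam (μ - μ₂) (i - j) ≤ 2 * N₁) ∧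
          M ≤ |μ - 2 * μ₂| ∧
          |τ - (μ₂ ^ 2 + ((j : ℝ) / lam) ^ 2)
             - ((μ - μ₂) ^ 2 + (((i - j : ℤ) : ℝ) / lam) ^ 2)| ≤ 1}
          ≤ ENNReal.ofReal (2 / M) := by
      intro j _
      refine (measure_mono ?_).trans (slice M
        (τ - ((j : ℝ) / lam) ^ 2 - (((i - j : ℤ) : ℝ) / lam) ^ 2 - μ ^ 2 / 2) μ hM)
      rintro x ⟨-, -, h1, h2⟩
      refine ⟨h1, ?_⟩
      convert h2 using 2
      ring
    refine (mul_le_mul_right (Finset.sum_le_card_nsmul _ _ _ hb) _).trans ?_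
    rw [nsmul_eq_mul, ← ENNReal.ofReal_natCast, ← ENNReal.ofReal_mul (by positivity),
      ← ENNReal.ofReal_mul (by positivity)]
    apply ENNReal.ofReal_le_ofReal
    have hc : ((Finset.Icc (-n) n).card : ℝ) = 2 * n + 1 := by
      rw [Int.card_Icc]
      have : ((n + 1 - -n).toNat : ℤ) = 2 * n + 1 := by omega
      exact_mod_cast this
    rw [hc]
    calc 1 / lam * ((2 * (n : ℝ) + 1) * (2 / M))
        ≤ 1 / lam * ((2 * (2 * N₂ * lam) + 1) * (2 / M)) := by gcongr
      _ = 2 * (1 / (lam * M)) + 8 * (N₂ / M) := by field_simp; ring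
      _ ≤ 8 * (1 / (lam * M) + N₂ / M) := by
        have : 0 < 1 / (lam * M) := by positivity
        linarith
  · intro j hj
    rw [show {μ₂ : ℝ | _} = (∅ : Set ℝ) from ?_, measure_empty]
    rw [Set.eq_empty_iff_forall_notMem]
    rintro x ⟨⟨-, h⟩, -⟩
    apply hj
    have h1 : |(j : ℝ) / lam| ≤ 2 * N₂ := by
      refine le_trans ?_ h
      exact Real.abs_le_sqrt (by nlinarith [sq_nonneg x])
    rw [abs_div, abs_of_pos hl0, div_le_iff₀ hl0] at h1
    have h2 : |j| ≤ n := Int.le_floor.2 (by push_cast; exact h1)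
    rw [Finset.mem_Icc]
    exact abs_le.1 h2
end
end

section
/- There exist constants C > 0 and c₀ ∈ (0,1) such that for all λ ≥ 1, M ≥ 1, 0 < θ ≤ 1, reals N₁, N₂ with 1 < N₂ ≤ c₀N₁, all τ ∈ ℝ, all angles α ∈ ℝ, and all ξ = (μ,η) ∈ ℝ×(1/λ)ℤ with |μ| ≥ M, the set of all ξ₂ = (μ₂,η₂) ∈ ℝ×(1/λ)ℤ satisfying: (i) ξ−ξ₂ lies in the sector of aperture θ about α; (ii) N₁ ≤ |ξ−ξ₂| ≤ 2N₁ and N₂ ≤ |ξ₂| ≤ 2N₂; (iii) |τ − |ξ−ξ₂|² + |ξ₂|²| ≤ 1, has measure μ_λ at most C (1/(λM) + N₁θ/M). -/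
noncomputable section
open MeasureTheory
open scoped ENNReal Classical

theorem osr_polar (θ α x y N : ℝ) (h0 : 0 < θ) (h1 : θ ≤ 1) (h : inSector θ α x y)
    (hN : Real.sqrt (x ^ 2 + y ^ 2) ≤ 2 * N) :
    |x * Real.cos α + y * Real.sin α| ≤ 2 * N ∧
    |x * Real.sin α - y * Real.cos α| ≤ 2 * N * θ := by
  unfold inSector at h
  set r := Real.sqrt (x ^ 2 + y ^ 2) with hr
  have hr0 : 0 ≤ r := Real.sqrt_nonneg _
  have hr2 : r ^ 2 = x ^ 2 + y ^ 2 := Real.sq_sqrt (by positivity)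
  have hcs := Real.sin_sq_add_cos_sq α
  have hcs' := Real.sin_sq_add_cos_sq θ
  have hc : 0 ≤ Real.cos θ :=
    Real.cos_nonneg_of_neg_pi_div_two_le_of_le (by linarith [Real.pi_gt_three])
      (by linarith [Real.pi_gt_three])
  have hs0 : 0 ≤ Real.sin θ := Real.sin_nonneg_of_nonneg_of_le_pi h0.le
      (by linarith [Real.pi_gt_three])
  have hs : Real.sin θ ≤ θ := Real.sin_le h0.le
  set p := x * Real.cos α + y * Real.sin α with hp
  set q := x * Real.sin α - y * Real.cos α with hq
  have hpq : p ^ 2 + q ^ 2 = r ^ 2 := by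
    rw [hr2, hp, hq]; linear_combination (x ^ 2 + y ^ 2) * hcs
  have hrc : 0 ≤ r * Real.cos θ := by positivity
  constructor
  · refine le_trans ?_ hN
    exact abs_le_of_sq_le_sq (by nlinarith [sq_nonneg q]) hr0
  · have h2 : q ^ 2 ≤ (r * Real.sin θ) ^ 2 := by
      have : (r * Real.cos θ) ^ 2 ≤ p ^ 2 := pow_le_pow_left₀ hrc h 2
      have e : (r * Real.sin θ) ^ 2 + (r * Real.cos θ) ^ 2 = r ^ 2 := by
        linear_combination r ^ 2 * hcs'
      linarith
    calc |q| ≤ r * Real.sin θ := abs_le_of_sq_le_sq h2 (by positivity)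
      _ ≤ 2 * N * θ := mul_le_mul hN hs hs0 (hr0.trans hN)

theorem osr_cross (θ α x y x' y' N : ℝ) (h0 : 0 < θ) (h1 : θ ≤ 1) (h : inSector θ α x y)
    (h' : inSector θ α x' y') (hN : Real.sqrt (x ^ 2 + y ^ 2) ≤ 2 * N)
    (hN' : Real.sqrt (x' ^ 2 + y' ^ 2) ≤ 2 * N) :
    |x * y' - y * x'| ≤ 8 * N ^ 2 * θ := by
  obtain ⟨a, b⟩ := osr_polar θ α x y N h0 h1 h hN
  obtain ⟨a', b'⟩ := osr_polar θ α x' y' N h0 h1 h' hN'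
  have hcs := Real.sin_sq_add_cos_sq α
  have e : x * y' - y * x' =
    (x * Real.sin α - y * Real.cos α) * (x' * Real.cos α + y' * Real.sin α)
    - (x * Real.cos α + y * Real.sin α) * (x' * Real.sin α - y' * Real.cos α) := by
    linear_combination (-(x * y' - y * x')) * hcs
  have n0 : 0 ≤ 2 * N := (abs_nonneg _).trans a
  rw [e]
  refine (abs_sub _ _).trans ?_
  rw [abs_mul, abs_mul]
  have u1 := mul_le_mul b a' (abs_nonneg _) ((abs_nonneg _).trans b)
  have u2 := mul_le_mul a b' (abs_nonneg _) n0
  nlinarith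

/-- Geometric core for a pair of points. -/
theorem osr_pair (θ α N₁ N₂ τ m η a b a' b' : ℝ) (h0 : 0 < θ) (h1 : θ ≤ 1)
    (hN2 : 1 < N₂) (hN : N₂ ≤ 1 / 8 * N₁)
    (s : inSector θ α (m - a) (η - b)) (s' : inSector θ α (m - a') (η - b'))
    (l : N₁ ≤ Real.sqrt ((m - a) ^ 2 + (η - b) ^ 2))
    (u : Real.sqrt ((m - a) ^ 2 + (η - b) ^ 2) ≤ 2 * N₁)
    (u' : Real.sqrt ((m - a') ^ 2 + (η - b') ^ 2) ≤ 2 * N₁)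
    (w : Real.sqrt (a ^ 2 + b ^ 2) ≤ 2 * N₂)
    (t : |τ - ((m - a) ^ 2 + (η - b) ^ 2) + (a ^ 2 + b ^ 2)| ≤ 1)
    (t' : |τ - ((m - a') ^ 2 + (η - b') ^ 2) + (a' ^ 2 + b' ^ 2)| ≤ 1) :
    |m| ≤ 3 * N₁ ∧ |m * (a' - a) + η * (b' - b)| ≤ 1 ∧
    |(m - a) * (b' - b) - (η - b) * (a' - a)| ≤ 8 * N₁ ^ 2 * θ ∧
    |b' - b| ≤ 48 * N₁ * θ + 2 * |η - b| / N₁ ^ 2 := by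
  have hN1 : 0 < N₁ := by linarith
  have A : |m * (a' - a) + η * (b' - b)| ≤ 1 := by
    rw [abs_le] at *
    constructor <;> nlinarith
  have B : |(m - a) * (b' - b) - (η - b) * (a' - a)| ≤ 8 * N₁ ^ 2 * θ := by
    have := osr_cross θ α _ _ _ _ N₁ h0 h1 s s' u u'
    rw [← abs_neg]
    convert this using 2
    ring
  have ha : |a| ≤ 2 * N₂ := (Real.abs_le_sqrt (by nlinarith [sq_nonneg b])).trans w
  have hma : |m - a| ≤ 2 * N₁ := (Real.abs_le_sqrt (by nlinarith [sq_nonneg (η - b)])).trans u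
  have hm : |m| ≤ 3 * N₁ := by
    rw [abs_le] at *
    constructor <;> linarith
  refine ⟨hm, A, B, ?_⟩
  set r := Real.sqrt ((m - a) ^ 2 + (η - b) ^ 2) with hr
  set ρ := Real.sqrt (a ^ 2 + b ^ 2) with hρ
  have hr2 : r ^ 2 = (m - a) ^ 2 + (η - b) ^ 2 := Real.sq_sqrt (by positivity)
  have hρ2 : ρ ^ 2 = a ^ 2 + b ^ 2 := Real.sq_sqrt (by positivity)
  have hρ0 : 0 ≤ ρ := Real.sqrt_nonneg _
  have hr0 : 0 ≤ r := Real.sqrt_nonneg _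
  have cs : |a * (m - a) + b * (η - b)| ≤ ρ * r := by
    apply abs_le_of_sq_le_sq _ (by positivity)
    rw [mul_pow, hr2, hρ2]
    nlinarith [sq_nonneg (a * (η - b) - b * (m - a))]
  have hdot : N₁ ^ 2 / 2 ≤ m * (m - a) + η * (η - b) := by
    have e : m * (m - a) + η * (η - b) = r ^ 2 + (a * (m - a) + b * (η - b)) := by
      rw [hr2]; ring
    have c1 := (abs_le.1 cs).1
    have c2 : ρ ≤ N₁ / 4 := by linarith
    have c3 : ρ * r ≤ N₁ / 4 * r := mul_le_mul_of_nonneg_right c2 hr0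
    rw [e]
    nlinarith
  have key : (b' - b) * (m * (m - a) + η * (η - b)) =
      m * ((m - a) * (b' - b) - (η - b) * (a' - a))
      + (η - b) * (m * (a' - a) + η * (b' - b)) := by ring
  have k2 : |b' - b| * (N₁ ^ 2 / 2) ≤ 3 * N₁ * (8 * N₁ ^ 2 * θ) + |η - b| * 1 := by
    calc |b' - b| * (N₁ ^ 2 / 2) ≤ |b' - b| * |m * (m - a) + η * (η - b)| :=
          mul_le_mul_of_nonneg_left (hdot.trans (le_abs_self _)) (abs_nonneg _)
      _ = |m * ((m - a) * (b' - b) - (η - b) * (a' - a))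
      + (η - b) * (m * (a' - a) + η * (b' - b))| := by rw [← abs_mul, key]
      _ ≤ _ := by
        refine (abs_add_le _ _).trans ?_
        rw [abs_mul, abs_mul]
        gcongr
  have e2 : 48 * N₁ * θ + 2 * |η - b| / N₁ ^ 2 =
      (3 * N₁ * (8 * N₁ ^ 2 * θ) + |η - b| * 1) / (N₁ ^ 2 / 2) := by
    field_simp
    ring
  rw [e2, le_div_iff₀ (by positivity)]
  exact k2

/-- Summation step. -/
theorem osr_sum (S : ℤ → Set ℝ) (lam L R : ℝ) (j0 : ℤ) (hl : 1 ≤ lam) (hL : 0 ≤ L) (hR : 0 ≤ R)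
    (hd : ∀ j, ∀ a ∈ S j, ∀ b ∈ S j, |a - b| ≤ L)
    (hj : ∀ j, ∀ a ∈ S j, |(j : ℝ) / lam - (j0 : ℝ) / lam| ≤ R) :
    ENNReal.ofReal (1 / lam) * ∑' j : ℤ, volume (S j) ≤
      ENNReal.ofReal (L / lam + 2 * R * L) := by
  have hl0 : 0 < lam := by linarith
  set F := Finset.Icc ⌈(j0 : ℝ) - lam * R⌉ ⌊(j0 : ℝ) + lam * R⌋ with hF
  have hout : ∀ j ∉ F, volume (S j) = 0 := by
    intro j hjF
    have : S j = ∅ := by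
      rw [Set.eq_empty_iff_forall_notMem]
      intro a ha
      apply hjF
      have h := hj j a ha
      rw [← sub_div, abs_div, abs_of_pos hl0, div_le_iff₀ hl0, abs_le] at h
      rw [hF, Finset.mem_Icc, Int.ceil_le, Int.le_floor]
      constructor <;> nlinarith [h.1, h.2]
    rw [this, measure_empty]
  have hin : ∀ j, volume (S j) ≤ ENNReal.ofReal L := by
    intro j
    refine (Real.volume_le_diam _).trans (Metric.ediam_le ?_)
    intro a ha b hb
    rw [edist_dist, Real.dist_eq]
    exact ENNReal.ofReal_le_ofReal (hd j a ha b hb)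
  rw [tsum_eq_sum hout]
  have hcard : (F.card : ℝ) ≤ 2 * lam * R + 1 := by
    have hp : 0 ≤ lam * R := by positivity
    have hle : ⌈(j0 : ℝ) - lam * R⌉ ≤ ⌊(j0 : ℝ) + lam * R⌋ + 1 := by
      have h1 : ⌈(j0 : ℝ) - lam * R⌉ ≤ j0 := Int.ceil_le.2 (by linarith)
      have h2 : j0 ≤ ⌊(j0 : ℝ) + lam * R⌋ := Int.le_floor.2 (by linarith)
      omega
    have hc : ((F.card : ℤ) : ℝ) = ((⌊(j0 : ℝ) + lam * R⌋ + 1 - ⌈(j0 : ℝ) - lam * R⌉ : ℤ) : ℝ) := by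
      rw [hF, Int.card_Icc_of_le _ _ hle]
    push_cast at hc
    rw [hc]
    have := Int.floor_le ((j0 : ℝ) + lam * R)
    have := Int.le_ceil ((j0 : ℝ) - lam * R)
    linarith
  calc ENNReal.ofReal (1 / lam) * ∑ j ∈ F, volume (S j)
      ≤ ENNReal.ofReal (1 / lam) * ∑ j ∈ F, ENNReal.ofReal L := by
        gcongr with j _
        exact hin j
    _ = ENNReal.ofReal (1 / lam * (F.card * L)) := by
        rw [Finset.sum_const, nsmul_eq_mul, ENNReal.ofReal_mul (by positivity),
          ENNReal.ofReal_mul (by positivity), ENNReal.ofReal_natCast]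
    _ ≤ _ := by
        apply ENNReal.ofReal_le_ofReal
        calc 1 / lam * (F.card * L) ≤ 1 / lam * ((2 * lam * R + 1) * L) := by gcongr
          _ = _ := by field_simp; ring

/-- **Measure bound for the one-sector resonance set `M̃(τ,ξ)`.**
Here `ξ = (μ, i/λ)` with `|μ| ≥ M`, and points `ξ₂ = (μ₂, j/λ)` of `ℝ × (1/λ)ℤ` are
parametrized by `μ₂ : ℝ` and `j : ℤ`; the measure `μ_λ` of a set is `(1/λ) ∑_j Leb` of its
horizontal slices. -/
theorem one_sector_resonance_set_measure : ∃ (C c₀ : ℝ), 0 < C ∧ 0 < c₀ ∧ c₀ < 1 ∧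
    ∀ (lam M θ N₁ N₂ τ α μ : ℝ) (i : ℤ),
      1 ≤ lam → 1 ≤ M → 0 < θ → θ ≤ 1 → 1 < N₂ → N₂ ≤ c₀ * N₁ → M ≤ |μ| →
      ENNReal.ofReal (1 / lam) * ∑' j : ℤ, volume {μ₂ : ℝ |
          inSector θ α (μ - μ₂) (((i - j : ℤ) : ℝ) / lam) ∧
          (N₁ ≤ fnorm lam (μ - μ₂) (i - j) ∧ fnorm lam (μ - μ₂) (i - j) ≤ 2 * N₁) ∧
          (N₂ ≤ fnorm lam μ₂ j ∧ fnorm lam μ₂ j ≤ 2 * N₂) ∧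
          |τ - ((μ - μ₂) ^ 2 + (((i - j : ℤ) : ℝ) / lam) ^ 2)
             + (μ₂ ^ 2 + ((j : ℝ) / lam) ^ 2)| ≤ 1}
        ≤ ENNReal.ofReal (C * (1 / (lam * M) + N₁ * θ / M)) := by
  refine ⟨192, 1 / 8, by norm_num, by norm_num, by norm_num, ?_⟩
  intro lam M θ N₁ N₂ τ α m i hl hM h0 h1 hN2 hN hm
  have hl0 : 0 < lam := by linarith
  have hM0 : 0 < M := by linarith
  have hN1 : 0 < N₁ := by linarith
  set S : ℤ → Set ℝ := fun j => {μ₂ : ℝ |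
          inSector θ α (m - μ₂) (((i - j : ℤ) : ℝ) / lam) ∧
          (N₁ ≤ fnorm lam (m - μ₂) (i - j) ∧ fnorm lam (m - μ₂) (i - j) ≤ 2 * N₁) ∧
          (N₂ ≤ fnorm lam μ₂ j ∧ fnorm lam μ₂ j ≤ 2 * N₂) ∧
          |τ - ((m - μ₂) ^ 2 + (((i - j : ℤ) : ℝ) / lam) ^ 2)
             + (μ₂ ^ 2 + ((j : ℝ) / lam) ^ 2)| ≤ 1} with hS
  change ENNReal.ofReal (1 / lam) * ∑' j : ℤ, volume (S j) ≤ _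
  have hpair : ∀ j, ∀ a ∈ S j, ∀ j', ∀ a' ∈ S j',
      |m| ≤ 3 * N₁ ∧ |m * (a' - a) + (i / lam : ℝ) * ((j' : ℝ) / lam - (j : ℝ) / lam)| ≤ 1 ∧
    |(m - a) * ((j' : ℝ) / lam - (j : ℝ) / lam) - (i / lam - j / lam : ℝ) * (a' - a)|
      ≤ 8 * N₁ ^ 2 * θ ∧
    |(j' : ℝ) / lam - (j : ℝ) / lam| ≤ 48 * N₁ * θ + 2 * |(i / lam - j / lam : ℝ)| / N₁ ^ 2 := by
    intro j a ha j' a' ha'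
    simp only [hS, Set.mem_ofPred_eq, fnorm, Int.cast_sub, sub_div] at ha ha'
    obtain ⟨s, ⟨l, u⟩, ⟨_, w⟩, t⟩ := ha
    obtain ⟨s', ⟨l', u'⟩, ⟨_, w'⟩, t'⟩ := ha'
    exact osr_pair θ α N₁ N₂ τ m _ a _ a' _ h0 h1 hN2 hN s s' l u u' w t t'
  by_cases hne : ∃ n : ℕ, ∃ j : ℤ, (i - j).natAbs = n ∧ (S j).Nonempty
  · obtain ⟨j0, hj0, a0, ha0⟩ := Nat.find_spec hne
    have hmin : ∀ j, (S j).Nonempty → |(i / lam - j0 / lam : ℝ)| ≤ |(i / lam - j / lam : ℝ)| := by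
      intro j hj
      have h := Nat.find_min' hne ⟨j, rfl, hj⟩
      rw [← hj0] at h
      have h2 : |i - j0| ≤ |i - j| := by
        rw [Int.abs_eq_natAbs, Int.abs_eq_natAbs]; exact_mod_cast h
      have h3 : |(i - j0 : ℝ)| ≤ |(i - j : ℝ)| := by exact_mod_cast h2
      rw [← sub_div, ← sub_div, abs_div, abs_div]
      gcongr
    set V := |(i / lam - j0 / lam : ℝ)| with hV
    have hV0 : 0 ≤ V := abs_nonneg _
    have hm3 : |m| ≤ 3 * N₁ := (hpair j0 a0 ha0 j0 a0 ha0).1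
    obtain ⟨L, hL0, hLM, hLV, hLd⟩ : ∃ L : ℝ, 0 ≤ L ∧ L ≤ 1 / M ∧ L * V ≤ 8 * N₁ ^ 2 * θ ∧
        ∀ j, ∀ a ∈ S j, ∀ b ∈ S j, |a - b| ≤ L := by
      have d1 : ∀ j, ∀ a ∈ S j, ∀ b ∈ S j, |a - b| ≤ 1 / M := by
        intro j a ha b hb
        have h := (hpair j b hb j a ha).2.1
        rw [sub_self, mul_zero, add_zero, abs_mul] at h
        rw [le_div_iff₀ hM0]
        nlinarith [abs_nonneg (a - b)]
      have d2 : ∀ j, ∀ a ∈ S j, ∀ b ∈ S j, |a - b| * V ≤ 8 * N₁ ^ 2 * θ := by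
        intro j a ha b hb
        have h := (hpair j b hb j a ha).2.2.1
        rw [sub_self, mul_zero, zero_sub, abs_neg, abs_mul] at h
        have := hmin j ⟨a, ha⟩
        nlinarith [abs_nonneg (a - b)]
      rcases hV0.eq_or_lt with hz | hpos
      · exact ⟨1 / M, by positivity, le_rfl, by rw [← hz, mul_zero]; positivity, d1⟩
      · refine ⟨min (1 / M) (8 * N₁ ^ 2 * θ / V), by positivity, min_le_left _ _, ?_, ?_⟩
        · rw [← le_div_iff₀ hpos]; exact min_le_right _ _
        · intro j a ha b hb
          refine le_min (d1 j a ha b hb) ?_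
          rw [le_div_iff₀ hpos]
          exact d2 j a ha b hb
    refine (osr_sum S lam L (48 * N₁ * θ + 2 * V / N₁ ^ 2) j0 hl hL0 (by positivity) hLd ?_).trans ?_
    · intro j a ha
      exact (hpair j0 a0 ha0 j a ha).2.2.2
    · apply ENNReal.ofReal_le_ofReal
      have e1 : L / lam ≤ 1 / (lam * M) := by
        calc L / lam ≤ (1 / M) / lam := by gcongr
          _ = _ := by field_simp
      have e2 : 96 * N₁ * θ * L ≤ 96 * (N₁ * θ / M) := by
        calc 96 * N₁ * θ * L ≤ 96 * N₁ * θ * (1 / M) := by gcongr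
          _ = _ := by ring
      have e3 : 4 * (L * V / N₁ ^ 2) ≤ 32 * θ := by
        have : L * V / N₁ ^ 2 ≤ 8 * θ := by
          rw [div_le_iff₀ (by positivity)]; linarith
        linarith
      have e4 : θ ≤ 3 * (N₁ * θ / M) := by
        rw [← mul_div_assoc, le_div_iff₀ hM0]
        nlinarith
      have e5 : 2 * (48 * N₁ * θ + 2 * V / N₁ ^ 2) * L =
        96 * N₁ * θ * L + 4 * (L * V / N₁ ^ 2) := by ring
      have e6 : 0 ≤ 1 / (lam * M) := by positivity
      rw [e5]
      linarith
  · have hz : ∀ j, volume (S j) = 0 := by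
      intro j
      have : S j = ∅ := by
        by_contra hc
        exact hne ⟨_, j, rfl, Set.nonempty_iff_ne_empty.2 hc⟩
      rw [this, measure_empty]
    simp [hz]
end
end
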